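/- The Riemann hypothesis holds if and only if ∫_2^x (π(t) − li(t)) dt < 0 for every real x > 2. -/

import Mathlib

open MeasureTheory Filter

/-- `primePi x` is the number of primes `p ≤ x`. -/
noncomputable def primePi (x : ℝ) : ℝ := Nat.primeCounting ⌊x⌋₊

/-- `li x` is the logarithmic integral, defined for `x > 1` as the Cauchy principal value
`lim_{ε→0⁺} (∫_0^{1-ε} du/log u + ∫_{1+ε}^x du/log u)`. -/
noncomputable def li (x : ℝ) : ℝ :=
  limUnder (nhdsWithin (0:ℝ) (Set.Ioi 0)) (fun ε =>
    (∫ u in (0:ℝ)..(1 - ε), 1 / Real.log u) + ∫ u in (1 + ε)..x, 1 / Real.log u)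

namespace RHPi

/-! ## Part 1: the zeta function on `Re s > 0` -/
section zeta
open Complex Set Topology Asymptotics

/-- Truncated fractional part. -/
noncomputable def fr (x : ℝ) : ℂ := indicator (Ioi (1:ℝ)) (fun x => ((Int.fract x : ℝ) : ℂ)) x

lemma norm_fr_le (x : ℝ) : ‖fr x‖ ≤ 1 := by
  unfold fr
  by_cases h : x ∈ Ioi (1:ℝ)
  · rw [indicator_of_mem h, norm_real, Real.norm_eq_abs, abs_of_nonneg (Int.fract_nonneg x)]
    exact (Int.fract_lt_one x).le
  · simp [indicator_of_notMem h]

lemma measurable_fr : Measurable fr := by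
  unfold fr
  apply Measurable.indicator _ measurableSet_Ioi
  exact measurable_ofReal.comp measurable_fract

lemma locallyIntegrableOn_fr : LocallyIntegrableOn fr (Ioi 0) := by
  apply LocallyIntegrable.locallyIntegrableOn
  intro x
  refine ⟨Metric.ball x 1, Metric.ball_mem_nhds _ one_pos, ?_⟩
  refine Measure.integrableOn_of_bounded (M := 1) ?_ measurable_fr.aestronglyMeasurable ?_
  · exact measure_ball_lt_top.ne
  · exact Eventually.of_forall norm_fr_le

/-- `E s = ∫_1^∞ {x} x^{-s-1} dx`. -/
noncomputable def EE (s : ℂ) : ℂ := mellin fr (-s)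

lemma fr_top : fr =O[atTop] (fun x : ℝ => x ^ (-(0:ℝ))) := by
  refine IsBigO.of_bound 1 (Eventually.of_forall fun x => ?_)
  simpa using norm_fr_le x

lemma fr_bot (b : ℝ) : fr =O[𝓝[>] 0] (fun x : ℝ => x ^ (-b)) := by
  refine IsBigO.of_bound 1 ?_
  have : ∀ᶠ x : ℝ in 𝓝[>] 0, x < 1 := nhdsWithin_le_nhds (Iio_mem_nhds one_pos)
  filter_upwards [this] with x hx
  rw [fr, indicator_of_notMem (by simpa using hx.le)]
  simp

lemma EE_conv {s : ℂ} (hs : 0 < s.re) : MellinConvergent fr (-s) :=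
  mellinConvergent_of_isBigO_rpow locallyIntegrableOn_fr fr_top (by simpa using hs)
    (fr_bot (-s.re - 1)) (by simp)

lemma EE_diff {s : ℂ} (hs : 0 < s.re) : DifferentiableAt ℂ EE s := by
  have := mellin_differentiableAt_of_isBigO_rpow (s := -s) locallyIntegrableOn_fr fr_top
    (by simpa using hs) (fr_bot (-s.re - 1)) (by simp)
  exact this.comp s differentiable_neg.differentiableAt

lemma EE_eq (s : ℂ) :
    EE s = ∫ x in Ioi (1:ℝ), ((Int.fract x : ℝ) : ℂ) * (x:ℂ) ^ (-s - 1) := by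
  unfold EE mellin
  rw [show (∫ x in Ioi (1:ℝ), ((Int.fract x : ℝ) : ℂ) * (x:ℂ) ^ (-s - 1)) =
    ∫ x in Ioi (0:ℝ) ∩ Ioi 1, ((Int.fract x : ℝ) : ℂ) * (x:ℂ) ^ (-s - 1) by
      rw [Ioi_inter_Ioi]; simp]
  rw [← setIntegral_indicator measurableSet_Ioi]
  refine setIntegral_congr_fun measurableSet_Ioi fun x _ => ?_
  simp only [fr, indicator, smul_eq_mul]
  split_ifs <;> ring

lemma EE_norm {s : ℂ} (hs : 0 < s.re) : ‖EE s‖ ≤ 1 / s.re := by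
  rw [EE_eq]
  have h1 : ∫ x in Ioi (1:ℝ), x ^ (-s.re - 1) = 1 / s.re := by
    rw [integral_Ioi_rpow_of_lt (by linarith) one_pos]
    rw [Real.one_rpow, show -s.re - 1 + 1 = -s.re by ring, neg_div_neg_eq]
  rw [← h1]
  refine norm_integral_le_of_norm_le (integrableOn_Ioi_rpow_of_lt (by linarith) one_pos) ?_
  filter_upwards [ae_restrict_mem measurableSet_Ioi] with x hx
  have hx0 : (0:ℝ) < x := lt_trans one_pos hx
  rw [norm_mul, norm_cpow_eq_rpow_re_of_pos hx0, norm_real, Real.norm_eq_abs,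
    abs_of_nonneg (Int.fract_nonneg x)]
  simp only [sub_re, neg_re, one_re]
  have := (Int.fract_lt_one x).le
  have h2 := Real.rpow_nonneg hx0.le (-s.re - 1)
  nlinarith

lemma zeta1_eq_of_one_lt {s : ℂ} (hs : 1 < s.re) :
    riemannZeta₁ s = s - s * (s - 1) * EE s := by
  have hs1 : s ≠ 1 := by rintro rfl; simp at hs
  have hs1' : s - 1 ≠ 0 := sub_ne_zero.2 hs1
  have hs0 : 0 < s.re := by linarith
  have hz := riemannZeta_eq_inv_sub_mul hs1
  have h2 := LSeries_eq_mul_integral_of_nonneg (fun _ => (1:ℝ)) (r := 1) zero_le_one hs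
    (by simpa using isBigO_refl _ _) (by simp)
  have h3 : LSeries (fun _ => ((1:ℝ):ℂ)) s = riemannZeta s := by
    rw [← LSeries_one_eq_riemannZeta hs]; congr 1
  rw [h3] at h2
  have i1 : IntegrableOn (fun x : ℝ => (x:ℂ) ^ (-s)) (Ioi 1) :=
    integrableOn_Ioi_cpow_of_lt (by simpa using hs) one_pos
  have i2 : IntegrableOn (fun x : ℝ => ((Int.fract x : ℝ) : ℂ) * (x:ℂ) ^ (-s - 1)) (Ioi 1) := by
    have := (EE_conv hs0).mono_set (Ioi_subset_Ioi zero_le_one)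
    refine this.congr_fun (fun x hx => ?_) measurableSet_Ioi
    simp only [fr, indicator_of_mem hx, smul_eq_mul]; ring
  have h4 : ∫ t in Ioi (1 : ℝ), (∑ k ∈ Finset.Icc 1 ⌊t⌋₊, ((1:ℝ) : ℂ)) * (t:ℂ) ^ (-(s + 1)) =
      1 / (s - 1) - EE s := by
    have h5 : ∫ x in Ioi (1:ℝ), (x:ℂ) ^ (-s) = 1 / (s - 1) := by
      rw [integral_Ioi_cpow_of_lt (by simpa using hs) one_pos]
      rw [ofReal_one, one_cpow, show -s + 1 = -(s - 1) by ring, neg_div_neg_eq]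
    rw [EE_eq, ← h5, ← integral_sub i1 i2]
    refine setIntegral_congr_fun measurableSet_Ioi fun x hx => ?_
    have hx0 : (0:ℝ) < x := lt_trans one_pos hx
    have hx' : (x:ℂ) ≠ 0 := by exact_mod_cast hx0.ne'
    have e1 : (x:ℂ) ^ (-s) = x * (x:ℂ) ^ (-s - 1) := by
      rw [cpow_sub _ _ hx', cpow_one]; field_simp
    have e2 : ((⌊x⌋₊ : ℕ) : ℂ) = x - ((Int.fract x : ℝ) : ℂ) := by
      have : ((⌊x⌋₊ : ℕ) : ℝ) = x - Int.fract x := by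
        rw [natCast_floor_eq_intCast_floor hx0.le]; exact (Int.self_sub_fract x).symm
      exact_mod_cast this
    simp only [Finset.sum_const, Nat.card_Icc, add_tsub_cancel_right, ofReal_one, nsmul_eq_mul, mul_one]
    rw [e1, e2, neg_add, ← sub_eq_add_neg]; ring
  rw [h4, hz] at h2
  field_simp at h2
  linear_combination h2

lemma zeta1_eq {s : ℂ} (hs : 0 < s.re) :
    riemannZeta₁ s = s - s * (s - 1) * EE s := by
  have hU : IsOpen {z : ℂ | 0 < z.re} := isOpen_lt continuous_const continuous_re
  have hc : IsPreconnected {z : ℂ | 0 < z.re} := (convex_halfSpace_re_gt 0).isPreconnected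
  have h1 : AnalyticOnNhd ℂ riemannZeta₁ {z : ℂ | 0 < z.re} :=
    differentiable_riemannZeta₁.differentiableOn.analyticOnNhd hU
  have h2 : AnalyticOnNhd ℂ (fun s => s - s * (s - 1) * EE s) {z : ℂ | 0 < z.re} := by
    apply DifferentiableOn.analyticOnNhd _ hU
    intro z hz
    have := EE_diff hz
    apply DifferentiableAt.differentiableWithinAt
    fun_prop
  refine h1.eqOn_of_preconnected_of_eventuallyEq h2 hc (z₀ := 2) (by simp) ?_ hs
  filter_upwards [(isOpen_lt continuous_const continuous_re).mem_nhds
    (show (1:ℝ) < (2:ℂ).re by simp)] with z hz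
  exact zeta1_eq_of_one_lt hz

/-- Polynomial bound. -/
lemma zeta1_norm_le {s : ℂ} (hs : 1 / 4 ≤ s.re) : ‖riemannZeta₁ s‖ ≤ 5 * (‖s‖ + 1) ^ 2 := by
  have h0 : 0 < s.re := by linarith
  rw [zeta1_eq h0]
  have hE : ‖EE s‖ ≤ 4 := (EE_norm h0).trans (by rw [div_le_iff₀ h0]; linarith)
  have h1 : ‖s - 1‖ ≤ ‖s‖ + 1 := (norm_sub_le _ _).trans (by simp)
  calc ‖s - s * (s - 1) * EE s‖ ≤ ‖s‖ + ‖s‖ * ‖s - 1‖ * ‖EE s‖ := by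
        refine (norm_sub_le _ _).trans ?_
        rw [norm_mul, norm_mul]
    _ ≤ ‖s‖ + ‖s‖ * (‖s‖ + 1) * 4 := by gcongr
    _ ≤ _ := by nlinarith [norm_nonneg s]

lemma zeta1_ne_zero_of_one_le {s : ℂ} (hs : 1 ≤ s.re) : riemannZeta₁ s ≠ 0 := by
  rcases eq_or_ne s 1 with rfl | h
  · simp
  · have := riemannZeta_ne_zero_of_one_le_re hs
    rw [riemannZeta_eq_inv_sub_mul h] at this
    exact right_ne_zero_of_mul this

lemma zeta1_real_ne_zero {x : ℝ} (hx : 0 < x) : riemannZeta₁ (x:ℂ) ≠ 0 := by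
  rcases le_or_gt 1 x with h | h
  · exact zeta1_ne_zero_of_one_le (by simpa using h)
  rw [zeta1_eq (by simpa using hx), EE_eq]
  have : (∫ y in Ioi (1:ℝ), ((Int.fract y : ℝ) : ℂ) * (y:ℂ) ^ (-(x:ℂ) - 1)) =
      ((∫ y in Ioi (1:ℝ), Int.fract y * y ^ (-x - 1) : ℝ) : ℂ) := by
    rw [← integral_complex_ofReal]
    refine setIntegral_congr_fun measurableSet_Ioi fun y hy => ?_
    have hy0 : (0:ℝ) ≤ y := zero_le_one.trans (le_of_lt hy)
    push_cast [ofReal_cpow hy0]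
    rfl
  rw [this]
  have h0 : 0 ≤ ∫ y in Ioi (1:ℝ), Int.fract y * y ^ (-x - 1) :=
    setIntegral_nonneg measurableSet_Ioi fun y hy =>
      mul_nonneg (Int.fract_nonneg y) (Real.rpow_nonneg (zero_le_one.trans (le_of_lt hy)) _)
  set q := ∫ y in Ioi (1:ℝ), Int.fract y * y ^ (-x - 1)
  have : 0 < x - x * (x - 1) * q := by nlinarith [mul_nonneg (mul_nonneg hx.le (by linarith : 0 ≤ 1 - x)) h0]
  exact_mod_cast this.ne'

lemma logDeriv_zeta1 {s : ℂ} (hs : 1 < s.re) :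
    logDeriv riemannZeta₁ s = 1 / (s - 1) - LSeries (fun n => (ArithmeticFunction.vonMangoldt n : ℂ)) s := by
  have hs1 : s ≠ 1 := by rintro rfl; simp at hs
  have hs1' : s - 1 ≠ 0 := sub_ne_zero.2 hs1
  rw [ArithmeticFunction.LSeries_vonMangoldt_eq_deriv_riemannZeta_div hs]
  have hev : riemannZeta₁ =ᶠ[𝓝 s] fun z => (z - 1) * riemannZeta z := by
    filter_upwards [compl_singleton_mem_nhds hs1] with z hz
    have : z - 1 ≠ 0 := sub_ne_zero.2 hz
    rw [riemannZeta_eq_inv_sub_mul hz]; field_simp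
  have hz0 := riemannZeta_ne_zero_of_one_le_re hs.le
  have hd := differentiableAt_riemannZeta hs1
  rw [logDeriv_apply, hev.deriv_eq, hev.eq_of_nhds, deriv_fun_mul (by fun_prop) hd]
  simp only [deriv_sub_const, deriv_id'']
  field_simp
  ring

end zeta
end RHPi

namespace RHPi

/-! ## Part 2: Borel-Caratheodory bounds under the Riemann hypothesis -/
section bc
open Complex Set Topology Asymptotics

lemma nz_of_RH (h : RiemannHypothesis) {s : ℂ} (hs : 1 / 2 < s.re) : riemannZeta₁ s ≠ 0 := by
  intro h0
  have hs1 : s ≠ 1 := by rintro rfl; simp at h0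
  have hz : riemannZeta s = 0 := by rw [riemannZeta_eq_inv_sub_mul hs1, h0, mul_zero]
  have := h s hz (by
    rintro ⟨n, rfl⟩
    have : (-2 * ((n:ℂ) + 1)).re = -2 * ((n:ℝ) + 1) := by simp
    rw [this] at hs
    have : (0:ℝ) ≤ n := n.cast_nonneg
    linarith) hs1
  linarith

lemma zeta_sub_one_le {s : ℂ} (hs : 2 ≤ s.re) : ‖riemannZeta s - 1‖ ≤ 0.65 := by
  have hs1 : 1 < s.re := by linarith
  have hsum : Summable (fun n : ℕ => 1 / ((n:ℂ) + 1) ^ s) := by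
    have := (summable_nat_add_iff 1).2 (Complex.summable_one_div_nat_cpow.2 hs1)
    simpa using this
  rw [zeta_eq_tsum_one_div_nat_add_one_cpow hs1, hsum.tsum_eq_zero_add]
  simp only [Nat.cast_zero, zero_add, one_cpow, div_one, add_sub_cancel_left]
  have hz2 := hasSum_zeta_two
  have h2 : HasSum (fun n : ℕ => 1 / ((n:ℝ) + 2) ^ 2) (Real.pi ^ 2 / 6 - 1) := by
    have := (hasSum_nat_add_iff' 2).2 hz2
    simpa [Finset.sum_range_succ] using this
  have hle : ∀ n : ℕ, ‖1 / (((n + 1 : ℕ) : ℂ) + 1) ^ s‖ ≤ 1 / ((n:ℝ) + 2) ^ 2 := by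
    intro n
    have e : (((n + 1 : ℕ) : ℂ) + 1) = (((n:ℝ) + 2 : ℝ) : ℂ) := by push_cast; ring
    have hp : (0:ℝ) < (n:ℝ) + 2 := by positivity
    rw [e, norm_div, norm_one, norm_cpow_eq_rpow_re_of_pos hp]
    gcongr
    rw [← Real.rpow_natCast]
    apply Real.rpow_le_rpow_of_exponent_le
    · have : (0:ℝ) ≤ n := n.cast_nonneg
      linarith
    · simpa using hs
  refine (tsum_of_norm_bounded h2 hle).trans ?_
  have := Real.pi_lt_d4
  have := Real.pi_pos
  nlinarith

lemma zeta_lower {s : ℂ} (hs : 2 ≤ s.re) : 0.35 ≤ ‖riemannZeta s‖ := by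
  have h := zeta_sub_one_le hs
  have h2 := norm_sub_norm_le (1:ℂ) (1 - riemannZeta s)
  rw [norm_sub_rev] at h
  simp only [norm_one, sub_sub_cancel] at h2
  linarith

lemma zeta_upper {s : ℂ} (hs : 2 ≤ s.re) : ‖riemannZeta s‖ ≤ 1.65 := by
  have h := zeta_sub_one_le hs
  have h2 := norm_add_le (riemannZeta s - 1) 1
  simp only [norm_one, sub_add_cancel] at h2
  linarith

lemma zeta1_eq_mul {s : ℂ} (hs : s ≠ 1) : riemannZeta₁ s = (s - 1) * riemannZeta s := by
  have : s - 1 ≠ 0 := sub_ne_zero.2 hs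
  rw [riemannZeta_eq_inv_sub_mul hs]; field_simp

lemma zeta1_lower {s : ℂ} (hs : 2 ≤ s.re) : 0.35 ≤ ‖riemannZeta₁ s‖ := by
  have hs1 : s ≠ 1 := by rintro rfl; norm_num at hs
  rw [zeta1_eq_mul hs1, norm_mul]
  have h1 : 1 ≤ ‖s - 1‖ := by
    have := (abs_re_le_norm (s - 1))
    have h3 := le_abs_self ((s - 1).re)
    simp only [sub_re, one_re] at this h3
    linarith
  nlinarith [zeta_lower hs]

/-- growth function -/
noncomputable def gr (t : ℝ) : ℝ := 7 * Real.sqrt (|t| + 5)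

lemma gr_pos (t : ℝ) : 0 < gr t := by unfold gr; positivity

lemma log_bound {y : ℝ} (hy : 5 ≤ y) : Real.log (5 * y ^ 2 / 0.35) ≤ 7 * Real.sqrt y := by
  have hy0 : 0 < y := by linarith
  have h1 : Real.log y = 2 * Real.log (Real.sqrt y) := by
    rw [Real.log_sqrt hy0.le]; ring
  have h2 : Real.log (Real.sqrt y) ≤ Real.sqrt y - 1 :=
    Real.log_le_sub_one_of_pos (Real.sqrt_pos.2 hy0)
  have h3 : Real.log (5 / 0.35) ≤ 4 := by
    rw [Real.log_le_iff_le_exp (by norm_num)]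
    have := Real.add_one_le_exp (4:ℝ)
    have h4 : (5/0.35:ℝ) ≤ 2.7 ^ 4 := by norm_num
    have h5 : (2.7:ℝ) ^ 4 ≤ Real.exp 1 ^ 4 := by
      gcongr; exact (by norm_num : (2.7:ℝ) ≤ 2.7182818283).trans Real.exp_one_gt_d9.le
    rw [← Real.exp_nat_mul] at h5
    norm_num at h5 h4 ⊢
    linarith
  have : Real.log (5 * y ^ 2 / 0.35) = Real.log (5 / 0.35) + 2 * Real.log y := by
    rw [show 5 * y ^ 2 / 0.35 = (5 / 0.35) * y ^ 2 by ring, Real.log_mul (by norm_num) (by positivity),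
      Real.log_pow]
    norm_num
  rw [this, h1]
  have : 0 ≤ Real.sqrt y := Real.sqrt_nonneg y
  linarith

lemma bc_f (hZ : ∀ s : ℂ, 1 / 2 < s.re → riemannZeta₁ s ≠ 0) (T : ℝ) :
    ∃ f : ℂ → ℂ, f 0 = 0 ∧ (∀ z ∈ Metric.ball (0:ℂ) (3/2),
      HasDerivAt f (logDeriv riemannZeta₁ (2 + T * I + z)) z) ∧
      (∀ z ∈ Metric.ball (0:ℂ) (3/2), riemannZeta₁ (2 + T * I + z) =
        riemannZeta₁ (2 + T * I) * exp (f z)) ∧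
      (∀ z ∈ Metric.ball (0:ℂ) (3/2), ‖f z‖ ≤ 2 * gr T * ‖z‖ / (3/2 - ‖z‖)) := by
  set c : ℂ := 2 + T * I with hc
  have hre : ∀ z ∈ Metric.ball (0:ℂ) (3/2), 1 / 2 < (c + z).re := by
    intro z hz
    rw [mem_ball_zero_iff] at hz
    have := (abs_le.1 (abs_re_le_norm z)).1
    simp [hc]; linarith
  have hd : DifferentiableOn ℂ (fun z => logDeriv riemannZeta₁ (c + z)) (Metric.ball (0:ℂ) (3/2)) := by
    intro z hz
    apply DifferentiableAt.differentiableWithinAt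
    have hd1 : DifferentiableAt ℂ (logDeriv riemannZeta₁) (c + z) := by
      have h2 : Differentiable ℂ (deriv riemannZeta₁) := differentiable_riemannZeta₁.deriv
      exact (h2 _).div (differentiable_riemannZeta₁ _) (hZ _ (hre z hz))
    exact hd1.comp z (by fun_prop)
  obtain ⟨f, hf0, hf⟩ := hd.isExactOn_ball.with_val_at 0 0
  have hexp : ∀ z ∈ Metric.ball (0:ℂ) (3/2), riemannZeta₁ (c + z) =
        riemannZeta₁ c * exp (f z) := by
    have key : ∀ z ∈ Metric.ball (0:ℂ) (3/2), HasDerivAt (fun z => riemannZeta₁ (c + z) * exp (-f z)) 0 z := by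
      intro z hz
      have h1 : HasDerivAt (fun z => riemannZeta₁ (c + z)) (deriv riemannZeta₁ (c + z)) z :=
        (differentiable_riemannZeta₁ (c + z)).hasDerivAt.comp_const_add c z
      have h2 := h1.mul (hf z hz).neg.cexp
      convert! h2 using 1
      rw [logDeriv_apply]
      have := hZ _ (hre z hz)
      field_simp
      simp
    intro z hz
    have hcst := (convex_ball (0:ℂ) (3/2)).is_const_of_fderivWithin_eq_zero (𝕜 := ℂ)
      (f := fun z => riemannZeta₁ (c + z) * exp (-f z))
      (fun z hz => (key z hz).differentiableAt.differentiableWithinAt)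
      (fun z hz => by
        rw [fderivWithin_of_isOpen Metric.isOpen_ball hz]
        ext
        simpa using (key z hz).deriv) hz (Metric.mem_ball_self (by norm_num))
    simp only [hf0, add_zero, neg_zero, exp_zero, mul_one] at hcst
    rw [← hcst, mul_assoc, ← exp_add]; simp
  refine ⟨f, hf0, hf, hexp, ?_⟩
  have hc2 : 2 ≤ c.re := by simp [hc]
  have hl := zeta1_lower hc2
  have hM : MapsTo f (Metric.ball 0 (3/2)) {z | z.re ≤ gr T} := by
    intro z hz
    have e1 : Real.exp (f z).re = ‖riemannZeta₁ (c + z)‖ / ‖riemannZeta₁ c‖ := by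
      rw [hexp z hz, norm_mul, norm_exp]
      field_simp
    have hn : ‖c + z‖ + 1 ≤ |T| + 5 := by
      have h1 := norm_add_le c z
      have h2 : ‖c‖ ≤ 2 + |T| := by
        rw [hc]; refine (norm_add_le _ _).trans ?_; simp
      rw [mem_ball_zero_iff] at hz
      linarith
    have h3 := zeta1_norm_le (s := c + z) (by linarith [hre z hz])
    have h4 : Real.exp (f z).re ≤ 5 * (|T| + 5) ^ 2 / 0.35 := by
      rw [e1]; gcongr; refine h3.trans (by gcongr)
    have h5 := (Real.le_log_iff_exp_le (by positivity)).2 h4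
    exact h5.trans (log_bound (by linarith [abs_nonneg T]))
  intro z hz
  exact borelCaratheodory_zero (gr_pos T) (fun z hz => (hf z hz).differentiableAt.differentiableWithinAt)
    hM (by norm_num) hz hf0

lemma bc_f_bound (hZ : ∀ s : ℂ, 1 / 2 < s.re → riemannZeta₁ s ≠ 0) {δ : ℝ} (hδ : 0 < δ) {s : ℂ}
    (h1 : 1 / 2 + δ ≤ s.re) (h2 : s.re ≤ 2) :
    0.35 * Real.exp (- (3 / δ * gr s.im)) ≤ ‖riemannZeta₁ s‖ := by
  obtain ⟨f, hf0, hf, hexp, hb⟩ := bc_f hZ s.im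
  set z : ℂ := ((s.re - 2 : ℝ) : ℂ) with hz
  have hsz : 2 + s.im * I + z = s := by
    apply Complex.ext <;> simp [hz]
  have hzn : ‖z‖ = 2 - s.re := by
    rw [hz, norm_real, Real.norm_eq_abs, abs_of_nonpos (by linarith)]; ring
  have hzb : z ∈ Metric.ball (0:ℂ) (3/2) := by rw [mem_ball_zero_iff, hzn]; linarith
  have h3 := hexp z hzb
  rw [hsz] at h3
  rw [h3, norm_mul, norm_exp]
  have h4 : ‖f z‖ ≤ 3 / δ * gr s.im := by
    refine (hb z hzb).trans ?_
    have hg := gr_pos s.im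
    rw [hzn, div_mul_eq_mul_div, div_le_div_iff₀ (by linarith) hδ]
    have : 0 < gr s.im * δ := by positivity
    nlinarith
  have h5 := (abs_le.1 (abs_re_le_norm (f z))).1
  have h6 := zeta1_lower (s := 2 + s.im * I) (by simp)
  gcongr
  linarith

lemma bc_logDeriv (hZ : ∀ s : ℂ, 1 / 2 < s.re → riemannZeta₁ s ≠ 0) {δ : ℝ} (hδ : 0 < δ) {s : ℂ}
    (h1 : 1 / 2 + 2 * δ ≤ s.re) (h2 : s.re ≤ 2) :
    ‖logDeriv riemannZeta₁ s‖ ≤ 3 / δ ^ 2 * gr s.im := by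
  obtain ⟨f, hf0, hf, hexp, hb⟩ := bc_f hZ s.im
  set z : ℂ := ((s.re - 2 : ℝ) : ℂ) with hz
  have hsz : 2 + s.im * I + z = s := by
    apply Complex.ext <;> simp [hz]
  have hzn : ‖z‖ = 2 - s.re := by
    rw [hz, norm_real, Real.norm_eq_abs, abs_of_nonpos (by linarith)]; ring
  have hin : ∀ w, dist w z ≤ δ → ‖w‖ ≤ 3 / 2 - δ := by
    intro w hw
    have := norm_add_le (w - z) z
    rw [dist_eq_norm] at hw
    rw [sub_add_cancel] at this
    linarith
  have hzb : z ∈ Metric.ball (0:ℂ) (3/2) := by rw [mem_ball_zero_iff, hzn]; linarith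
  have hder : deriv f z = logDeriv riemannZeta₁ s := by rw [(hf z hzb).deriv, hsz]
  rw [← hder]
  have := norm_deriv_le_of_forall_mem_sphere_norm_le (f := f) (c := z) (C := 3 / δ * gr s.im) hδ
    (by
      refine (DifferentiableOn.diffContOnCl ?_)
      intro w hw
      rw [closure_ball _ hδ.ne'] at hw
      have hw := hin w hw
      exact (hf w (by rw [mem_ball_zero_iff]; linarith)).differentiableAt.differentiableWithinAt)
    (by
      intro w hw
      have hw := hin w (le_of_eq hw)
      refine (hb w (by rw [mem_ball_zero_iff]; linarith)).trans ?_
      have hg := gr_pos s.im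
      rw [div_mul_eq_mul_div, div_le_div_iff₀ (by linarith) hδ]
      have : 0 < gr s.im * δ := by positivity
      nlinarith)
  refine this.trans (le_of_eq ?_)
  field_simp

end bc
end RHPi

namespace RHPi

/-! ## Part 3: positivity of the real part of the logarithmic derivative of xi -/
section xi
open Complex Set Topology Asymptotics

/-- The Riemann xi function. -/
noncomputable def Xi (s : ℂ) : ℂ := (s * (s - 1) * completedRiemannZeta₀ s + 1) / 2

lemma Xi_diff : Differentiable ℂ Xi := by
  unfold Xi
  have := differentiable_completedZeta₀
  fun_prop

lemma Xi_one_sub (s : ℂ) : Xi (1 - s) = Xi s := by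
  unfold Xi; rw [completedRiemannZeta₀_one_sub]; ring

lemma Xi_eq {s : ℂ} (hs : 0 < s.re) :
    Xi s = riemannZeta₁ s * (Real.pi : ℂ) ^ (-s / 2) * Gamma (s / 2 + 1) := by
  have hpi : (Real.pi : ℂ) ≠ 0 := by exact_mod_cast Real.pi_ne_zero
  rcases eq_or_ne s 1 with rfl | h1
  · have : Gamma (1 / 2 + 1) = 1 / 2 * (Real.pi : ℂ) ^ (1 / 2 : ℂ) := by
      rw [Gamma_add_one _ (by norm_num), Gamma_one_half_eq]
    rw [this]
    simp only [Xi, riemannZeta₁_one, sub_self, mul_zero, zero_mul, zero_add, one_mul]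
    rw [mul_left_comm, ← cpow_add _ _ hpi]
    norm_num
  · have h0 : s ≠ 0 := by rintro rfl; simp at hs
    have hs1 : s - 1 ≠ 0 := sub_ne_zero.2 h1
    have hs1' : 1 - s ≠ 0 := sub_ne_zero.2 h1.symm
    have hG : Gammaℝ s ≠ 0 := Gammaℝ_ne_zero_of_re_pos hs
    rw [zeta1_eq_mul h1, riemannZeta_def_of_ne_zero h0, Gamma_add_one _ (by simpa using h0),
      completedRiemannZeta_eq]
    have e : (s - 1) * ((completedRiemannZeta₀ s - 1 / s - 1 / (1 - s)) / Gammaℝ s) * (Real.pi : ℂ) ^ (-s / 2) *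
        (s / 2 * Gamma (s / 2)) = (s - 1) * ((completedRiemannZeta₀ s - 1 / s - 1 / (1 - s)) / Gammaℝ s) *
        (s / 2) * Gammaℝ s := by rw [Gammaℝ_def]; ring
    rw [e, Xi]
    field_simp
    ring

lemma zeta1_conj (s : ℂ) : riemannZeta₁ (starRingEnd ℂ s) = starRingEnd ℂ (riemannZeta₁ s) := by
  rcases eq_or_ne s 1 with rfl | h1
  · simp
  · have h2 : starRingEnd ℂ s ≠ 1 := by
      intro h; apply h1; have := congrArg (starRingEnd ℂ) h; simpa using this
    rw [zeta1_eq_mul h1, zeta1_eq_mul h2, riemannZeta_conj]; simp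

lemma Xi_norm {s : ℂ} (hs : 0 < s.re) :
    ‖Xi s‖ = ‖riemannZeta₁ s‖ * Real.pi ^ (-s.re / 2) * ‖Gamma (s / 2 + 1)‖ := by
  rw [Xi_eq hs, norm_mul, norm_mul, norm_cpow_eq_rpow_re_of_pos Real.pi_pos]
  simp

lemma Xi_norm_conj {s : ℂ} (hs : 0 < s.re) : ‖Xi (starRingEnd ℂ s)‖ = ‖Xi s‖ := by
  rw [Xi_norm hs, Xi_norm (by simpa using hs), zeta1_conj]
  have : starRingEnd ℂ s / 2 + 1 = starRingEnd ℂ (s / 2 + 1) := by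
    rw [map_add, map_div₀, map_one, Complex.conj_ofNat]
  rw [this, Gamma_conj]; simp

lemma Xi_ne_zero (hZ : ∀ s : ℂ, 1 / 2 < s.re → riemannZeta₁ s ≠ 0) {s : ℂ} (hs : 1 / 2 < s.re) :
    Xi s ≠ 0 := by
  have h0 : 0 < s.re := by linarith
  rw [Xi_eq h0]
  have hpi : (Real.pi : ℂ) ≠ 0 := by exact_mod_cast Real.pi_ne_zero
  refine mul_ne_zero (mul_ne_zero (hZ s hs) ?_) ?_
  · simp [cpow_eq_zero_iff, hpi]
  · apply Gamma_ne_zero_of_re_pos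
    simp; positivity

lemma norm_beta_le {z : ℂ} {ε : ℝ} (hz : 1 ≤ z.re) (hε : 0 < ε) :
    ‖betaIntegral z ε‖ ≤ 1 / ε := by
  have h1 : ∫ x : ℝ in (0:ℝ)..1, (1 - x) ^ (ε - 1) = 1 / ε := by
    have := intervalIntegral.integral_comp_sub_left (a := 0) (b := 1) (fun x : ℝ => x ^ (ε - 1)) 1
    rw [this, sub_self, sub_zero, integral_rpow (Or.inl (by linarith))]
    rw [Real.zero_rpow (by simp [hε.ne'])]
    simp
  rw [← h1]
  unfold betaIntegral
  refine intervalIntegral.norm_integral_le_of_norm_le zero_le_one ?_ ?_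
  · have : ∀ᵐ x : ℝ, x ≠ 1 := by simp [ae_iff]
    filter_upwards [this] with x hx1 hx
    have hx0 : 0 < x := hx.1
    have hx1 : 0 < 1 - x := by
      have := lt_of_le_of_ne hx.2 hx1
      linarith
    rw [norm_mul, norm_cpow_eq_rpow_re_of_pos hx0,
      show (1 - (x:ℂ)) = ((1 - x : ℝ) : ℂ) by push_cast; rfl, norm_cpow_eq_rpow_re_of_pos hx1]
    simp only [sub_re, one_re, ofReal_re]
    have h2 : x ^ (z.re - 1) ≤ 1 := Real.rpow_le_one hx0.le hx.2 (by linarith)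
    have := Real.rpow_nonneg hx1.le (ε - 1)
    nlinarith
  · have : IntervalIntegrable (fun x : ℝ => x ^ (ε - 1)) volume 0 1 :=
      intervalIntegral.intervalIntegrable_rpow' (by linarith)
    have := this.comp_sub_left 1
    simpa using this.symm

lemma Gamma_ratio {z : ℂ} {ε : ℝ} (hz : 1 ≤ z.re) (hε : 0 < ε) :
    ‖Gamma z‖ ≤ 1 / (ε * ‖Gamma ε‖) * ‖Gamma (z + ε)‖ := by
  have h := Gamma_mul_Gamma_eq_betaIntegral (s := z) (t := ε) (by linarith) (by simpa using hε)
  have h2 := congrArg norm h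
  rw [norm_mul, norm_mul] at h2
  have h3 : 0 < ‖Gamma ε‖ := norm_pos_iff.2 (Gamma_ne_zero_of_re_pos (by simpa using hε))
  have h4 := norm_beta_le hz hε
  have h5 : ‖Gamma z‖ * ‖Gamma ε‖ ≤ ‖Gamma (z + ε)‖ * (1 / ε) := by rw [h2]; gcongr
  rw [div_mul_eq_mul_div, one_mul, le_div_iff₀ (by positivity)]
  rw [mul_one_div, le_div_iff₀ hε] at h5
  linarith

lemma Xi_ratio_bound {w : ℂ} {ε : ℝ} (hw : 0 ≤ w.re) (hε : 0 < ε) (hε' : ε ≤ 1 / 8) :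
    ‖Xi (1 / 2 + w - ε)‖ * ‖riemannZeta₁ (1 / 2 + w + ε)‖ ≤
      Real.pi ^ ε / (ε * ‖Gamma ε‖) * ‖riemannZeta₁ (1 / 2 + w - ε)‖ * ‖Xi (1 / 2 + w + ε)‖ := by
  have r1 : (1 / 2 + w - ε).re = 1 / 2 + w.re - ε := by simp
  have r2 : (1 / 2 + w + ε).re = 1 / 2 + w.re + ε := by simp
  rw [Xi_norm (by rw [r1]; linarith), Xi_norm (by rw [r2]; linarith), r1, r2]
  have h := Gamma_ratio (z := (1 / 2 + w - ε) / 2 + 1) (ε := ε) (by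
    have : ((1 / 2 + w - ε) / 2 + 1).re = (1 / 2 + w.re - ε) / 2 + 1 := by simp
    rw [this]; linarith) hε
  have e : (1 / 2 + w - ε) / 2 + 1 + (ε:ℂ) = (1 / 2 + w + ε) / 2 + 1 := by ring
  rw [e] at h
  have e2 : Real.pi ^ (-(1 / 2 + w.re - ε) / 2) = Real.pi ^ ε * Real.pi ^ (-(1 / 2 + w.re + ε) / 2) := by
    rw [← Real.rpow_add Real.pi_pos]; congr 1; ring
  rw [e2]
  calc _ = (‖riemannZeta₁ (1 / 2 + w - ε)‖ * (Real.pi ^ ε * Real.pi ^ (-(1 / 2 + w.re + ε) / 2)) *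
        ‖riemannZeta₁ (1 / 2 + w + ε)‖) * ‖Gamma ((1 / 2 + w - ε) / 2 + 1)‖ := by ring
    _ ≤ (‖riemannZeta₁ (1 / 2 + w - ε)‖ * (Real.pi ^ ε * Real.pi ^ (-(1 / 2 + w.re + ε) / 2)) *
        ‖riemannZeta₁ (1 / 2 + w + ε)‖) * (1 / (ε * ‖Gamma ε‖) * ‖Gamma ((1 / 2 + w + ε) / 2 + 1)‖) := by
        gcongr
    _ = _ := by ring

lemma Xi_le (hZ : ∀ s : ℂ, 1 / 2 < s.re → riemannZeta₁ s ≠ 0) {w : ℂ} {ε : ℝ} (hw : 0 ≤ w.re)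
    (hε : 0 < ε) (hε' : ε ≤ 1 / 8) : ‖Xi (1 / 2 + w - ε)‖ ≤ ‖Xi (1 / 2 + w + ε)‖ := by
  set g : ℂ → ℂ := fun w => Xi (1 / 2 + w - ε) / Xi (1 / 2 + w + ε) with hg
  have hne : ∀ w : ℂ, 0 ≤ w.re → Xi (1 / 2 + w + ε) ≠ 0 := by
    intro w hw
    apply Xi_ne_zero hZ
    simp; linarith
  have hne' : ∀ w : ℂ, 0 ≤ w.re → riemannZeta₁ (1 / 2 + w + ε) ≠ 0 := by
    intro w hw
    apply hZ
    simp; linarith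
  set K := Real.pi ^ ε / (ε * ‖Gamma ε‖) with hK
  have hK0 : 0 ≤ K := by have := Real.pi_pos; positivity
  have hgb : ∀ w : ℂ, 0 ≤ w.re → ‖g w‖ ≤ K * ‖riemannZeta₁ (1 / 2 + w - ε)‖ / ‖riemannZeta₁ (1 / 2 + w + ε)‖ := by
    intro w hw
    have h1 := norm_pos_iff.2 (hne w hw)
    have h2 := norm_pos_iff.2 (hne' w hw)
    rw [hg]; simp only [norm_div]
    rw [div_le_div_iff₀ h1 h2]
    exact Xi_ratio_bound hw hε hε'
  have hmain : ‖g w‖ ≤ 1 := by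
    refine PhragmenLindelof.right_half_plane_of_bounded_on_real (f := g) (C := 1) ?_ ?_ ?_ ?_ hw
    · apply DifferentiableOn.diffContOnCl
      intro z hz
      rw [closure_setOfPred_lt_re] at hz
      apply DifferentiableAt.differentiableWithinAt
      have h1 : DifferentiableAt ℂ (fun z : ℂ => Xi (1 / 2 + z - ε)) z := by
        have := Xi_diff; fun_prop
      have h2 : DifferentiableAt ℂ (fun z : ℂ => Xi (1 / 2 + z + ε)) z := by
        have := Xi_diff; fun_prop
      exact h1.div h2 (hne z hz)
    · refine ⟨1, by norm_num, 2 + 21 / ε, ?_⟩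
      refine IsBigO.of_bound (K * (5 * Real.exp 4) / (0.35 * Real.exp (- (21 / ε * 6)))) ?_
      rw [eventually_inf_principal]
      refine Eventually.of_forall fun z hz => ?_
      simp only [mem_ofPred_eq] at hz
      have h1 : ‖riemannZeta₁ (1 / 2 + z - ε)‖ ≤ 5 * Real.exp 4 * Real.exp (2 * ‖z‖) := by
        refine (zeta1_norm_le (by simp; linarith)).trans ?_
        have : ‖1 / 2 + z - ε‖ ≤ 1 + ‖z‖ := by
          refine (norm_sub_le _ _).trans ?_
          have := norm_add_le (1/2:ℂ) z
          have e : ‖(1/2:ℂ)‖ = 1 / 2 := by norm_num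
          rw [norm_real, Real.norm_eq_abs, abs_of_pos hε]
          linarith
        have h3 : (‖1 / 2 + z - ε‖ + 1) ≤ Real.exp (‖z‖ + 2) :=
          le_trans (by linarith) (Real.add_one_le_exp _)
        rw [mul_assoc, ← Real.exp_add]
        gcongr
        calc _ ≤ Real.exp (‖z‖ + 2) ^ 2 := by gcongr
          _ = _ := by rw [← Real.exp_nat_mul]; congr 1; push_cast; ring
      have h2 : 0.35 * Real.exp (- (21 / ε * 6)) * Real.exp (-(21 / ε * ‖z‖)) ≤
          ‖riemannZeta₁ (1 / 2 + z + ε)‖ := by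
        have hre : (1 / 2 + z + ε).re = 1 / 2 + z.re + ε := by simp
        have him : (1 / 2 + z + ε).im = z.im := by simp
        have hgr : gr z.im ≤ 7 * (‖z‖ + 6) := by
          unfold gr
          have h3 := abs_im_le_norm z
          have : Real.sqrt (|z.im| + 5) ≤ |z.im| + 5 + 1 := by
            rw [Real.sqrt_le_left (by positivity)]
            nlinarith [abs_nonneg z.im]
          linarith
        rw [mul_assoc, ← Real.exp_add]
        rcases le_or_gt (1 / 2 + z + ε).re 2 with h | h
        · refine le_trans ?_ (bc_f_bound hZ hε (by rw [hre]; linarith) h)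
          rw [him]
          gcongr
          have : 3 / ε * gr z.im ≤ 3 / ε * (7 * (‖z‖ + 6)) := by gcongr
          calc _ = -(3 / ε * (7 * (‖z‖ + 6))) := by ring
            _ ≤ _ := by linarith
        · refine le_trans ?_ (zeta1_lower h.le)
          have : Real.exp (-(21 / ε * 6) + -(21 / ε * ‖z‖)) ≤ 1 := by
            rw [Real.exp_le_one_iff]
            have : 0 ≤ 21 / ε * 6 + (21 / ε * ‖z‖) := by positivity
            linarith
          linarith
      refine (hgb z hz.le).trans ?_
      rw [Real.norm_eq_abs, abs_of_pos (Real.exp_pos _), Real.rpow_one]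
      calc _ ≤ K * (5 * Real.exp 4 * Real.exp (2 * ‖z‖)) /
            (0.35 * Real.exp (- (21 / ε * 6)) * Real.exp (-(21 / ε * ‖z‖))) := by gcongr
        _ = _ := by
          rw [add_mul, Real.exp_add, Real.exp_neg (21 / ε * ‖z‖)]
          field_simp
    · refine ⟨K * (1.65 / 0.35), ?_⟩
      rw [eventually_map]
      filter_upwards [eventually_ge_atTop 2] with x hx
      refine (hgb x (by simp; linarith)).trans ?_
      rw [mul_div_assoc]
      refine mul_le_mul_of_nonneg_left ?_ hK0
      have n1 : (1 / 2 + (x:ℂ) - ε) ≠ 1 := by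
        intro h; have := congrArg re h; simp at this; linarith
      have n2 : (1 / 2 + (x:ℂ) + ε) ≠ 1 := by
        intro h; have := congrArg re h; simp at this; linarith
      have h1 := zeta_upper (s := 1 / 2 + (x:ℂ) - ε) (by simp; linarith)
      have h2 := zeta_lower (s := 1 / 2 + (x:ℂ) + ε) (by simp; linarith)
      have h3 : ‖(1 / 2 + (x:ℂ) - ε) - 1‖ ≤ ‖(1 / 2 + (x:ℂ) + ε) - 1‖ := by
        rw [show (1 / 2 + (x:ℂ) - ε) - 1 = ((x - 1 / 2 - ε : ℝ) : ℂ) by push_cast; ring,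
          show (1 / 2 + (x:ℂ) + ε) - 1 = ((x - 1 / 2 + ε : ℝ) : ℂ) by push_cast; ring,
          norm_real, norm_real, Real.norm_eq_abs, Real.norm_eq_abs, abs_of_nonneg (by linarith),
          abs_of_nonneg (by linarith)]
        linarith
      have h4 : 0 < ‖(1 / 2 + (x:ℂ) + ε) - 1‖ := norm_pos_iff.2 (sub_ne_zero.2 n2)
      rw [zeta1_eq_mul n1, zeta1_eq_mul n2, norm_mul, norm_mul, mul_div_mul_comm]
      calc _ ≤ 1 * (1.65 / 0.35 : ℝ) := by
            gcongr
            exact (div_le_one h4).2 h3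
        _ = _ := one_mul _
    · intro y
      have : ‖Xi (1 / 2 + y * I - ε)‖ = ‖Xi (1 / 2 + y * I + ε)‖ := by
        rw [← Xi_one_sub, ← Xi_norm_conj (s := 1 / 2 + y * I + ε) (by simp; positivity)]
        congr 2
        apply Complex.ext <;> simp; ring
      simp only [hg, norm_div, this]
      exact div_self_le_one _
  rw [hg] at hmain
  simp only [norm_div] at hmain
  exact (div_le_one (norm_pos_iff.2 (hne w hw))).1 hmain

/-- positivity of `Re of the log-derivative of xi`. -/
lemma Xi_logDeriv_re (hZ : ∀ s : ℂ, 1 / 2 < s.re → riemannZeta₁ s ≠ 0) {s : ℂ} (hs : 1 / 2 < s.re) :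
    0 ≤ (logDeriv Xi s).re := by
  have hX := Xi_ne_zero hZ hs
  -- derivative of `|Xi (s+ε)/Xi s|^2 - |Xi (s-ε)/Xi s|^2`
  set φ : ℝ → ℂ := fun t => Xi (s + t) / Xi s with hφ
  have hd : HasDerivAt φ (logDeriv Xi s) 0 := by
    have h1 : HasDerivAt (fun z : ℂ => Xi (s + z)) (deriv Xi s) ((0:ℝ):ℂ) := by
      have := (Xi_diff (s + 0)).hasDerivAt.comp_const_add s 0
      simpa using this
    exact (h1.div_const (Xi s)).comp_ofReal
  have hn : HasDerivAt (fun t => Complex.normSq (φ t)) (2 * (logDeriv Xi s).re) 0 := by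
    have hre : HasDerivAt (fun t => (φ t).re) (logDeriv Xi s).re 0 :=
      (Complex.reCLM.hasFDerivAt.comp_hasDerivAt 0 hd)
    have him : HasDerivAt (fun t => (φ t).im) (logDeriv Xi s).im 0 :=
      (Complex.imCLM.hasFDerivAt.comp_hasDerivAt 0 hd)
    have h0 : φ 0 = 1 := by simp [hφ, hX]
    have := (hre.mul hre).add (him.mul him)
    convert! this using 1
    rw [h0]; simp; ring
  have hm : HasDerivAt (fun t => Complex.normSq (φ (-t))) (-(2 * (logDeriv Xi s).re)) 0 := by
    have := HasDerivAt.scomp (0:ℝ) (h := fun t : ℝ => -t) (h' := -1)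
      (g₁ := fun t => Complex.normSq (φ t)) (by simpa using hn) (hasDerivAt_neg 0)
    simpa [Function.comp_def] using this
  have hdiff := hn.sub hm
  have hnn : ∀ᶠ t in 𝓝[>] (0:ℝ), 0 ≤ slope ((fun t => Complex.normSq (φ t)) - fun t => Complex.normSq (φ (-t))) 0 t := by
    have : Ioo (0:ℝ) (1/8) ∈ 𝓝[>] (0:ℝ) := Ioo_mem_nhdsGT (by norm_num)
    filter_upwards [this] with t ht
    have h1 := Xi_le hZ (w := s - 1 / 2) (ε := t) (by simp; linarith) ht.1 ht.2.le
    rw [show 1 / 2 + (s - 1 / 2) - (t:ℂ) = s + (-t : ℝ) by push_cast; ring,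
      show 1 / 2 + (s - 1 / 2) + (t:ℂ) = s + t by ring] at h1
    rw [slope_def_field]
    apply div_nonneg _ (by linarith [ht.1])
    simp only [Pi.sub_apply, neg_zero, sub_self, sub_zero]
    rw [Complex.normSq_eq_norm_sq, Complex.normSq_eq_norm_sq, sub_nonneg]
    simp only [hφ, norm_div]
    gcongr
  have ht := (hasDerivAt_iff_tendsto_slope.1 hdiff).mono_left
    (nhdsWithin_mono (s := Ioi (0:ℝ)) 0 (fun x (hx : 0 < x) => (ne_of_gt hx : x ≠ 0)))
  have := ge_of_tendsto ht hnn
  linarith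

lemma Xi_logDeriv {s : ℂ} (hs : 0 < s.re) (hz : riemannZeta₁ s ≠ 0) :
    logDeriv Xi s = logDeriv riemannZeta₁ s - Real.log Real.pi / 2 + digamma (s / 2 + 1) / 2 := by
  have hpi : (Real.pi : ℂ) ≠ 0 := by exact_mod_cast Real.pi_ne_zero
  have hev : Xi =ᶠ[𝓝 s] fun s => (riemannZeta₁ s * (Real.pi : ℂ) ^ (-s / 2)) * Gamma (s / 2 + 1) := by
    filter_upwards [(isOpen_lt continuous_const continuous_re).mem_nhds hs] with z hz
    exact Xi_eq hz
  have hre : 0 < (s / 2 + 1).re := by simp; positivity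
  have hGd : DifferentiableAt ℂ Gamma (s / 2 + 1) := by
    apply differentiableAt_Gamma
    intro m h
    rw [h] at hre
    simp at hre
    have : (0:ℝ) ≤ m := m.cast_nonneg
    linarith
  have hG0 : Gamma (s / 2 + 1) ≠ 0 := Gamma_ne_zero_of_re_pos hre
  have hZd : HasDerivAt riemannZeta₁ (deriv riemannZeta₁ s) s := (differentiable_riemannZeta₁ s).hasDerivAt
  have hpd : HasDerivAt (fun s : ℂ => (Real.pi : ℂ) ^ (-s / 2)) ((Real.pi : ℂ) ^ (-s / 2) * Complex.log Real.pi * (-1 / 2)) s :=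
    HasDerivAt.const_cpow ((hasDerivAt_id s).neg.div_const 2) (Or.inl hpi)
  have hG : HasDerivAt (fun s : ℂ => Gamma (s / 2 + 1)) (deriv Gamma (s / 2 + 1) * (1 / 2)) s :=
    hGd.hasDerivAt.comp s (((hasDerivAt_id s).div_const 2).add_const 1)
  have hp0 : (Real.pi : ℂ) ^ (-s / 2) ≠ 0 := by simp [cpow_eq_zero_iff, hpi]
  rw [logDeriv_apply, hev.deriv_eq, hev.eq_of_nhds, ((hZd.fun_mul hpd).fun_mul hG).deriv, digamma_def,
    logDeriv_apply, logDeriv_apply, ofReal_log Real.pi_pos.le]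
  clear hev hG hGd hpd
  generalize Gamma (s / 2 + 1) = A at *
  generalize deriv Gamma (s / 2 + 1) = B at *
  field_simp
  ring

end xi
end RHPi

namespace RHPi

/-! ## Part 4: the digamma series -/
section digam
open Complex Set Topology Asymptotics

/-- terms of the digamma series -/
noncomputable def dT (k : ℕ) (z : ℂ) : ℂ := 1 / ((k:ℂ) + 1) - 1 / (z + k)

noncomputable def dP (z : ℂ) : ℂ := ∑' k, dT k z

lemma add_nat_ne {z : ℂ} (hz : 0 < z.re) (k : ℕ) : z + k ≠ 0 := by
  intro h; have := congrArg re h; simp at this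
  have : (0:ℝ) ≤ k := k.cast_nonneg
  linarith

lemma dT_eq {z : ℂ} (hz : 0 < z.re) (k : ℕ) : dT k z = (z - 1) / (((k:ℂ) + 1) * (z + k)) := by
  have h1 := add_nat_ne hz k
  have h2 : (k:ℂ) + 1 ≠ 0 := by exact_mod_cast k.succ_ne_zero
  unfold dT; field_simp; ring

lemma summable_aux : Summable (fun k : ℕ => 1 / ((k:ℝ) + 1) ^ 2) := by
  have := (summable_nat_add_iff 1).2 (Real.summable_one_div_nat_pow.2 (one_lt_two))
  simpa using this

lemma dT_bound {δ R : ℝ} (hδ : 0 < δ) (hδ1 : δ ≤ 1) {z : ℂ} (hz : δ < z.re) (hR : ‖z‖ < R) (k : ℕ) :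
    ‖dT k z‖ ≤ (R + 1) / δ * (1 / ((k:ℝ) + 1) ^ 2) := by
  rw [dT_eq (hδ.trans hz), norm_div, norm_mul]
  have hk : (0:ℝ) ≤ k := k.cast_nonneg
  have h1 : ‖(k:ℂ) + 1‖ = k + 1 := by
    rw [show (k:ℂ) + 1 = ((k + 1 : ℝ) : ℂ) by push_cast; rfl, norm_real, Real.norm_eq_abs, abs_of_pos (by positivity)]
  have h2 : δ * (k + 1) ≤ ‖z + k‖ := by
    have := (le_abs_self _).trans (abs_re_le_norm (z + k))
    simp at this
    nlinarith
  have h3 : ‖z - 1‖ ≤ R + 1 := (norm_sub_le _ _).trans (by simp; linarith)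
  have hR0 : 0 ≤ R + 1 := (norm_nonneg _).trans h3
  rw [h1]
  calc _ ≤ (R + 1) / ((k + 1) * (δ * (k + 1))) := by gcongr
    _ = _ := by field_simp

lemma dT_summable {z : ℂ} (hz : 0 < z.re) : Summable (fun k => dT k z) := by
  set δ := min 1 (z.re / 2) with hδ
  have h0 : 0 < δ := by positivity
  refine Summable.of_norm_bounded (summable_aux.mul_left ((‖z‖ + 1 + 1) / δ)) fun k => ?_
  refine dT_bound h0 (min_le_left _ _) ?_ (by linarith) k
  exact (min_le_right _ _).trans_lt (by linarith)

lemma dP_diff {z : ℂ} (hz : 0 < z.re) : DifferentiableAt ℂ dP z := by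
  set δ := min 1 (z.re / 2) with hδ
  have h0 : 0 < δ := by positivity
  set U : Set ℂ := {w | δ < w.re} ∩ Metric.ball 0 (‖z‖ + 1)
  have hU : IsOpen U := (isOpen_lt continuous_const continuous_re).inter Metric.isOpen_ball
  have := differentiableOn_tsum_of_summable_norm (F := dT) (U := U)
    (summable_aux.mul_left ((‖z‖ + 1 + 1) / δ)) (fun k w hw => by
      have : w + k ≠ 0 := add_nat_ne (h0.trans hw.1) k
      apply DifferentiableAt.differentiableWithinAt
      unfold dT
      fun_prop (disch := assumption)) hU (fun k w hw => dT_bound h0 (min_le_left _ _) hw.1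
        (by simpa using hw.2) k)
  have hm : δ < z.re := (min_le_right _ _).trans_lt (by linarith)
  exact (this.differentiableAt (hU.mem_nhds ⟨hm, by simp⟩))

lemma dP_add_one {z : ℂ} (hz : 0 < z.re) : dP (z + 1) = dP z + 1 / z := by
  have hz1 : 0 < (z + 1).re := by simp; linarith
  have h1 := dT_summable hz
  have h2 := dT_summable hz1
  have : dP (z + 1) - dP z = 1 / z := by
    unfold dP
    rw [← h2.tsum_sub h1]
    refine HasSum.tsum_eq ?_
    have hs : Summable (fun k => dT k (z + 1) - dT k z) := h2.sub h1
    rw [hs.hasSum_iff_tendsto_nat]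
    have e : ∀ n, ∑ k ∈ Finset.range n, (dT k (z + 1) - dT k z) = 1 / z - 1 / (z + n) := by
      intro n
      have := Finset.sum_range_sub' (fun k : ℕ => 1 / (z + k)) n
      simp only [Nat.cast_zero, add_zero] at this
      rw [← this]
      refine Finset.sum_congr rfl fun k _ => ?_
      unfold dT; push_cast; ring_nf
    simp_rw [e]
    have : Tendsto (fun n : ℕ => 1 / (z + n)) atTop (𝓝 0) := by
      simp_rw [one_div]
      refine tendsto_inv₀_cobounded.comp ?_
      refine (tendsto_const_add_cobounded z).comp ?_
      rw [← tendsto_norm_atTop_iff_cobounded]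
      simpa using tendsto_natCast_atTop_atTop (R := ℝ)
    simpa using tendsto_const_nhds.sub this
  rw [← this]; ring

lemma dP_real (x : ℝ) :
    dP x = ((∑' k : ℕ, (1 / ((k:ℝ) + 1) - 1 / (x + k)) : ℝ) : ℂ) := by
  unfold dP dT; push_cast; rfl

lemma dP_mono {x y : ℝ} (hx : 0 < x) (hxy : x ≤ y) : (dP x).re ≤ (dP y).re := by
  have hs : ∀ x : ℝ, 0 < x → Summable (fun k : ℕ => (1 / ((k:ℝ) + 1) - 1 / (x + k))) := by
    intro x hx
    have := dT_summable (z := x) (by simpa using hx)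
    rw [← Complex.summable_ofReal]
    refine this.congr fun k => ?_
    unfold dT; push_cast; rfl
  rw [dP_real x, dP_real y, ofReal_re, ofReal_re]
  refine Summable.tsum_le_tsum (fun k => ?_) (hs x hx) (hs y (hx.trans_le hxy))
  have : (0:ℝ) ≤ k := k.cast_nonneg
  gcongr

lemma dP_im (x : ℝ) : (dP x).im = 0 := by rw [dP_real x, ofReal_im]

lemma ne_neg_nat {z : ℂ} (hz : 0 < z.re) (m : ℕ) : z ≠ -m := by
  rintro rfl; simp at hz
  have : (0:ℝ) ≤ m := m.cast_nonneg
  linarith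

lemma digamma_real {x : ℝ} (hx : 0 < x) :
    digamma x = ((deriv (Real.log ∘ Real.Gamma) x : ℝ) : ℂ) := by
  have h1 : HasDerivAt (fun x : ℝ => Complex.Gamma x) (deriv Complex.Gamma x) x :=
    (differentiableAt_Gamma x (ne_neg_nat (by simpa using hx))).hasDerivAt.comp_ofReal
  have hd : DifferentiableAt ℝ Real.Gamma x := by
    apply Real.differentiableAt_Gamma
    rintro m rfl
    have : (0:ℝ) ≤ m := m.cast_nonneg
    linarith
  have h2 : HasDerivAt (fun x : ℝ => Complex.Gamma x) ((deriv Real.Gamma x : ℝ) : ℂ) x := by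
    have := hd.hasDerivAt.ofReal_comp
    simpa [Complex.Gamma_ofReal] using this
  have h3 := h1.unique h2
  have hp := Real.Gamma_pos_of_pos hx
  have h4 : deriv (Real.log ∘ Real.Gamma) x = deriv Real.Gamma x / Real.Gamma x :=
    (hd.hasDerivAt.log hp.ne').deriv
  rw [h4, digamma_def, logDeriv_apply, h3, Complex.Gamma_ofReal]
  push_cast; rfl

lemma digamma_mono {x y : ℝ} (hx : 0 < x) (hxy : x ≤ y) : (digamma x).re ≤ (digamma y).re := by
  rw [digamma_real hx, digamma_real (hx.trans_le hxy), ofReal_re, ofReal_re]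
  refine Real.convexOn_log_Gamma.monotoneOn_deriv ?_ hx (hx.trans_le hxy) hxy
  intro z hz
  have hd : DifferentiableAt ℝ Real.Gamma z := by
    apply Real.differentiableAt_Gamma
    rintro m rfl
    have : (0:ℝ) ≤ m := m.cast_nonneg
    have : (0:ℝ) < -m := hz
    linarith
  exact hd.log (Real.Gamma_pos_of_pos hz).ne'

lemma shift_n {f : ℂ → ℂ} (hf : ∀ z : ℂ, 0 < z.re → f (z + 1) = f z + 1 / z) {g : ℂ → ℂ}
    (hg : ∀ z : ℂ, 0 < z.re → g (z + 1) = g z + 1 / z) {x : ℝ} (hx : 0 < x) (n : ℕ) :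
    f ((x + n : ℝ)) - g ((x + n : ℝ)) = f x - g x := by
  induction n with
  | zero => simp
  | succ n ih =>
    have hp : 0 < (((x + n : ℝ)) : ℂ).re := by simp; positivity
    have e : (((x + (n + 1 : ℕ) : ℝ)) : ℂ) = ((x + n : ℝ) : ℂ) + 1 := by push_cast; ring
    rw [e, hf _ hp, hg _ hp, ← ih]; ring

lemma digamma_step {x y : ℝ} (hx : 0 < x) (hxy : x ≤ y) (hy : y ≤ x + 1) :
    digamma x - dP x = digamma y - dP y := by
  have hy0 : 0 < y := hx.trans_le hxy
  have hdg : ∀ z : ℂ, 0 < z.re → digamma (z + 1) = digamma z + 1 / z := fun z hz => by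
    rw [digamma_apply_add_one z (ne_neg_nat hz)]; simp
  have hdp : ∀ z : ℂ, 0 < z.re → dP (z + 1) = dP z + 1 / z := fun z hz => dP_add_one hz
  have hb : ∀ n : ℕ, |((digamma x - dP x) - (digamma y - dP y)).re| ≤ 1 / ((n:ℝ) + x) := by
    intro n
    have hxn : 0 < x + n := by positivity
    rw [← shift_n hdg hdp hx n, ← shift_n hdg hdp hy0 n]
    have hre : 0 < (((x + n : ℝ)) : ℂ).re := by simp; positivity
    have a1 := digamma_mono hxn (show x + n ≤ y + n by linarith)
    have a2 := digamma_mono (x := y + n) (y := x + n + 1) (by linarith) (by linarith)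
    have b1 := dP_mono hxn (show x + n ≤ y + n by linarith)
    have b2 := dP_mono (x := y + n) (y := x + n + 1) (by linarith) (by linarith)
    have e : (((x + n + 1 : ℝ)) : ℂ) = ((x + n : ℝ) : ℂ) + 1 := by push_cast; ring
    have e2 : (1 / (((x + n : ℝ)) : ℂ)).re = 1 / (n + x) := by
      rw [← ofReal_one, ← ofReal_div, ofReal_re, add_comm]
    rw [e, hdg _ hre, add_re, e2] at a2
    rw [e, hdp _ hre, add_re, e2] at b2
    simp only [sub_re]
    rw [abs_le]; constructor <;> linarith
  have hlim : Tendsto (fun n : ℕ => 1 / ((n:ℝ) + x)) atTop (𝓝 0) := by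
    simp_rw [one_div]
    exact tendsto_inv_atTop_zero.comp (tendsto_atTop_add_const_right _ _ tendsto_natCast_atTop_atTop)
  have h0 : |((digamma x - dP x) - (digamma y - dP y)).re| ≤ 0 := ge_of_tendsto' hlim hb
  have h1 : ((digamma x - dP x) - (digamma y - dP y)).re = 0 := abs_nonpos_iff.1 h0
  rw [← sub_eq_zero]
  apply Complex.ext
  · simpa using h1
  · simp [dP_im x, dP_im y, digamma_real hx, digamma_real hy0]

lemma digamma_eq {z : ℂ} (hz : 0 < z.re) : digamma z = dP z + (digamma 1 - dP 1) := by
  have hU : IsOpen {z : ℂ | 0 < z.re} := isOpen_lt continuous_const continuous_re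
  have hc : IsPreconnected {z : ℂ | 0 < z.re} := (convex_halfSpace_re_gt 0).isPreconnected
  have h1 : AnalyticOnNhd ℂ digamma {z : ℂ | 0 < z.re} := by
    have hG : DifferentiableOn ℂ Gamma {z : ℂ | 0 < z.re} := fun w hw =>
      (differentiableAt_Gamma w (ne_neg_nat hw)).differentiableWithinAt
    apply DifferentiableOn.analyticOnNhd _ hU
    exact (hG.deriv hU).div hG (fun w hw => Gamma_ne_zero_of_re_pos hw)
  have h2 : AnalyticOnNhd ℂ (fun z => dP z + (digamma 1 - dP 1)) {z : ℂ | 0 < z.re} := by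
    apply DifferentiableOn.analyticOnNhd _ hU
    intro w hw
    exact ((dP_diff hw).add_const _).differentiableWithinAt
  refine h1.eqOn_of_preconnected_of_frequently_eq h2 hc (z₀ := 1) (by simp) ?_ hz
  have hev : ∀ᶠ x : ℝ in 𝓝[>] 1, digamma x = dP x + (digamma 1 - dP 1) := by
    have : Ioo (1:ℝ) 2 ∈ 𝓝[>] (1:ℝ) := Ioo_mem_nhdsGT (by norm_num)
    filter_upwards [this] with x hx
    have := digamma_step (x := 1) (y := x) one_pos hx.1.le (by linarith [hx.2])
    push_cast at this
    rw [this]; ring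
  have ht : Tendsto (fun x : ℝ => (x:ℂ)) (𝓝[>] 1) (𝓝[≠] 1) := by
    refine tendsto_nhdsWithin_iff.2 ⟨?_, ?_⟩
    · exact (continuous_ofReal.tendsto' 1 1 (by simp)).mono_left nhdsWithin_le_nhds
    · filter_upwards [self_mem_nhdsWithin] with x hx
      have : x ≠ 1 := ne_of_gt hx
      simpa using this
  exact ht.frequently hev.frequently

/-- The Gamma-part, summed. -/
lemma digamma_hasSum {s : ℂ} (hs : -2 < s.re) :
    HasSum (fun k : ℕ => (s - 1) / ((2 * (k:ℂ) + 3) * (2 * k + 2 + s)))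
      ((digamma (s / 2 + 1) - digamma (3 / 2)) / 2) := by
  have h1 : 0 < (s / 2 + 1).re := by simp; linarith
  have h2 : 0 < (3 / 2 : ℂ).re := by norm_num
  have a := (dT_summable h1).hasSum
  have b := (dT_summable h2).hasSum
  have c := (a.sub b).div_const 2
  have e : (∑' k, dT k (s / 2 + 1) - ∑' k, dT k (3 / 2)) / 2 = (digamma (s / 2 + 1) - digamma (3 / 2)) / 2 := by
    rw [digamma_eq h1, digamma_eq h2]; unfold dP; ring
  rw [e] at c
  convert! c using 1
  ext k
  have n1 := add_nat_ne h1 k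
  have n2 := add_nat_ne h2 k
  have n3 : 2 * (k:ℂ) + 3 ≠ 0 := by
    intro h; apply n2; linear_combination h / 2
  have n4 : 2 * (k:ℂ) + 2 + s ≠ 0 := by
    intro h; apply n1; linear_combination h / 2
  unfold dT
  have e1 : 1 / (s / 2 + 1 + k) = 2 / (2 * (k:ℂ) + 2 + s) := by
    rw [div_eq_div_iff n1 n4]; ring
  have e2 : 1 / (3 / 2 + (k:ℂ)) = 2 / (2 * (k:ℂ) + 3) := by
    rw [div_eq_div_iff n2 n3]; ring
  rw [e1, e2]
  generalize 1 / ((k:ℂ) + 1) = C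
  rw [show (C - 2 / (2 * (k:ℂ) + 2 + s) - (C - 2 / (2 * (k:ℂ) + 3))) / 2
    = 1 / (2 * (k:ℂ) + 3) - 1 / (2 * (k:ℂ) + 2 + s) by ring, div_sub_div _ _ n3 n4]
  congr 1
  ring

lemma digamma_three_half : digamma (3 / 2) = 2 - 2 * Real.log 2 - Real.eulerMascheroniConstant := by
  have := digamma_apply_add_one (1 / 2) (ne_neg_nat (by norm_num))
  rw [show (1 / 2 : ℂ) + 1 = 3 / 2 by norm_num, digamma_one_half] at this
  rw [this]
  have : Complex.log 2 = (Real.log 2 : ℝ) := by rw [ofReal_log (by norm_num)]; norm_num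
  rw [this]
  norm_num
  ring

end digam
end RHPi

namespace RHPi
section blocks
open Complex Set Topology

lemma integrable_inv_sq_add {d : ℝ} (hd : 0 < d) : Integrable (fun t : ℝ => 1 / (d ^ 2 + t ^ 2)) := by
  have h := (integrable_inv_one_add_sq.comp_div hd.ne').const_mul (1 / d ^ 2)
  refine h.congr (Eventually.of_forall fun t => ?_)
  simp only
  field_simp

lemma integral_inv_sq_add {d : ℝ} (hd : 0 < d) : ∫ t : ℝ, 1 / (d ^ 2 + t ^ 2) = Real.pi / d := by
  have h : ∀ t : ℝ, 1 / (d ^ 2 + t ^ 2) = (1 / d ^ 2) * (fun x : ℝ => (1 + x ^ 2)⁻¹) (t / d) := by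
    intro t; simp only; field_simp
  simp_rw [h]
  rw [integral_const_mul, Measure.integral_comp_div (fun x : ℝ => (1 + x ^ 2)⁻¹) d,
    integral_univ_inv_one_add_sq, abs_of_pos hd, smul_eq_mul]
  field_simp

lemma normSq_line (p t : ℝ) : ‖(1 + t * I : ℂ) + p‖ ^ 2 = (1 + p) ^ 2 + t ^ 2 := by
  rw [← normSq_eq_norm_sq, normSq_apply]; simp; ring

lemma line_ne {p : ℝ} (hp : -1 < p) (t : ℝ) : (1 + t * I : ℂ) + p ≠ 0 := by
  intro h
  have := congrArg Complex.re h
  simp at this; linarith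

lemma block_integrable {p q : ℝ} (hp : -1 < p) (hq : -1 < q) :
    Integrable (fun t : ℝ => 1 / (((1 + t * I : ℂ) + p) * ((1 + t * I : ℂ) + q))) := by
  have h := ((integrable_inv_sq_add (d := 1 + p) (by linarith)).add
    (integrable_inv_sq_add (d := 1 + q) (by linarith)))
  refine h.mono' ?_ (Eventually.of_forall fun t => ?_)
  · apply Continuous.aestronglyMeasurable
    apply Continuous.div continuous_const (by fun_prop)
    intro t
    exact mul_ne_zero (line_ne hp t) (line_ne hq t)
  · have n1 := norm_pos_iff.mpr (line_ne hp t)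
    have n2 := norm_pos_iff.mpr (line_ne hq t)
    simp only [Pi.add_apply]
    rw [← normSq_line, ← normSq_line, norm_div, norm_mul, norm_one]
    generalize ‖(1 + t * I : ℂ) + p‖ = x at *
    generalize ‖(1 + t * I : ℂ) + q‖ = y at *
    rw [div_add_div _ _ (by positivity) (by positivity), div_le_div_iff₀ (by positivity) (by positivity)]
    nlinarith [mul_pos n1 n2, sq_nonneg (x - y), mul_pos (mul_pos n1 n2) (mul_pos n1 n2), mul_nonneg (mul_pos n1 n2).le (sq_nonneg (x-y)), mul_nonneg (mul_pos n1 n2).le (sq_nonneg (x+y))]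

lemma laplace_inv {g : ℝ → ℝ} {G : ℂ → ℂ} (hc : Continuous g) (h0 : ∀ u ≤ 0, g u = 0)
    (hi : IntegrableOn (fun u => g u * Real.exp (-u)) (Ioi 0))
    (hL : ∀ t : ℝ, ∫ u in Ioi (0:ℝ), (g u : ℂ) * cexp (-(1 + t * I) * u) = G (1 + t * I))
    (hG : Integrable (fun t : ℝ => G (1 + t * I))) (u : ℝ) :
    ∫ t : ℝ, G (1 + t * I) * cexp ((1 + t * I) * u) = 2 * Real.pi * g u := by
  set f : ℝ → ℂ := fun u => ((g u * Real.exp (-u) : ℝ) : ℂ) with hf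
  have hfc : Continuous f := by fun_prop
  have hfi : Integrable f := by
    apply Integrable.ofReal
    rw [← integrableOn_univ, ← Iic_union_Ioi (a := (0:ℝ))]
    apply IntegrableOn.union _ hi
    apply (integrableOn_zero).congr_fun (f := fun _ => (0:ℝ)) _ measurableSet_Iic
    intro x hx
    simp [h0 x hx]
  have hF : ∀ ξ : ℝ, FourierTransform.fourier f ξ = G (1 + (2 * Real.pi * ξ : ℝ) * I) := by
    intro ξ
    rw [← hL, Real.fourier_real_eq_integral_exp_smul]
    rw [← setIntegral_eq_integral_of_forall_compl_eq_zero (s := Ioi (0:ℝ))]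
    · apply setIntegral_congr_fun measurableSet_Ioi
      intro v _
      simp only [hf, smul_eq_mul]
      push_cast
      rw [mul_left_comm, ← Complex.exp_add]
      congr 2; ring
    · intro x hx
      simp [hf, h0 x (by simpa using hx)]
  have hpi : (2 * Real.pi) ≠ 0 := by positivity
  have hFi : Integrable (FourierTransform.fourier f) := by
    have := hG.comp_mul_left' hpi
    exact this.congr (Eventually.of_forall fun t => (hF t).symm)
  have key := hfi.fourierInv_fourier_eq hFi (hfc.continuousAt (x := u))
  rw [Real.fourierInv_eq'] at key
  have e1 : ∀ v : ℝ, cexp ((2 * Real.pi * inner ℝ v u : ℝ) * I) • FourierTransform.fourier f v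
      = (fun t : ℝ => G (1 + t * I) * cexp (t * I * u)) (2 * Real.pi * v) := by
    intro v
    rw [hF]
    have hin : inner ℝ v u = u * v := by simp [RCLike.inner_apply]
    simp only [smul_eq_mul, hin]
    rw [mul_comm]
    congr 2
    push_cast; ring
  simp_rw [e1] at key
  rw [Measure.integral_comp_mul_left (fun t : ℝ => G (1 + t * I) * cexp (t * I * u))] at key
  have e2 : ∀ t : ℝ, G (1 + t * I) * cexp ((1 + t * I) * u) = cexp u * (G (1 + t * I) * cexp (t * I * u)) := by
    intro t
    rw [add_mul, Complex.exp_add, one_mul]; ring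
  simp_rw [e2]
  rw [integral_const_mul]
  rw [abs_of_pos (by positivity)] at key
  have e3 : ∫ t : ℝ, G (1 + t * I) * cexp (t * I * u) = 2 * Real.pi * f u := by
    rw [← key, Complex.real_smul]
    generalize (∫ t : ℝ, G (1 + t * I) * cexp (t * I * u)) = X
    push_cast
    field_simp
  rw [e3, hf]
  simp only
  push_cast
  have e4 : cexp u * cexp (-u) = 1 := by rw [← Complex.exp_add]; simp
  linear_combination (2 * Real.pi * (g u : ℂ)) * e4

lemma exp_lap {p : ℝ} (hp : -1 < p) (t : ℝ) :
    IntegrableOn (fun u : ℝ => cexp (-(((1 + t * I : ℂ) + p)) * u)) (Ioi 0) ∧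
    ∫ u in Ioi (0:ℝ), cexp (-(((1 + t * I : ℂ) + p)) * u) = 1 / ((1 + t * I : ℂ) + p) := by
  have hre : (-((1 + t * I : ℂ) + p)).re < 0 := by simp; linarith
  refine ⟨integrableOn_exp_mul_complex_Ioi hre 0, ?_⟩
  rw [integral_exp_mul_complex_Ioi hre 0]
  simp [neg_div_neg_eq, -neg_add_rev]

noncomputable def g1 (p q u : ℝ) : ℝ :=
  (Real.exp (-p * max u 0) - Real.exp (-q * max u 0)) / (q - p)

lemma block1 {p q : ℝ} (hp : -1 < p) (hq : -1 < q) (hpq : p ≠ q) (u : ℝ) :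
    ∫ t : ℝ, 1 / (((1 + t * I : ℂ) + p) * ((1 + t * I : ℂ) + q)) * cexp ((1 + t * I) * u)
      = 2 * Real.pi * g1 p q u := by
  apply laplace_inv (G := fun w => 1 / ((w + p) * (w + q)))
  · unfold g1; fun_prop
  · intro u hu; unfold g1; rw [max_eq_right hu]; simp
  · have i1 := integrableOn_exp_mul_Ioi (a := -(1 + p)) (by linarith) 0
    have i2 := integrableOn_exp_mul_Ioi (a := -(1 + q)) (by linarith) 0
    have i3 : IntegrableOn _ (Ioi (0:ℝ)) := (i1.sub i2).div_const (q - p)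
    refine i3.congr_fun ?_ measurableSet_Ioi
    intro v hv
    simp only [g1, Pi.sub_apply, max_eq_left (le_of_lt (mem_Ioi.mp hv))]
    rw [div_mul_eq_mul_div, sub_mul, ← Real.exp_add, ← Real.exp_add]
    congr 4 <;> ring
  · intro t
    obtain ⟨i1, j1⟩ := exp_lap hp t
    obtain ⟨i2, j2⟩ := exp_lap hq t
    have : ∫ u in Ioi (0:ℝ), (g1 p q u : ℂ) * cexp (-(1 + t * I) * u) =
        ∫ u in Ioi (0:ℝ), (cexp (-(((1 + t * I : ℂ) + p)) * u) - cexp (-(((1 + t * I : ℂ) + q)) * u)) / (q - p) := by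
      apply setIntegral_congr_fun measurableSet_Ioi
      intro v hv
      simp only [g1, max_eq_left (le_of_lt (mem_Ioi.mp hv))]
      push_cast
      rw [div_mul_eq_mul_div, sub_mul, ← Complex.exp_add, ← Complex.exp_add]
      congr 4 <;> ring
    rw [this, integral_div, integral_sub i1 i2, j1, j2]
    have n1 := line_ne hp t
    have n2 := line_ne hq t
    have n3 : (q:ℂ) - p ≠ 0 := by
      rw [← ofReal_sub]; exact_mod_cast sub_ne_zero.mpr hpq.symm
    rw [div_sub_div _ _ n1 n2, div_div, div_eq_div_iff (by positivity) (by positivity)]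
    ring
  · exact block_integrable hp hq

noncomputable def g2 (p u : ℝ) : ℝ := max u 0 * Real.exp (-p * max u 0)

lemma int_u_exp {z : ℂ} (hz : 0 < z.re) :
    ∫ u in Ioi (0:ℝ), (u:ℂ) * cexp (-(z * u)) = 1 / (z * z) := by
  have hz0 : z ≠ 0 := by rintro rfl; simp at hz
  have hn : ∀ v : ℝ, ‖cexp (-(z * v))‖ = Real.exp (-z.re * v) := by
    intro v; rw [norm_exp]; simp
  have lim : ∀ k : ℝ, Tendsto (fun v : ℝ => v ^ k * Real.exp (-z.re * v)) atTop (𝓝 0) := fun k =>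
    tendsto_rpow_mul_exp_neg_mul_atTop_nhds_zero k z.re hz
  have hi : IntegrableOn (fun u : ℝ => (u:ℂ) * cexp (-(z * u))) (Ioi 0) := by
    have i1 := integrableOn_rpow_mul_exp_neg_mul_rpow (s := 1) (p := 1) (b := z.re) (by norm_num) (by norm_num) hz
    refine Integrable.mono' i1 (by apply Continuous.aestronglyMeasurable; fun_prop) ?_
    rw [ae_restrict_iff' measurableSet_Ioi]
    refine Eventually.of_forall fun v hv => ?_
    rw [norm_mul, hn, norm_real, Real.norm_eq_abs, abs_of_pos hv, Real.rpow_one]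
  have h := integral_Ioi_of_hasDerivAt_of_tendsto' (a := 0) (m := 0)
    (f := fun u : ℝ => -((u:ℂ) / z + 1 / (z * z)) * cexp (-(z * u)))
    (f' := fun u : ℝ => (u:ℂ) * cexp (-(z * u))) ?_ hi ?_
  · rw [h]; simp
  · intro v _
    have h1 : HasDerivAt (fun u : ℂ => -(u / z + 1 / (z * z)) * cexp (-(z * u))) ((v:ℂ) * cexp (-(z * v))) (v:ℂ) := by
      have a1 : HasDerivAt (fun u : ℂ => -(u / z + 1 / (z * z))) (-(1 / z)) (v:ℂ) :=
        (((hasDerivAt_id (v:ℂ)).div_const z).add_const _).neg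
      have a2 : HasDerivAt (fun u : ℂ => -(z * u)) (-z) (v:ℂ) := by
        convert! ((hasDerivAt_id (v:ℂ)).const_mul z).neg using 1; simp
      convert! a1.fun_mul a2.cexp using 1
      field_simp
      ring
    exact h1.comp_ofReal
  · rw [tendsto_zero_iff_norm_tendsto_zero]
    have l := ((lim 1).mul_const ‖1 / z‖).add ((lim 0).mul_const ‖1 / (z * z)‖)
    simp only [zero_mul, add_zero] at l
    refine squeeze_zero' (Eventually.of_forall fun v => norm_nonneg _) ?_ l
    filter_upwards [eventually_gt_atTop 0] with v hv
    rw [norm_mul, norm_neg, hn, Real.rpow_one, Real.rpow_zero, one_mul]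
    have : ‖(v:ℂ) / z + 1 / (z * z)‖ ≤ v * ‖1 / z‖ + ‖1 / (z * z)‖ := by
      refine (norm_add_le _ _).trans ?_
      gcongr
      rw [div_eq_mul_one_div, norm_mul, norm_real, Real.norm_eq_abs, abs_of_pos hv]
    nlinarith [Real.exp_pos (-z.re * v)]

lemma block2 {p : ℝ} (hp : -1 < p) (u : ℝ) :
    ∫ t : ℝ, 1 / (((1 + t * I : ℂ) + p) * ((1 + t * I : ℂ) + p)) * cexp ((1 + t * I) * u)
      = 2 * Real.pi * g2 p u := by
  apply laplace_inv (G := fun w => 1 / ((w + p) * (w + p)))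
  · unfold g2; fun_prop
  · intro u hu; unfold g2; rw [max_eq_right hu]; simp
  · have i1 := integrableOn_rpow_mul_exp_neg_mul_rpow (s := 1) (p := 1) (b := 1 + p) (by norm_num) (by norm_num) (by linarith)
    refine i1.congr_fun ?_ measurableSet_Ioi
    intro v hv
    simp only [g2, max_eq_left (le_of_lt (mem_Ioi.mp hv)), Real.rpow_one]
    rw [mul_assoc, ← Real.exp_add]
    congr 2; ring
  · intro t
    have hre : 0 < ((1 + t * I : ℂ) + p).re := by simp; linarith
    have : ∫ u in Ioi (0:ℝ), (g2 p u : ℂ) * cexp (-(1 + t * I) * u) =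
        ∫ u in Ioi (0:ℝ), (u:ℂ) * cexp (-(((1 + t * I : ℂ) + p) * u)) := by
      apply setIntegral_congr_fun measurableSet_Ioi
      intro v hv
      simp only [g2, max_eq_left (le_of_lt (mem_Ioi.mp hv))]
      push_cast
      rw [mul_assoc, ← Complex.exp_add]
      congr 2; ring
    rw [this]
    exact int_u_exp hre
  · exact block_integrable hp hp

lemma line_shift {Φ : ℂ → ℂ} {C : ℝ} (hd : ∀ w : ℂ, 0 ≤ w.re → DifferentiableAt ℂ Φ w)
    (hC : ∀ x ∈ Icc (0:ℝ) 1, ∀ t : ℝ, ‖Φ (x + t * I)‖ ≤ C * (1 + t ^ 2) ^ (-(3:ℝ) / 4)) (u : ℝ) :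
    (∀ x ∈ Icc (0:ℝ) 1, Integrable (fun t : ℝ => Φ (x + t * I) * cexp ((x + t * I) * u))) ∧
    ∫ t : ℝ, Φ (t * I) * cexp (t * I * u) = ∫ t : ℝ, Φ (1 + t * I) * cexp ((1 + t * I) * u) := by
  set Ψ : ℂ → ℂ := fun w => Φ w * cexp (w * u) with hΨ
  have hΨd : ∀ w : ℂ, 0 ≤ w.re → DifferentiableAt ℂ Ψ w := by
    intro w hw
    exact (hd w hw).mul (by fun_prop)
  have hE : ∀ (x t : ℝ), ‖Ψ (x + t * I)‖ = ‖Φ (x + t * I)‖ * Real.exp (x * u) := by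
    intro x t
    simp only [hΨ, norm_mul, norm_exp]; simp
  have hB : ∀ x ∈ Icc (0:ℝ) 1, ∀ t : ℝ, ‖Ψ (x + t * I)‖ ≤ (C * Real.exp |u|) * (1 + t ^ 2) ^ (-(3:ℝ) / 4) := by
    intro x hx t
    rw [hE]
    have h1 := hC x hx t
    have h2 : Real.exp (x * u) ≤ Real.exp |u| := by
      apply Real.exp_le_exp.mpr
      have := le_abs_self u
      have := abs_nonneg u
      nlinarith [hx.1, hx.2]
    calc _ ≤ (C * (1 + t ^ 2) ^ (-(3:ℝ) / 4)) * Real.exp |u| := by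
          apply mul_le_mul h1 h2 (by positivity) ((norm_nonneg _).trans h1)
      _ = _ := by ring
  have hI : ∀ x ∈ Icc (0:ℝ) 1, Integrable (fun t : ℝ => Ψ (x + t * I)) := by
    intro x hx
    have := integrable_rpow_neg_one_add_norm_sq (E := ℝ) (μ := volume) (r := 3 / 2) (by simp; norm_num)
    refine (this.const_mul (C * Real.exp |u|)).mono' ?_ (Eventually.of_forall fun t => ?_)
    · apply Continuous.aestronglyMeasurable
      rw [continuous_iff_continuousAt]
      intro t
      have h := (hΨd (x + t * I) (by simpa using hx.1)).continuousAt
      exact ContinuousAt.comp (f := fun t : ℝ => (x + t * I : ℂ)) (g := Ψ) h (by fun_prop)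
    · have := hB x hx t
      rw [Real.norm_eq_abs, sq_abs]
      convert! this using 3
      norm_num
  refine ⟨hI, ?_⟩
  have t1 := intervalIntegral_tendsto_integral (hI 0 (by simp)) tendsto_neg_atTop_atBot tendsto_id
  have t2 := intervalIntegral_tendsto_integral (hI 1 (by simp)) tendsto_neg_atTop_atBot tendsto_id
  simp only [ofReal_zero, zero_add, ofReal_one, id] at t1 t2
  refine tendsto_nhds_unique t1 ?_
  have hr : ∀ T : ℝ, (∫ t in -T..T, Ψ (t * I)) = (∫ t in -T..T, Ψ (1 + t * I)) +
      (-I) * ((∫ x in (0:ℝ)..1, Ψ (x + (-T : ℝ) * I)) - ∫ x in (0:ℝ)..1, Ψ (x + T * I)) := by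
    intro T
    have h := integral_boundary_rect_eq_zero_of_differentiableOn Ψ (-T * I) (1 + T * I) (by
      intro w hw
      apply DifferentiableAt.differentiableWithinAt
      apply hΨd
      have := hw.1
      simp at this
      exact this.1)
    simp at h
    simp only [ofReal_neg, neg_mul] at h ⊢
    linear_combination (I) * h + ((∫ t in -T..T, Ψ (t * I)) - (∫ t in -T..T, Ψ (1 + t * I))) * I_sq
  simp_rw [hr]
  have hz : ∀ σ : ℝ, σ ^ 2 = 1 → Tendsto (fun T : ℝ => ∫ x in (0:ℝ)..1, Ψ (x + (σ * T : ℝ) * I)) atTop (𝓝 0) := by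
    intro σ hσ
    have hlim : Tendsto (fun T : ℝ => (C * Real.exp |u|) * (1 + T ^ 2) ^ (-(3:ℝ) / 4)) atTop (𝓝 0) := by
      have : Tendsto (fun T : ℝ => 1 + T ^ 2) atTop atTop :=
        tendsto_atTop_add_const_left _ _ (tendsto_pow_atTop (by norm_num))
      have h2 := (tendsto_rpow_neg_atTop (y := 3 / 4) (by norm_num)).comp this
      have h3 := h2.const_mul (C * Real.exp |u|)
      rw [mul_zero] at h3
      refine h3.congr fun T => ?_
      simp only [Function.comp]; norm_num
    apply squeeze_zero_norm _ hlim
    intro T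
    have := intervalIntegral.norm_integral_le_of_norm_le_const (a := 0) (b := 1) (f := fun x : ℝ => Ψ (x + (σ * T : ℝ) * I))
      (C := (C * Real.exp |u|) * (1 + T ^ 2) ^ (-(3:ℝ) / 4)) (by
        intro x hx
        rw [uIoc_of_le (by norm_num)] at hx
        have := hB x ⟨hx.1.le, hx.2⟩ (σ * T)
        rwa [mul_pow, hσ, one_mul] at this)
    simpa using this
  have z1 := hz (-1) (by norm_num)
  have z2 := hz 1 (by norm_num)
  simp only [neg_mul, one_mul] at z1 z2
  have := t2.add ((z1.sub z2).const_mul (-I))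
  simpa using this

end blocks
end RHPi

namespace RHPi
section phi
open Complex Set Topology

lemma FX_diff (hZ : ∀ s : ℂ, 1 / 2 < s.re → riemannZeta₁ s ≠ 0) {s : ℂ} (hs : 1 / 2 < s.re) :
    DifferentiableAt ℂ (logDeriv Xi) s := by
  unfold logDeriv
  apply DifferentiableAt.div
  · exact (Xi_diff.deriv) s
  · exact Xi_diff s
  · exact Xi_ne_zero hZ hs

noncomputable def Phi (a : ℝ) (w : ℂ) : ℂ :=
  - dslope (fun w => logDeriv Xi (1 / 2 + a + w)) ((1 / 2 - a : ℝ) : ℂ) w / (w + (1 / 2 - a : ℝ))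

lemma add_c_ne {c : ℝ} (hc : 0 < c) {w : ℂ} (hw : -c < w.re) : w + c ≠ 0 := by
  intro h
  have := congrArg Complex.re h
  simp at this; linarith

lemma Phi_diff (hZ : ∀ s : ℂ, 1 / 2 < s.re → riemannZeta₁ s ≠ 0) {a : ℝ} (ha : 0 < a) (ha' : a < 1 / 2)
    {w : ℂ} (hw : 0 ≤ w.re) : DifferentiableAt ℂ (Phi a) w := by
  unfold Phi
  apply DifferentiableAt.fun_div
  · apply DifferentiableAt.fun_neg
    have ho : IsOpen {w : ℂ | -a < w.re} := isOpen_lt continuous_const continuous_re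
    have hd : DifferentiableOn ℂ (fun w => logDeriv Xi (1 / 2 + a + w)) {w : ℂ | -a < w.re} := by
      intro z hz
      have hz' : -a < z.re := hz
      apply DifferentiableAt.differentiableWithinAt
      have h2 : DifferentiableAt ℂ (logDeriv Xi) (1 / 2 + a + z) := FX_diff hZ (by simp; linarith)
      exact h2.comp z (f := fun w => (1 / 2 + a + w : ℂ)) (by fun_prop)
    have h3 := (Complex.differentiableOn_dslope (c := ((1 / 2 - a : ℝ) : ℂ)) (ho.mem_nhds (by
      show -a < _; rw [ofReal_re]; linarith))).mpr hd
    exact h3.differentiableAt (ho.mem_nhds (show -a < w.re by linarith))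
  · fun_prop
  · exact add_c_ne (by linarith) (by linarith)

lemma Phi_eq (a : ℝ) {w : ℂ} (hw : w ≠ (1 / 2 - a : ℝ)) :
    Phi a w = (logDeriv Xi 1 - logDeriv Xi (1 / 2 + a + w)) /
      ((w - (1 / 2 - a : ℝ)) * (w + (1 / 2 - a : ℝ))) := by
  unfold Phi
  rw [dslope_of_ne _ hw, slope_def_field]
  rw [show (1 / 2 + a + (1 / 2 - a : ℝ) : ℂ) = 1 by push_cast; ring, ← neg_div, neg_sub, div_div]

lemma FX_growth (hZ : ∀ s : ℂ, 1 / 2 < s.re → riemannZeta₁ s ≠ 0) {a : ℝ} (ha : 0 < a) :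
    ∃ K : ℝ, 0 ≤ K ∧ ∀ s : ℂ, 1 / 2 + a ≤ s.re → s.re ≤ 2 → 1 ≤ |s.im| →
      ‖logDeriv Xi s‖ ≤ K * √|s.im| := by
  have hsum : Summable (fun k : ℕ => 1 / (((k:ℝ) + 1) * √(k + 1))) := by
    have := (summable_nat_add_iff 1).mpr (Real.summable_one_div_nat_rpow (p := 3 / 2) |>.mpr (by norm_num))
    refine this.congr fun k => ?_
    have hk : (0:ℝ) < k + 1 := by positivity
    push_cast
    rw [show (3 / 2 : ℝ) = 1 + 1 / 2 by norm_num, Real.rpow_add hk, Real.rpow_one, ← Real.sqrt_eq_rpow]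
  set S := ∑' k : ℕ, 1 / (((k:ℝ) + 1) * √(k + 1)) with hS
  set M := ‖(-(Real.log Real.pi / 2) + digamma (3 / 2) / 2 : ℂ)‖ with hM
  have hS0 : 0 ≤ S := tsum_nonneg fun k => by positivity
  refine ⟨3 / (a / 2) ^ 2 * 21 + M + 3 * S, by positivity, fun s h1 h2 h3 => ?_⟩
  have hre : 0 < s.re := by linarith
  rw [Xi_logDeriv hre (hZ s (by linarith))]
  have hT : 1 ≤ √|s.im| := by rw [Real.one_le_sqrt]; exact h3
  have b1 : ‖logDeriv riemannZeta₁ s‖ ≤ 3 / (a / 2) ^ 2 * 21 * √|s.im| := by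
    refine (bc_logDeriv hZ (δ := a / 2) (by positivity) (by linarith) h2).trans ?_
    rw [mul_assoc]
    gcongr
    unfold gr
    have : √(|s.im| + 5) ≤ 3 * √|s.im| := by
      rw [show (3:ℝ) = √(3 ^ 2) by rw [Real.sqrt_sq (by norm_num)], ← Real.sqrt_mul (by norm_num)]
      apply Real.sqrt_le_sqrt; nlinarith
    linarith
  have b2 : ‖(digamma (s / 2 + 1) - digamma (3 / 2)) / 2‖ ≤ 3 * S * √|s.im| := by
    have hh := digamma_hasSum (s := s) (by linarith)
    rw [← hh.tsum_eq]
    have hg := (hsum.hasSum).mul_left (3 * √|s.im|)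
    refine (tsum_of_norm_bounded hg fun k => ?_).trans (by rw [← hS]; apply le_of_eq; ring)
    have e1 : ‖s - 1‖ ≤ 3 * |s.im| := by
      refine (norm_le_abs_re_add_abs_im _).trans ?_
      have : |s.re - 1| ≤ 1 := by rw [abs_le]; constructor <;> linarith
      simp; linarith
    have e2 : √(k + 1) * √|s.im| ≤ ‖2 * (k:ℂ) + 2 + s‖ := by
      rw [← Real.sqrt_mul (by positivity), Complex.norm_def]
      apply Real.sqrt_le_sqrt
      rw [normSq_apply]
      simp only [add_re, mul_re, re_ofNat, natCast_re, im_ofNat, natCast_im, mul_zero, sub_zero, add_im, mul_im, zero_mul, add_zero, zero_add]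
      have hk : (0:ℝ) ≤ k := by positivity
      have := abs_mul_abs_self s.im
      nlinarith [sq_nonneg ((k:ℝ) + 1 - |s.im|), mul_nonneg hk hre.le]
    have e3 : ‖2 * (k:ℂ) + 3‖ = 2 * (k:ℝ) + 3 := by
      rw [show (2 * (k:ℂ) + 3) = ((2 * (k:ℝ) + 3 : ℝ) : ℂ) by push_cast; ring, norm_real, Real.norm_eq_abs, abs_of_pos (by positivity)]
    rw [norm_div, norm_mul, e3]
    have hsk : 0 < √((k:ℝ) + 1) := Real.sqrt_pos.mpr (by positivity)
    calc ‖s - 1‖ / ((2 * k + 3) * ‖2 * (k:ℂ) + 2 + s‖) ≤ 3 * |s.im| / (((k:ℝ) + 1) * (√(k + 1) * √|s.im|)) := by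
          apply div_le_div₀ (by positivity) e1 (by positivity)
          apply mul_le_mul (by linarith [(Nat.cast_nonneg k : (0:ℝ) ≤ k)]) e2 (by positivity) (by positivity)
      _ = 3 * √|s.im| * (1 / ((k + 1) * √(k + 1))) := by
          nth_rw 1 [← Real.mul_self_sqrt (abs_nonneg s.im)]
          field_simp
  have e : logDeriv riemannZeta₁ s - Real.log Real.pi / 2 + digamma (s / 2 + 1) / 2 =
    logDeriv riemannZeta₁ s + (-(Real.log Real.pi / 2) + digamma (3 / 2) / 2 : ℂ) + (digamma (s / 2 + 1) - digamma (3 / 2)) / 2 := by ring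
  rw [e]
  refine (norm_add₃_le).trans ?_
  rw [← hM]
  have : M ≤ M * √|s.im| := le_mul_of_one_le_right (norm_nonneg _) hT
  linarith

lemma Phi_growth (hZ : ∀ s : ℂ, 1 / 2 < s.re → riemannZeta₁ s ≠ 0) {a : ℝ} (ha : 0 < a) (ha' : a < 1 / 2) :
    ∃ C : ℝ, ∀ x ∈ Icc (0:ℝ) 1, ∀ t : ℝ, ‖Phi a (x + t * I)‖ ≤ C * (1 + t ^ 2) ^ (-(3:ℝ) / 4) := by
  obtain ⟨K, hK, hF⟩ := FX_growth hZ ha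
  have hcomp : IsCompact (Icc (0:ℝ) 1 ×ℂ Icc (-1:ℝ) 1) := isCompact_Icc.reProdIm isCompact_Icc
  obtain ⟨M, hM⟩ := hcomp.exists_bound_of_continuousOn (f := Phi a) (fun w hw =>
    (Phi_diff hZ ha ha' hw.1.1).continuousAt.continuousWithinAt)
  have hM0 : 0 ≤ M := (norm_nonneg _).trans (hM 0 (by constructor <;> simp))
  refine ⟨2 * M + 2 * (‖logDeriv Xi 1‖ + K), fun x hx t => ?_⟩
  have hp : (0:ℝ) < 1 + t ^ 2 := by positivity
  have hpp := Real.rpow_pos_of_pos hp (-(3:ℝ) / 4)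
  have hn := norm_nonneg (logDeriv Xi 1)
  rcases le_total |t| 1 with ht | ht
  · have h1 := hM (x + t * I) (by
      constructor
      · simpa using hx
      · simpa using abs_le.mp ht)
    have h2 : (1:ℝ) / 2 ≤ (1 + t ^ 2) ^ (-(3:ℝ) / 4) := by
      have t2 : t ^ 2 ≤ 1 := by rw [← sq_abs]; nlinarith [abs_nonneg t]
      calc (1:ℝ) / 2 = 2 ^ (-1:ℝ) := by rw [Real.rpow_neg_one]; norm_num
        _ ≤ 2 ^ (-(3:ℝ) / 4) := Real.rpow_le_rpow_of_exponent_le (by norm_num) (by norm_num)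
        _ ≤ _ := Real.rpow_le_rpow_of_nonpos hp (by linarith) (by norm_num)
    nlinarith
  · have hne : (x + t * I : ℂ) ≠ (1 / 2 - a : ℝ) := by
      intro h
      have := congrArg Complex.im h
      simp at this
      rw [this] at ht; norm_num at ht
    rw [Phi_eq a hne]
    have hT : 1 ≤ √|t| := by rw [Real.one_le_sqrt]; exact ht
    have hb := hF (1 / 2 + a + (x + t * I)) (by simp; linarith [hx.1]) (by simp; linarith [hx.2]) (by simpa using ht)
    have him : (1 / 2 + a + (x + t * I) : ℂ).im = t := by simp
    rw [him] at hb
    have d1 : |t| ≤ ‖(x + t * I : ℂ) - (1 / 2 - a : ℝ)‖ := by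
      have := abs_im_le_norm ((x + t * I : ℂ) - (1 / 2 - a : ℝ)); simpa using this
    have d2 : |t| ≤ ‖(x + t * I : ℂ) + (1 / 2 - a : ℝ)‖ := by
      have := abs_im_le_norm ((x + t * I : ℂ) + (1 / 2 - a : ℝ)); simpa using this
    have tp : 0 < |t| := by linarith
    rw [norm_div, norm_mul]
    have n1 : ‖logDeriv Xi 1 - logDeriv Xi (1 / 2 + a + (x + t * I))‖ ≤ (‖logDeriv Xi 1‖ + K) * √|t| := by
      refine (norm_sub_le _ _).trans ?_
      have := le_mul_of_one_le_right hn hT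
      linarith
    have n2 : (1 + t ^ 2) ^ ((3:ℝ) / 4) ≤ 2 * (|t| * √|t|) := by
      have : (1 + t ^ 2) ≤ 2 * |t| ^ 2 := by rw [sq_abs]; have : 1 ≤ |t| ^ 2 := by nlinarith
                                             rw [sq_abs] at this; linarith
      calc (1 + t ^ 2) ^ ((3:ℝ) / 4) ≤ (2 * |t| ^ 2) ^ ((3:ℝ) / 4) := Real.rpow_le_rpow hp.le this (by norm_num)
        _ = 2 ^ ((3:ℝ) / 4) * (|t| ^ (2:ℝ)) ^ ((3:ℝ) / 4) := by
          rw [Real.mul_rpow (by norm_num) (by positivity)]; norm_num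
        _ ≤ 2 ^ (1:ℝ) * (|t| * √|t|) := by
          rw [← Real.rpow_mul tp.le, show (2:ℝ) * (3 / 4) = 1 + 1 / 2 by norm_num, Real.rpow_add tp, Real.rpow_one,
            ← Real.sqrt_eq_rpow]
          gcongr <;> norm_num
        _ = _ := by norm_num
    have n3 : (1 + t ^ 2) ^ (-(3:ℝ) / 4) = 1 / (1 + t ^ 2) ^ ((3:ℝ) / 4) := by
      rw [neg_div, Real.rpow_neg hp.le, one_div]
    have hq := Real.rpow_pos_of_pos hp ((3:ℝ) / 4)
    calc _ ≤ ((‖logDeriv Xi 1‖ + K) * √|t|) / (|t| * |t|) := by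
          apply div_le_div₀ (by positivity) n1 (by positivity)
          apply mul_le_mul d1 d2 (by positivity) (by positivity)
      _ ≤ 2 * (‖logDeriv Xi 1‖ + K) * (1 + t ^ 2) ^ (-(3:ℝ) / 4) := by
          rw [n3, mul_one_div, div_le_div_iff₀ (by positivity) hq]
          have s2 := Real.mul_self_sqrt tp.le
          calc (‖logDeriv Xi 1‖ + K) * √|t| * (1 + t ^ 2) ^ ((3:ℝ) / 4) ≤ (‖logDeriv Xi 1‖ + K) * √|t| * (2 * (|t| * √|t|)) := by gcongr
            _ = 2 * (‖logDeriv Xi 1‖ + K) * (|t| * (√|t| * √|t|)) := by ring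
            _ = _ := by rw [s2]
      _ ≤ _ := by nlinarith

end phi
end RHPi

namespace RHPi
section expl
open Complex Set Topology
open scoped ArithmeticFunction.vonMangoldt

lemma FX_one : logDeriv Xi 1 = Real.eulerMascheroniConstant - Real.log Real.pi / 2 + digamma (3 / 2) / 2 := by
  rw [Xi_logDeriv (by norm_num) (by rw [riemannZeta₁_one]; norm_num), logDeriv_apply,
    deriv_riemannZeta₁_one, riemannZeta₁_one, show (1 / 2 + 1 : ℂ) = 3 / 2 by norm_num, div_one]

lemma FX_one' : logDeriv Xi 1 = ((1 + Real.eulerMascheroniConstant / 2 - Real.log 2 - Real.log Real.pi / 2 : ℝ) : ℂ) := by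
  rw [FX_one, digamma_three_half]; push_cast; ring

lemma Phi_line {a : ℝ} (hZ : ∀ s : ℂ, 1 / 2 < s.re → riemannZeta₁ s ≠ 0) (ha : 0 < a) (ha' : a < 1 / 2) (t : ℝ) :
    HasSum (fun n : ℕ => LSeries.term (fun n => (Λ n : ℂ)) (1 / 2 + a + (1 + t * I)) n *
        (1 / (((1 + t * I) + (-(1 / 2 - a) : ℝ)) * ((1 + t * I) + (1 / 2 - a : ℝ)))))
      (Phi a (1 + t * I)
        - Real.eulerMascheroniConstant * (1 / (((1 + t * I) + (-(1 / 2 - a) : ℝ)) * ((1 + t * I) + (1 / 2 - a : ℝ))))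
        + 1 / (2 * (1 / 2 - a : ℝ)) * (1 / (((1 + t * I) + (-(1 / 2 - a) : ℝ)) * ((1 + t * I) + (-(1 / 2 - a) : ℝ)))
          - 1 / (((1 + t * I) + (-(1 / 2 - a) : ℝ)) * ((1 + t * I) + (1 / 2 - a : ℝ))))
        + ∑' k : ℕ, 1 / (2 * (k:ℂ) + 3) * (1 / (((1 + t * I) + (1 / 2 - a : ℝ)) * ((1 + t * I) + (2 * k + 5 / 2 + a : ℝ))))) ∧
    HasSum (fun k : ℕ => 1 / (2 * (k:ℂ) + 3) * (1 / (((1 + t * I) + (1 / 2 - a : ℝ)) * ((1 + t * I) + (2 * k + 5 / 2 + a : ℝ)))))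
     (((digamma ((1 / 2 + a + (1 + t * I)) / 2 + 1) - digamma (3 / 2)) / 2) /
       (((1 + t * I) + (-(1 / 2 - a) : ℝ)) * ((1 + t * I) + (1 / 2 - a : ℝ)))) := by
  have n1 := line_ne (p := -(1 / 2 - a)) (by linarith) t
  have n2 := line_ne (p := (1 / 2 - a)) (by linarith) t
  set s : ℂ := 1 / 2 + a + (1 + t * I) with hs
  have hre : s.re = 3 / 2 + a := by simp [hs]; ring
  have hs1 : s - 1 = (1 + t * I) + (-(1 / 2 - a) : ℝ) := by rw [hs]; push_cast; ring
  have hne : (1 + t * I : ℂ) ≠ (1 / 2 - a : ℝ) := by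
    intro h; apply n1; rw [h]; push_cast; ring
  have hd := (digamma_hasSum (s := s) (by linarith)).div_const
    (((1 + t * I) + (-(1 / 2 - a) : ℝ)) * ((1 + t * I) + (1 / 2 - a : ℝ)))
  have hd' : HasSum (fun k : ℕ => 1 / (2 * (k:ℂ) + 3) * (1 / (((1 + t * I) + (1 / 2 - a : ℝ)) * ((1 + t * I) + (2 * k + 5 / 2 + a : ℝ)))))
     (((digamma (s / 2 + 1) - digamma (3 / 2)) / 2) /
       (((1 + t * I) + (-(1 / 2 - a) : ℝ)) * ((1 + t * I) + (1 / 2 - a : ℝ)))) := by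
    convert! hd using 1
    ext k
    have n3 := line_ne (p := 2 * (k:ℝ) + 5 / 2 + a) (by have : (0:ℝ) ≤ k := k.cast_nonneg
                                                        linarith) t
    have n4 : (2 * (k:ℂ) + 3) ≠ 0 := by exact_mod_cast (by omega : 2 * k + 3 ≠ 0)
    rw [hs1, show 2 * (k:ℂ) + 2 + s = (1 + t * I) + (2 * k + 5 / 2 + a : ℝ) by rw [hs]; push_cast; ring]
    generalize (1 + t * I : ℂ) + (-(1 / 2 - a) : ℝ) = A at *
    generalize (1 + t * I : ℂ) + (1 / 2 - a : ℝ) = B at *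
    generalize (1 + t * I : ℂ) + (2 * (k:ℝ) + 5 / 2 + a : ℝ) = C at *
    generalize 2 * (k:ℂ) + 3 = D at *
    field_simp
  refine ⟨?_, hd'⟩
  rw [hd'.tsum_eq]
  have hL : HasSum (fun n : ℕ => LSeries.term (fun n => (Λ n : ℂ)) s n) (LSeries (fun n => (Λ n : ℂ)) s) :=
    (ArithmeticFunction.LSeriesSummable_vonMangoldt (by rw [hre]; linarith)).hasSum
  convert! hL.mul_right _ using 1
  have hP : Phi a (1 + t * I) = (logDeriv Xi 1 - logDeriv Xi s) /
      (((1 + t * I) + (-(1 / 2 - a) : ℝ)) * ((1 + t * I) + (1 / 2 - a : ℝ))) := by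
    rw [Phi_eq a hne, ← hs]; congr 2; push_cast; ring
  rw [hP, FX_one, Xi_logDeriv (by linarith) (hZ s (by linarith)), logDeriv_zeta1 (by linarith), hs1]
  have hc : (((1 / 2 - a : ℝ)) : ℂ) ≠ 0 := by
    exact_mod_cast (by linarith : (1 / 2 - a) ≠ 0)
  have hBA : (1 + t * I : ℂ) + (1 / 2 - a : ℝ) = (1 + t * I : ℂ) + (-(1 / 2 - a) : ℝ) + 2 * (1 / 2 - a : ℝ) := by push_cast; ring
  generalize (1 + t * I : ℂ) + (1 / 2 - a : ℝ) = B at *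
  generalize (1 + t * I : ℂ) + (-(1 / 2 - a) : ℝ) = A at *
  generalize digamma (s / 2 + 1) = D1
  generalize digamma (3 / 2) = D2
  generalize (Real.log Real.pi : ℂ) = D3
  generalize (Real.eulerMascheroniConstant : ℂ) = D4
  generalize LSeries _ s = D5
  generalize ((1 / 2 - a : ℝ) : ℂ) = c at *
  subst hBA
  field_simp
  ring

noncomputable def hh (a u : ℝ) : ℝ :=
  Real.eulerMascheroniConstant * g1 (-(1 / 2 - a)) (1 / 2 - a) u
  - 1 / (2 * (1 / 2 - a)) * (g2 (-(1 / 2 - a)) u - g1 (-(1 / 2 - a)) (1 / 2 - a) u)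
  + ∑' n : ℕ, Λ n * (n:ℝ) ^ (-(1 / 2 + a)) * g1 (-(1 / 2 - a)) (1 / 2 - a) (u - Real.log n)
  - ∑' k : ℕ, 1 / (2 * (k:ℝ) + 3) * g1 (1 / 2 - a) (2 * k + 5 / 2 + a) u

lemma norm_exp_line (t u : ℝ) : ‖cexp ((1 + t * I) * u)‖ = Real.exp u := by
  rw [norm_exp]; simp

lemma block_exp_integrable {G : ℝ → ℂ} (hG : Integrable G) (u : ℝ) :
    Integrable (fun t : ℝ => G t * cexp ((1 + t * I) * u)) := by
  refine hG.mul_bdd (c := Real.exp u) (by apply Continuous.aestronglyMeasurable; fun_prop)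
    (Eventually.of_forall fun t => ?_)
  rw [norm_exp_line]

lemma vM_int {a : ℝ} (ha : 0 < a) (ha' : a < 1 / 2) (u : ℝ) :
    HasSum (fun n : ℕ => (2 * Real.pi * (Λ n * (n:ℝ) ^ (-(1 / 2 + a)) * g1 (-(1 / 2 - a)) (1 / 2 - a) (u - Real.log n) : ℝ) : ℂ))
      (∫ t : ℝ, ∑' n : ℕ, LSeries.term (fun n => (Λ n : ℂ)) (1 / 2 + a + (1 + t * I)) n *
        (1 / (((1 + t * I) + (-(1 / 2 - a) : ℝ)) * ((1 + t * I) + (1 / 2 - a : ℝ)))) * cexp ((1 + t * I) * u)) := by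
  have hp : -1 < -(1 / 2 - a) := by linarith
  have hq : -1 < (1 / 2 - a) := by linarith
  have hb := block_integrable hp hq
  have e0 : ∀ (n : ℕ) (t : ℝ), LSeries.term (fun n => (Λ n : ℂ)) (1 / 2 + a + (1 + t * I)) n *
        (1 / (((1 + t * I) + (-(1 / 2 - a) : ℝ)) * ((1 + t * I) + (1 / 2 - a : ℝ)))) * cexp ((1 + t * I) * u)
      = (Λ n * (n:ℝ) ^ (-(1 / 2 + a)) : ℝ) * ((1 / (((1 + t * I) + (-(1 / 2 - a) : ℝ)) * ((1 + t * I) + (1 / 2 - a : ℝ))))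
        * cexp ((1 + t * I) * (u - Real.log n : ℝ))) := by
    intro n t
    rcases Nat.eq_zero_or_pos n with rfl | hn
    · simp
    rw [LSeries.term_of_ne_zero hn.ne']
    have hn' : (n:ℂ) ≠ 0 := by exact_mod_cast hn.ne'
    have hnr : (0:ℝ) < n := by exact_mod_cast hn
    have e1 : (n:ℂ) ^ (1 / 2 + a + (1 + t * I) : ℂ) = ((n:ℝ) ^ (1 / 2 + a) : ℝ) * cexp ((1 + t * I) * Real.log n) := by
      rw [cpow_add _ _ hn', ofReal_cpow hnr.le]
      congr 1
      · push_cast; rfl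
      · rw [cpow_def_of_ne_zero hn', natCast_log, mul_comm]
    rw [e1, Real.rpow_neg hnr.le]
    rw [show (1 + t * I) * ((u - Real.log n : ℝ) : ℂ) = (1 + t * I) * u - (1 + t * I) * Real.log n by push_cast; ring, Complex.exp_sub]
    push_cast
    generalize cexp ((1 + t * I) * u) = X
    generalize (1 / (((1 + t * I : ℂ) + -(1 / 2 - a)) * ((1 + t * I) + (1 / 2 - a)))) = Y
    have := Complex.exp_ne_zero ((1 + t * I) * Real.log n)
    have := (Real.rpow_pos_of_pos hnr (1 / 2 + a)).ne'
    field_simp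
  simp_rw [e0]
  have hbi := fun n : ℕ => block_exp_integrable hb (u - Real.log n)
  have key := hasSum_integral_of_summable_integral_norm (μ := volume)
    (F := fun (n : ℕ) (t : ℝ) => ((Λ n * (n:ℝ) ^ (-(1 / 2 + a)) : ℝ) : ℂ) * ((1 / (((1 + t * I) + (-(1 / 2 - a) : ℝ)) * ((1 + t * I) + (1 / 2 - a : ℝ))))
        * cexp ((1 + t * I) * (u - Real.log n : ℝ)))) (fun n => (hbi n).const_mul _) ?_
  · convert! key using 1
    ext n
    rw [integral_const_mul, block1 hp hq (by linarith : -(1 / 2 - a) < 1 / 2 - a).ne]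
    push_cast; ring
  · have hs : Summable (fun n : ℕ => ‖LSeries.term (fun n => (Λ n : ℂ)) ((3 / 2 + a : ℝ) : ℂ) n‖) :=
      (ArithmeticFunction.LSeriesSummable_vonMangoldt (s := ((3 / 2 + a : ℝ) : ℂ)) (by rw [ofReal_re]; linarith)).norm
    refine (hs.mul_right (Real.exp u * ∫ t : ℝ, ‖(1 / (((1 + t * I : ℂ) + (-(1 / 2 - a) : ℝ)) * ((1 + t * I) + (1 / 2 - a : ℝ))))‖)).congr fun n => ?_
    simp_rw [norm_mul, norm_exp_line]
    rw [integral_const_mul, integral_mul_const]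
    rcases Nat.eq_zero_or_pos n with rfl | hn
    · simp
    have hnr : (0:ℝ) < n := by exact_mod_cast hn
    rw [LSeries.norm_term_eq, if_neg hn.ne', ofReal_re, norm_real, norm_real, Real.norm_eq_abs, Real.norm_eq_abs,
      abs_of_nonneg ArithmeticFunction.vonMangoldt_nonneg, abs_of_nonneg (by have := ArithmeticFunction.vonMangoldt_nonneg (n := n); positivity),
      Real.exp_sub, Real.exp_log hnr, show 3 / 2 + a = 1 / 2 + a + 1 by ring, Real.rpow_add hnr, Real.rpow_one, Real.rpow_neg hnr.le]
    generalize (∫ t : ℝ, ‖(1 / (((1 + t * I : ℂ) + (-(1 / 2 - a) : ℝ)) * ((1 + t * I) + (1 / 2 - a : ℝ))))‖) = X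
    field_simp

lemma dg_int {a : ℝ} (ha : 0 < a) (ha' : a < 1 / 2) (u : ℝ) :
    HasSum (fun k : ℕ => (2 * Real.pi * (1 / (2 * (k:ℝ) + 3) * g1 (1 / 2 - a) (2 * k + 5 / 2 + a) u : ℝ) : ℂ))
      (∫ t : ℝ, ∑' k : ℕ, 1 / (2 * (k:ℂ) + 3) * (1 / (((1 + t * I) + (1 / 2 - a : ℝ)) * ((1 + t * I) + (2 * k + 5 / 2 + a : ℝ)))) * cexp ((1 + t * I) * u)) := by
  have hp : -1 < (1 / 2 - a) := by linarith
  have hq : ∀ k : ℕ, -1 < (2 * (k:ℝ) + 5 / 2 + a) := fun k => by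
    have : (0:ℝ) ≤ k := k.cast_nonneg
    linarith
  have hb := fun k : ℕ => block_integrable hp (hq k)
  have hbi := fun k : ℕ => block_exp_integrable (hb k) u
  have hbi' : ∀ k : ℕ, Integrable (fun t : ℝ => 1 / (2 * (k:ℂ) + 3) * (1 / (((1 + t * I) + (1 / 2 - a : ℝ)) * ((1 + t * I) + (2 * k + 5 / 2 + a : ℝ)))) * cexp ((1 + t * I) * u)) := by
    intro k
    simp_rw [mul_assoc]
    exact (hbi k).const_mul _
  have key := hasSum_integral_of_summable_integral_norm (μ := volume) hbi' ?_
  · convert! key using 1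
    ext k
    simp_rw [mul_assoc]
    rw [integral_const_mul, block1 hp (hq k) (by have : (0:ℝ) ≤ k := k.cast_nonneg
                                                 linarith : (1 / 2 - a) < 2 * k + 5 / 2 + a).ne]
    push_cast; ring
  · have hsum : Summable (fun k : ℕ => 1 / (((k:ℝ) + 1) * √(k + 1))) := by
      have := (summable_nat_add_iff 1).mpr (Real.summable_one_div_nat_rpow (p := 3 / 2) |>.mpr (by norm_num))
      refine this.congr fun k => ?_
      have hk : (0:ℝ) < k + 1 := by positivity
      push_cast
      rw [show (3 / 2 : ℝ) = 1 + 1 / 2 by norm_num, Real.rpow_add hk, Real.rpow_one, ← Real.sqrt_eq_rpow]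
    have hd : 0 < 1 + (1 / 2 - a) := by linarith
    have hintg := integrable_rpow_neg_one_add_norm_sq (E := ℝ) (μ := volume) (r := 3 / 2) (by simp; norm_num)
    refine Summable.of_nonneg_of_le (fun k => integral_nonneg fun t => norm_nonneg _) (fun k => ?_)
      (hsum.mul_left (∫ t : ℝ, (1 + ‖t‖ ^ 2) ^ (-(3/2:ℝ) / 2) * Real.exp u))
    rw [← integral_mul_const]
    apply integral_mono ((hbi' k).norm) ((hintg.mul_const _).mul_const _)
    intro t
    simp only
    rw [norm_mul, norm_mul, norm_exp_line]
    have e3 : ‖1 / (2 * (k:ℂ) + 3)‖ = 1 / (2 * (k:ℝ) + 3) := by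
      rw [show (1 / (2 * (k:ℂ) + 3)) = ((1 / (2 * (k:ℝ) + 3) : ℝ) : ℂ) by push_cast; ring, norm_real, Real.norm_eq_abs, abs_of_pos (by positivity)]
    have hk : (0:ℝ) ≤ k := k.cast_nonneg
    have hD : (0:ℝ) < 1 + t ^ 2 := by positivity
    have q1 : √(1 + t ^ 2) ≤ ‖(1 + t * I : ℂ) + (1 / 2 - a : ℝ)‖ := by
      rw [Real.sqrt_le_left (norm_nonneg _), normSq_line]; nlinarith
    have q2 : √(k + 1) * √(√(1 + t ^ 2)) ≤ ‖(1 + t * I : ℂ) + (2 * k + 5 / 2 + a : ℝ)‖ := by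
      rw [← Real.sqrt_mul (by positivity), Real.sqrt_le_left (norm_nonneg _), normSq_line]
      have := Real.sq_sqrt hD.le
      have h0 := Real.sqrt_nonneg (1 + t ^ 2)
      nlinarith [sq_nonneg ((k:ℝ) + 1 - √(1 + t ^ 2)), mul_nonneg hk ha.le]
    have hpw : (1 + ‖t‖ ^ 2) ^ (-(3/2:ℝ) / 2) = 1 / (√(1 + t ^ 2) * √(√(1 + t ^ 2))) := by
      rw [Real.norm_eq_abs, sq_abs, Real.sqrt_eq_rpow, Real.sqrt_eq_rpow, ← Real.rpow_mul hD.le, ← Real.rpow_add hD, one_div,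
        ← Real.rpow_neg hD.le]
      norm_num
    rw [e3, hpw, norm_div, norm_one, norm_mul]
    have s1 : 0 < √(1 + t ^ 2) := Real.sqrt_pos.mpr hD
    have s2 : 0 < √(√(1 + t ^ 2)) := Real.sqrt_pos.mpr s1
    have s3 : 0 < √((k:ℝ) + 1) := Real.sqrt_pos.mpr (by positivity)
    have i1 : 1 / (2 * (k:ℝ) + 3) ≤ 1 / (k + 1) := by
      apply one_div_le_one_div_of_le (by positivity); linarith
    have i2 : 1 / (‖(1 + t * I : ℂ) + (1 / 2 - a : ℝ)‖ * ‖(1 + t * I : ℂ) + (2 * k + 5 / 2 + a : ℝ)‖) ≤ 1 / (√(1 + t ^ 2) * (√(k + 1) * √(√(1 + t ^ 2)))) := by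
      apply one_div_le_one_div_of_le (by positivity)
      apply mul_le_mul q1 q2 (by positivity) (norm_nonneg _)
    calc _ ≤ 1 / ((k:ℝ) + 1) * (1 / (√(1 + t ^ 2) * (√(k + 1) * √(√(1 + t ^ 2))))) * Real.exp u := by
          gcongr
      _ = _ := by field_simp

lemma LS_line {a : ℝ} (ha : 0 < a) : Continuous (fun t : ℝ => LSeries (fun n => (Λ n : ℂ)) (1 / 2 + a + (1 + t * I))) ∧
    ∃ M, ∀ t : ℝ, ‖LSeries (fun n => (Λ n : ℂ)) (1 / 2 + a + (1 + t * I))‖ ≤ M := by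
  have hs : Summable (fun n : ℕ => ‖LSeries.term (fun n => (Λ n : ℂ)) ((3 / 2 + a : ℝ) : ℂ) n‖) :=
      (ArithmeticFunction.LSeriesSummable_vonMangoldt (s := ((3 / 2 + a : ℝ) : ℂ)) (by rw [ofReal_re]; linarith)).norm
  have hb : ∀ (n : ℕ) (t : ℝ), ‖LSeries.term (fun n => (Λ n : ℂ)) (1 / 2 + a + (1 + t * I)) n‖ ≤ ‖LSeries.term (fun n => (Λ n : ℂ)) ((3 / 2 + a : ℝ) : ℂ) n‖ := by
    intro n t
    rw [LSeries.norm_term_eq, LSeries.norm_term_eq]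
    have : (1 / 2 + a + (1 + t * I) : ℂ).re = 3 / 2 + a := by simp; ring
    rw [this, ofReal_re]
  constructor
  · unfold LSeries
    refine continuous_tsum (fun n => ?_) hs hb
    rcases Nat.eq_zero_or_pos n with rfl | hn
    · simp; exact continuous_const
    simp_rw [LSeries.term_of_ne_zero hn.ne']
    have hn' : (n:ℂ) ≠ 0 := by exact_mod_cast hn.ne'
    refine continuous_const.div ?_ (fun t => by rw [Ne, cpow_eq_zero_iff]; tauto)
    exact Continuous.const_cpow (by fun_prop) (Or.inl hn')
  · exact ⟨_, fun t => tsum_of_norm_bounded hs.hasSum fun n => hb n t⟩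

lemma hh_eq {a : ℝ} (hZ : ∀ s : ℂ, 1 / 2 < s.re → riemannZeta₁ s ≠ 0) (ha : 0 < a) (ha' : a < 1 / 2) (u : ℝ) :
    ∫ t : ℝ, Phi a (1 + t * I) * cexp ((1 + t * I) * u) = 2 * Real.pi * hh a u := by
  obtain ⟨C, hC⟩ := Phi_growth hZ ha ha'
  have hi := (line_shift (fun w hw => Phi_diff hZ ha ha' hw) hC u).1 1 (by simp)
  simp only [ofReal_one] at hi
  have hp : -1 < -(1 / 2 - a) := by linarith
  have hq : -1 < (1 / 2 - a) := by linarith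
  have hA := vM_int ha ha' u
  have hB := dg_int ha ha' u
  set X : ℝ → ℂ := fun t => 1 / (((1 + t * I) + (-(1 / 2 - a) : ℝ)) * ((1 + t * I) + (1 / 2 - a : ℝ))) * cexp ((1 + t * I) * u) with hX
  set Y : ℝ → ℂ := fun t => 1 / (((1 + t * I) + (-(1 / 2 - a) : ℝ)) * ((1 + t * I) + (-(1 / 2 - a) : ℝ))) * cexp ((1 + t * I) * u) with hY
  set S : ℝ → ℂ := fun t => ∑' n : ℕ, LSeries.term (fun n => (Λ n : ℂ)) (1 / 2 + a + (1 + t * I)) n *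
        (1 / (((1 + t * I) + (-(1 / 2 - a) : ℝ)) * ((1 + t * I) + (1 / 2 - a : ℝ)))) * cexp ((1 + t * I) * u) with hS
  set D : ℝ → ℂ := fun t => ∑' k : ℕ, 1 / (2 * (k:ℂ) + 3) * (1 / (((1 + t * I) + (1 / 2 - a : ℝ)) * ((1 + t * I) + (2 * k + 5 / 2 + a : ℝ)))) * cexp ((1 + t * I) * u) with hD
  have iX : Integrable X := block_exp_integrable (block_integrable hp hq) u
  have iY : Integrable Y := block_exp_integrable (block_integrable hp hp) u
  have vX : ∫ t, X t = 2 * Real.pi * g1 (-(1 / 2 - a)) (1 / 2 - a) u :=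
    block1 hp hq (by linarith : -(1 / 2 - a) < 1 / 2 - a).ne u
  have vY : ∫ t, Y t = 2 * Real.pi * g2 (-(1 / 2 - a)) u := block2 hp u
  have hpt : ∀ t : ℝ, S t = Phi a (1 + t * I) * cexp ((1 + t * I) * u) - Real.eulerMascheroniConstant * X t
      + 1 / (2 * (1 / 2 - a : ℝ)) * (Y t - X t) + D t := by
    intro t
    obtain ⟨h1, h2⟩ := Phi_line hZ ha ha' t
    have h1' := (h1.mul_right (cexp ((1 + t * I) * u))).tsum_eq
    have h2' := (h2.mul_right (cexp ((1 + t * I) * u))).tsum_eq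
    simp only [hS, hD, hX, hY]
    rw [h1', h2', h2.tsum_eq]
    ring
  have iSD : Integrable (fun t => S t - D t) := by
    have : Integrable (fun t : ℝ => Phi a (1 + t * I) * cexp ((1 + t * I) * u) - Real.eulerMascheroniConstant * X t
      + 1 / (2 * (1 / 2 - a : ℝ)) * (Y t - X t)) := (hi.sub (iX.const_mul _)).add ((iY.sub iX).const_mul _)
    refine this.congr (Eventually.of_forall fun t => ?_)
    simp only [hpt]; ring
  have iS : Integrable S := by
    obtain ⟨hc, M, hM⟩ := LS_line ha
    have : Integrable (fun t : ℝ => LSeries (fun n => (Λ n : ℂ)) (1 / 2 + a + (1 + t * I)) * X t) :=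
      iX.bdd_mul (c := M) hc.aestronglyMeasurable (Eventually.of_forall hM)
    refine this.congr (Eventually.of_forall fun t => ?_)
    simp only [hS, hX]
    rw [tsum_mul_right, tsum_mul_right, mul_assoc]; rfl
  have iD : Integrable D := by
    refine (iS.sub iSD).congr (Eventually.of_forall fun t => ?_)
    simp
  have hA' := hA.tsum_eq
  have hB' := hB.tsum_eq
  have fin : ∫ t : ℝ, Phi a (1 + t * I) * cexp ((1 + t * I) * u) =
      ∫ t : ℝ, ((S t + Real.eulerMascheroniConstant * X t) - 1 / (2 * (1 / 2 - a : ℝ)) * (Y t - X t) - D t) := by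
    congr 1; ext t; rw [hpt]; ring
  have i1 : Integrable (fun t => (Real.eulerMascheroniConstant : ℂ) * X t) := iX.const_mul _
  have i2 : Integrable (fun t => (1 / (2 * (1 / 2 - a : ℝ)) : ℂ) * (Y t - X t)) := (iY.sub iX).const_mul _
  have i3 : Integrable (fun t => S t + (Real.eulerMascheroniConstant : ℂ) * X t) := iS.add i1
  have i4 : Integrable (fun t => S t + (Real.eulerMascheroniConstant : ℂ) * X t - (1 / (2 * (1 / 2 - a : ℝ)) : ℂ) * (Y t - X t)) := i3.sub i2
  rw [fin, integral_sub i4 iD, integral_sub i3 i2, integral_add iS i1, integral_const_mul, integral_const_mul,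
    integral_sub iY iX, vX, vY, ← hA', ← hB', tsum_mul_left, tsum_mul_left, ← ofReal_tsum, ← ofReal_tsum]
  unfold hh
  push_cast
  ring

lemma g1_nonpos (p q : ℝ) {u : ℝ} (hu : u ≤ 0) : g1 p q u = 0 := by
  unfold g1; rw [max_eq_right hu]; simp

lemma hh_nonpos (a : ℝ) {u : ℝ} (hu : u ≤ 0) : hh a u = 0 := by
  unfold hh
  have h1 : ∀ n : ℕ, Λ n * (n:ℝ) ^ (-(1 / 2 + a)) * g1 (-(1 / 2 - a)) (1 / 2 - a) (u - Real.log n) = 0 := by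
    intro n
    rw [g1_nonpos _ _ (by linarith [Real.log_natCast_nonneg n]), mul_zero]
  simp_rw [h1]
  simp [g1_nonpos _ _ hu, g2, max_eq_right hu]

lemma Phi_re {a : ℝ} (hZ : ∀ s : ℂ, 1 / 2 < s.re → riemannZeta₁ s ≠ 0) (ha : 0 < a) (ha' : a < 1 / 2) (t : ℝ) :
    |(Phi a (t * I)).re| ≤ (Phi a (t * I)).re + 2 * (logDeriv Xi 1).re * (1 / ((1 / 2 - a) ^ 2 + t ^ 2)) := by
  have hne : (t * I : ℂ) ≠ (1 / 2 - a : ℝ) := by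
    intro h
    have := congrArg Complex.re h
    simp only [mul_re, ofReal_re, I_re, mul_zero, ofReal_im, I_im, mul_one, sub_self] at this
    linarith
  have hR := Xi_logDeriv_re hZ (s := 1 / 2 + a + t * I) (by simp; linarith)
  have h1 := Xi_logDeriv_re hZ (s := 1) (by norm_num)
  rw [Phi_eq a hne]
  have hden : ((t * I - (1 / 2 - a : ℝ)) * (t * I + (1 / 2 - a : ℝ)) : ℂ) = ((-((1 / 2 - a) ^ 2 + t ^ 2) : ℝ) : ℂ) := by
    push_cast; linear_combination (t:ℂ) ^ 2 * I_sq
  have hd : 0 < (1 / 2 - a) ^ 2 + t ^ 2 := by nlinarith [sq_nonneg t]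
  rw [hden, div_ofReal_re, sub_re]
  generalize (logDeriv Xi 1).re = A at *
  generalize (logDeriv Xi (1 / 2 + a + t * I)).re = B at *
  generalize (1 / 2 - a) ^ 2 + t ^ 2 = d at *
  rw [show (A - B) / -d = (B - A) / d by rw [div_neg, ← neg_div, neg_sub], abs_div, abs_of_pos hd,
    mul_one_div, ← add_div]
  gcongr
  rw [abs_le]; constructor <;> linarith

theorem hh_bound {a : ℝ} (hZ : ∀ s : ℂ, 1 / 2 < s.re → riemannZeta₁ s ≠ 0) (ha : 0 < a) (ha' : a < 1 / 2) (u : ℝ) (hu : 0 ≤ u) :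
    |hh a u| ≤ 2 * (logDeriv Xi 1).re / (1 / 2 - a) := by
  obtain ⟨C, hC⟩ := Phi_growth hZ ha ha'
  have hI : ∀ v : ℝ, Integrable (fun t : ℝ => Phi a (t * I) * cexp (t * I * v)) ∧
      ∫ t : ℝ, Phi a (t * I) * cexp (t * I * v) = 2 * Real.pi * hh a v := by
    intro v
    have h := line_shift (fun w hw => Phi_diff hZ ha ha' hw) hC v
    have h0 := h.1 0 (by simp)
    simp only [ofReal_zero, zero_add] at h0
    exact ⟨h0, h.2.trans (hh_eq hZ ha ha' v)⟩
  have hc : 0 < 1 / 2 - a := by linarith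
  have z0 := hI 0
  simp only [ofReal_zero, mul_zero, Complex.exp_zero, mul_one, hh_nonpos a le_rfl] at z0
  have z0re : ∫ t : ℝ, (Phi a (t * I)).re = 0 := by
    have := integral_re (𝕜 := ℂ) z0.1
    simp only [RCLike.re_to_complex] at this
    rw [this, z0.2]; simp
  have ire : Integrable (fun t : ℝ => (Phi a (t * I)).re) := z0.1.re
  have hsum : (2 * Real.pi * hh a u : ℂ) = ∫ t : ℝ, Phi a (t * I) * ((2 * Real.cos (t * u) : ℝ) : ℂ) := by
    have h1 := hI u
    have h2 := hI (-u)
    rw [hh_nonpos a (by linarith : -u ≤ 0)] at h2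
    have := integral_add h1.1 h2.1
    rw [h1.2, h2.2] at this
    simp only [ofReal_zero, mul_zero, add_zero] at this
    rw [← this]
    congr 1; ext t
    push_cast
    rw [Complex.cos, ← mul_add]
    congr 1
    rw [mul_div_cancel₀ _ (by norm_num : (2:ℂ) ≠ 0)]
    congr 2 <;> ring
  have hre : 2 * Real.pi * hh a u = ∫ t : ℝ, (Phi a (t * I)).re * (2 * Real.cos (t * u)) := by
    have hintg : Integrable (fun t : ℝ => Phi a (t * I) * ((2 * Real.cos (t * u) : ℝ) : ℂ)) := by
      refine z0.1.mul_bdd (c := 2) (by apply Continuous.aestronglyMeasurable; fun_prop) (Eventually.of_forall fun t => ?_)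
      rw [norm_real, Real.norm_eq_abs, abs_mul, abs_two]
      linarith [Real.abs_cos_le_one (t * u)]
    have := integral_re (𝕜 := ℂ) hintg
    simp only [RCLike.re_to_complex] at this
    rw [← hsum] at this
    have e : (2 * Real.pi * hh a u : ℂ) = ((2 * Real.pi * hh a u : ℝ) : ℂ) := by push_cast; ring
    rw [e, ofReal_re] at this
    rw [← this]
    congr 1; ext t
    rw [re_mul_ofReal]
  have hbd : |2 * Real.pi * hh a u| ≤ 2 * (2 * (logDeriv Xi 1).re * (Real.pi / (1 / 2 - a))) := by
    rw [hre]
    calc |∫ t : ℝ, (Phi a (t * I)).re * (2 * Real.cos (t * u))| ≤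
        ∫ t : ℝ, 2 * ((Phi a (t * I)).re + 2 * (logDeriv Xi 1).re * (1 / ((1 / 2 - a) ^ 2 + t ^ 2))) := by
          rw [← Real.norm_eq_abs]
          apply norm_integral_le_of_norm_le
          · exact (ire.add ((integrable_inv_sq_add hc).const_mul _)).const_mul 2
          · refine Eventually.of_forall fun t => ?_
            rw [Real.norm_eq_abs, abs_mul, abs_mul, abs_two]
            have h1 := Phi_re hZ ha ha' t
            have h2 := Real.abs_cos_le_one (t * u)
            have h3 := abs_nonneg (Phi a (t * I)).re
            have h4 := abs_nonneg (Real.cos (t * u))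
            nlinarith
      _ = _ := by
          rw [integral_const_mul, integral_add ire ((integrable_inv_sq_add hc).const_mul _), z0re,
            integral_const_mul, integral_inv_sq_add hc, zero_add]
  rw [abs_mul, abs_of_pos (by positivity : 0 < 2 * Real.pi)] at hbd
  have hpi := Real.pi_pos
  have : 2 * Real.pi * |hh a u| ≤ 2 * Real.pi * (2 * (logDeriv Xi 1).re / (1 / 2 - a)) := by
    refine hbd.trans (le_of_eq ?_)
    field_simp
  exact le_of_mul_le_mul_left this (by positivity)

end expl
end RHPi

namespace RHPi
section lim
open Set Topology
open scoped ArithmeticFunction.vonMangoldt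

noncomputable def MM (a u : ℝ) : ℝ :=
  Real.eulerMascheroniConstant * g1 (-(1 / 2 - a)) (1 / 2 - a) u
  - 1 / (2 * (1 / 2 - a)) * (g2 (-(1 / 2 - a)) u - g1 (-(1 / 2 - a)) (1 / 2 - a) u)
  + ∑ n ∈ Finset.Icc 1 ⌊Real.exp u⌋₊, Λ n * (n:ℝ) ^ (-(1 / 2 + a)) * g1 (-(1 / 2 - a)) (1 / 2 - a) (u - Real.log n)

lemma hh_MM (a u : ℝ) : hh a u = MM a u - ∑' k : ℕ, 1 / (2 * (k:ℝ) + 3) * g1 (1 / 2 - a) (2 * k + 5 / 2 + a) u := by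
  unfold hh MM
  rw [tsum_eq_sum (s := Finset.Icc 1 ⌊Real.exp u⌋₊)]
  intro n hn
  rcases Nat.eq_zero_or_pos n with rfl | hpos
  · simp
  rw [g1_nonpos _ _, mul_zero]
  simp only [Finset.mem_Icc, not_and, not_le] at hn
  have h1 := hn hpos
  rw [Nat.floor_lt (Real.exp_pos u).le] at h1
  have := (Real.lt_log_iff_exp_lt (by exact_mod_cast hpos)).mpr h1
  linarith

lemma G_bound {a u : ℝ} (ha : 0 < a) (ha' : a < 1 / 2) (hu : 0 ≤ u) :
    0 ≤ (∑' k : ℕ, 1 / (2 * (k:ℝ) + 3) * g1 (1 / 2 - a) (2 * k + 5 / 2 + a) u) ∧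
    (∑' k : ℕ, 1 / (2 * (k:ℝ) + 3) * g1 (1 / 2 - a) (2 * k + 5 / 2 + a) u) ≤ Real.exp (-(1 / 2 - a) * u) / 2 := by
  have h0 : ∀ k : ℕ, 0 ≤ 1 / (2 * (k:ℝ) + 3) * g1 (1 / 2 - a) (2 * k + 5 / 2 + a) u := by
    intro k
    have hk : (0:ℝ) ≤ k := k.cast_nonneg
    apply mul_nonneg (by positivity)
    unfold g1
    apply div_nonneg _ (by linarith)
    rw [sub_nonneg]
    apply Real.exp_le_exp.mpr
    have : 0 ≤ max u 0 := le_max_right _ _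
    nlinarith
  refine ⟨tsum_nonneg h0, ?_⟩
  set E := Real.exp (-(1 / 2 - a) * u) with hE
  have hE0 : 0 < E := Real.exp_pos _
  have hterm : ∀ k : ℕ, 1 / (2 * (k:ℝ) + 3) * g1 (1 / 2 - a) (2 * k + 5 / 2 + a) u ≤
      E / 2 * (1 / (2 * (k:ℝ) + 1) - 1 / (2 * ((k + 1 : ℕ):ℝ) + 1)) := by
    intro k
    have hk : (0:ℝ) ≤ k := k.cast_nonneg
    have : g1 (1 / 2 - a) (2 * k + 5 / 2 + a) u ≤ E / (2 * k + 1) := by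
      unfold g1
      rw [max_eq_left hu, ← hE]
      apply div_le_div₀ hE0.le _ (by positivity) (by linarith)
      have := Real.exp_pos (-(2 * (k:ℝ) + 5 / 2 + a) * u)
      linarith
    calc _ ≤ 1 / (2 * (k:ℝ) + 3) * (E / (2 * k + 1)) := by gcongr
      _ = _ := by
        push_cast
        rw [show 2 * ((k:ℝ) + 1) + 1 = 2 * k + 3 by ring]
        field_simp
        ring
  apply Real.tsum_le_of_sum_range_le h0
  intro n
  have : ∑ k ∈ Finset.range n, (1 / (2 * (k:ℝ) + 3) * g1 (1 / 2 - a) (2 * k + 5 / 2 + a) u) ≤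
      ∑ k ∈ Finset.range n, E / 2 * (1 / (2 * (k:ℝ) + 1) - 1 / (2 * ((k + 1 : ℕ):ℝ) + 1)) :=
    Finset.sum_le_sum fun k _ => hterm k
  rw [← Finset.mul_sum, Finset.sum_range_sub' (fun k : ℕ => 1 / (2 * (k:ℝ) + 1))] at this
  have hn : 0 ≤ 1 / (2 * (n:ℝ) + 1) := by positivity
  refine this.trans ?_
  rw [Nat.cast_zero, mul_zero, zero_add, div_one]
  nlinarith

lemma MM_cont (u : ℝ) : ContinuousAt (fun a => MM a u) 0 := by
  have hg : ∀ v : ℝ, ContinuousAt (fun a : ℝ => g1 (-(1 / 2 - a)) (1 / 2 - a) v) 0 := by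
    intro v
    unfold g1
    apply ContinuousAt.div (by fun_prop) (by fun_prop)
    norm_num
  unfold MM
  refine ContinuousAt.add (ContinuousAt.sub (continuousAt_const.mul (hg u)) (ContinuousAt.mul ?_ (ContinuousAt.sub ?_ (hg u)))) ?_
  · apply ContinuousAt.div (by fun_prop) (by fun_prop); norm_num
  · unfold g2; fun_prop
  · apply tendsto_finsetSum
    intro n hn
    have hn0 : (n:ℝ) ≠ 0 := by
      have := (Finset.mem_Icc.mp hn).1
      positivity
    refine ContinuousAt.mul (continuousAt_const.mul ?_) (hg _)
    exact ContinuousAt.rpow continuousAt_const (by fun_prop) (Or.inl hn0)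

noncomputable def Ssum (x : ℝ) : ℝ := ∑ n ∈ Finset.Icc 1 ⌊x⌋₊, Λ n * (1 / n - 1 / x)

lemma MM_zero {x : ℝ} (hx : 1 ≤ x) : MM 0 (Real.log x) =
    √x * (Ssum x - Real.log x + (1 + Real.eulerMascheroniConstant) * (1 - 1 / x)) := by
  have hx0 : 0 < x := by linarith
  have hs0 : 0 < √x := Real.sqrt_pos.mpr hx0
  have hss : √x * √x = x := Real.mul_self_sqrt hx0.le
  have hexp : ∀ y : ℝ, 0 < y → Real.exp (1 / 2 * Real.log y) = √y := by
    intro y hy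
    rw [Real.sqrt_eq_rpow, Real.rpow_def_of_pos hy, mul_comm]
  have hg : ∀ y : ℝ, 1 ≤ y → g1 (-(1 / 2 - 0)) (1 / 2 - 0) (Real.log y) = √y - 1 / √y := by
    intro y hy
    have hy0 : 0 < y := by linarith
    unfold g1
    rw [max_eq_left (Real.log_nonneg hy)]
    have : Real.exp (-(1 / 2 - 0) * Real.log y) = 1 / √y := by
      rw [sub_zero, neg_mul, Real.exp_neg, hexp y hy0, one_div]
    rw [this, neg_neg, sub_zero, hexp y hy0]
    norm_num
  have hg2 : g2 (-(1 / 2 - 0)) (Real.log x) = Real.log x * √x := by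
    unfold g2
    rw [max_eq_left (Real.log_nonneg hx), neg_neg, sub_zero, hexp x hx0]
  unfold MM Ssum
  rw [hg x hx, hg2, Real.exp_log hx0]
  have hsum : ∑ n ∈ Finset.Icc 1 ⌊x⌋₊, Λ n * (n:ℝ) ^ (-(1 / 2 + (0:ℝ))) * g1 (-(1 / 2 - 0)) (1 / 2 - 0) (Real.log x - Real.log n)
      = √x * ∑ n ∈ Finset.Icc 1 ⌊x⌋₊, Λ n * (1 / n - 1 / x) := by
    rw [Finset.mul_sum]
    apply Finset.sum_congr rfl
    intro n hn
    obtain ⟨h1, h2⟩ := Finset.mem_Icc.mp hn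
    have hn0 : (0:ℝ) < n := by exact_mod_cast h1
    have hnx : (n:ℝ) ≤ x := (Nat.le_floor_iff hx0.le).mp h2
    rw [← Real.log_div hx0.ne' hn0.ne', hg _ (by rw [le_div_iff₀ hn0]; linarith), add_zero, Real.rpow_neg hn0.le, ← Real.sqrt_eq_rpow,
      Real.sqrt_div hx0.le]
    have hsn : 0 < √(n:ℝ) := Real.sqrt_pos.mpr hn0
    have hssn : √(n:ℝ) * √(n:ℝ) = n := Real.mul_self_sqrt hn0.le
    have e1 : 1 / (n:ℝ) = 1 / (√(n:ℝ) * √(n:ℝ)) := by rw [hssn]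
    have e2 : 1 / x = 1 / (√x * √x) := by rw [hss]
    rw [e1, e2]
    field_simp
  rw [hsum]
  have e2 : 1 / x = 1 / (√x * √x) := by rw [hss]
  generalize ∑ n ∈ Finset.Icc 1 ⌊x⌋₊, Λ n * (1 / n - 1 / x) = S
  rw [e2]
  field_simp
  ring

theorem S_bound (hZ : ∀ s : ℂ, 1 / 2 < s.re → riemannZeta₁ s ≠ 0) {x : ℝ} (hx : 1 ≤ x) :
    -(4 * (logDeriv Xi 1).re) ≤ √x * (Ssum x - Real.log x + (1 + Real.eulerMascheroniConstant) * (1 - 1 / x)) ∧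
    √x * (Ssum x - Real.log x + (1 + Real.eulerMascheroniConstant) * (1 - 1 / x)) ≤ 4 * (logDeriv Xi 1).re + 1 / (2 * √x) := by
  rw [← MM_zero hx]
  have hx0 : 0 < x := by linarith
  have hu := Real.log_nonneg hx
  have hev : ∀ᶠ a : ℝ in 𝓝[>] 0, 0 < a ∧ a < 1 / 2 := by
    have := Ioo_mem_nhdsGT (show (0:ℝ) < 1 / 2 by norm_num)
    filter_upwards [this] with a ha using ha
  have hM : Tendsto (fun a => MM a (Real.log x)) (𝓝[>] 0) (𝓝 (MM 0 (Real.log x))) :=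
    (MM_cont _).tendsto.mono_left nhdsWithin_le_nhds
  have hB : Tendsto (fun a : ℝ => 2 * (logDeriv Xi 1).re / (1 / 2 - a)) (𝓝[>] 0) (𝓝 (4 * (logDeriv Xi 1).re)) := by
    have : ContinuousAt (fun a : ℝ => 2 * (logDeriv Xi 1).re / (1 / 2 - a)) 0 := by
      apply ContinuousAt.div (by fun_prop) (by fun_prop); norm_num
    have h := this.tendsto.mono_left (nhdsWithin_le_nhds (s := Ioi (0:ℝ)))
    convert! h using 2
    ring
  have hE : Tendsto (fun a : ℝ => Real.exp (-(1 / 2 - a) * Real.log x) / 2) (𝓝[>] 0) (𝓝 (1 / (2 * √x))) := by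
    have : ContinuousAt (fun a : ℝ => Real.exp (-(1 / 2 - a) * Real.log x) / 2) 0 := by fun_prop
    have h := this.tendsto.mono_left (nhdsWithin_le_nhds (s := Ioi (0:ℝ)))
    convert! h using 2
    rw [sub_zero, neg_mul, Real.exp_neg, Real.sqrt_eq_rpow, Real.rpow_def_of_pos hx0, mul_comm (Real.log x)]
    field_simp
  have key : ∀ a : ℝ, 0 < a ∧ a < 1 / 2 → -(2 * (logDeriv Xi 1).re / (1 / 2 - a)) ≤ MM a (Real.log x) ∧
      MM a (Real.log x) ≤ 2 * (logDeriv Xi 1).re / (1 / 2 - a) + Real.exp (-(1 / 2 - a) * Real.log x) / 2 := by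
    rintro a ⟨ha, ha'⟩
    have h1 := abs_le.mp (hh_bound hZ ha ha' _ hu)
    have h2 := G_bound ha ha' hu
    rw [hh_MM] at h1
    constructor <;> linarith [h1.1, h1.2, h2.1, h2.2]
  constructor
  · exact le_of_tendsto_of_tendsto hB.neg hM (hev.mono fun a ha => (key a ha).1)
  · exact le_of_tendsto_of_tendsto hM (hB.add hE) (hev.mono fun a ha => (key a ha).2)

end lim
end RHPi

namespace RHPi
section ibp
open Set Topology

theorem floor_rc (h : ℕ → ℝ) {f : ℝ → ℝ} (hf : ∀ x, f x = h ⌊x⌋₊) {x : ℝ} (hx : 0 ≤ x) :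
    ContinuousWithinAt f (Ici x) x := by
  have : f =ᶠ[𝓝[≥] x] fun _ => f x := by
    have h1 : Ico x (⌊x⌋₊ + 1) ∈ 𝓝[≥] x := Ico_mem_nhdsGE (Nat.lt_floor_add_one x)
    filter_upwards [h1] with y hy
    rw [hf, hf]
    congr 1
    rw [Nat.floor_eq_iff (hx.trans hy.1)]
    exact ⟨(Nat.floor_le hx).trans hy.1, hy.2⟩
  exact (continuousWithinAt_const (b := f x)).congr_of_eventuallyEq this rfl

theorem ibp {f g g' : ℝ → ℝ} {a b : ℝ} (hab : a ≤ b) (hf : IntervalIntegrable f volume a b)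
    (hrc : ∀ x ∈ Ioo a b, ContinuousWithinAt f (Ici x) x)
    (hg : ∀ x ∈ Icc a b, HasDerivAt g (g' x) x) (hg' : ContinuousOn g' (Icc a b)) :
    ∫ t in a..b, f t * g t = (∫ t in a..b, f t) * g b - ∫ t in a..b, (∫ u in a..t, f u) * g' t := by
  have hg'i : IntervalIntegrable g' volume a b := by
    apply ContinuousOn.intervalIntegrable; rwa [uIcc_of_le hab]
  have h := intervalIntegral.integral_mul_deriv_eq_deriv_mul_of_hasDeriv_right
    (u := fun x => ∫ t in a..x, f t) (v := g) (u' := f) (v' := g') (a := a) (b := b)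
    ?_ ?_ ?_ ?_ hf hg'i
  · rw [intervalIntegral.integral_same] at h
    linarith
  · have := intervalIntegral.continuousOn_primitive_interval' hf left_mem_uIcc
    exact this
  · rw [uIcc_of_le hab]; exact fun x hx => (hg x hx).continuousAt.continuousWithinAt
  · intro x hx
    rw [min_eq_left hab, max_eq_right hab] at hx
    have hfx : IntervalIntegrable f volume a x := hf.mono_set (by
      rw [uIcc_of_le hab, uIcc_of_le hx.1.le]; exact Icc_subset_Icc_right hx.2.le)
    refine HasDerivWithinAt.mono (intervalIntegral.integral_hasDerivWithinAt_right hfx (s := Ici x) (t := Ioi x) ?_ ((hrc x hx).mono Ioi_subset_Ici_self)) Ioi_subset_Ici_self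
    refine ⟨Ioc x b, Ioc_mem_nhdsGT hx.2, ?_⟩
    exact (hf.1.mono_set (Ioc_subset_Ioc_left hx.1.le)).aestronglyMeasurable
  · intro x hx
    rw [min_eq_left hab, max_eq_right hab] at hx
    exact (hg x ⟨hx.1.le, hx.2.le⟩).hasDerivWithinAt

theorem psi_rc {x : ℝ} (hx : 0 ≤ x) : ContinuousWithinAt Chebyshev.psi (Ici x) x :=
  floor_rc (fun n => Chebyshev.psi n) Chebyshev.psi_eq_psi_coe_floor hx
theorem theta_rc {x : ℝ} (hx : 0 ≤ x) : ContinuousWithinAt Chebyshev.theta (Ici x) x :=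
  floor_rc (fun n => Chebyshev.theta n) Chebyshev.theta_eq_theta_coe_floor hx
theorem psi_ii (a b : ℝ) : IntervalIntegrable Chebyshev.psi volume a b :=
  Chebyshev.psi_mono.intervalIntegrable
theorem theta_ii (a b : ℝ) : IntervalIntegrable Chebyshev.theta volume a b :=
  Chebyshev.theta_mono.intervalIntegrable

theorem Ssum_eq_int {x : ℝ} (hx : 1 ≤ x) : Ssum x = ∫ t in (1:ℝ)..x, Chebyshev.psi t * (1 / t ^ 2) := by
  have h := sum_mul_eq_sub_integral_mul₀ (f := fun t : ℝ => 1 / t)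
    (fun n => ArithmeticFunction.vonMangoldt n) (by simp) x ?_ ?_
  · simp only [← Chebyshev.psi_eq_sum_Icc] at h
    rw [intervalIntegral.integral_of_le hx]
    have h2 : ∫ t in Ioc 1 x, deriv (fun t : ℝ => 1 / t) t * Chebyshev.psi t
       = - ∫ t in Ioc 1 x, Chebyshev.psi t * (1 / t ^ 2) := by
      rw [← integral_neg]
      apply integral_congr_ae; refine ae_of_all _ fun t => ?_
      simp; ring
    rw [h2] at h
    have h3 : ∑ k ∈ Finset.Icc 0 ⌊x⌋₊, 1 / (k:ℝ) * ArithmeticFunction.vonMangoldt k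
      = ∑ k ∈ Finset.Icc 1 ⌊x⌋₊, 1 / (k:ℝ) * ArithmeticFunction.vonMangoldt k := by
      symm
      apply Finset.sum_subset (Finset.Icc_subset_Icc_left (by norm_num))
      intro k hk hk'
      have : k = 0 := by simp only [Finset.mem_Icc] at hk hk'; omega
      simp [this]
    have h4 : Chebyshev.psi x = ∑ k ∈ Finset.Icc 1 ⌊x⌋₊, ArithmeticFunction.vonMangoldt k := rfl
    rw [h3, h4] at h
    unfold Ssum
    simp only [mul_sub, Finset.sum_sub_distrib, ← Finset.sum_mul]
    simp only [mul_comm] at h ⊢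
    linarith
  · intro t ht
    have : t ≠ 0 := by have := ht.1; positivity
    fun_prop (disch := assumption)
  · have : deriv (fun t : ℝ => 1 / t) = fun t => -(1 / t ^ 2) := by ext t; simp
    rw [this]
    apply ContinuousOn.integrableOn_Icc
    intro t ht
    have : t ^ 2 ≠ 0 := by have := ht.1; positivity
    exact ContinuousAt.continuousWithinAt (by fun_prop (disch := assumption))

theorem intpsi_eq {x : ℝ} (hx : 1 ≤ x) : ∫ t in (1:ℝ)..x, Chebyshev.psi t =
    x ^ 2 * Ssum x - ∫ t in (1:ℝ)..x, 2 * t * Ssum t := by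
  have hc : ContinuousOn (fun t : ℝ => 1 / t ^ 2) (uIcc 1 x) := by
    rw [uIcc_of_le hx]
    intro t ht
    have : t ^ 2 ≠ 0 := by have := ht.1; positivity
    exact ContinuousAt.continuousWithinAt (by fun_prop (disch := assumption))
  have h := ibp (f := fun t => Chebyshev.psi t * (1 / t ^ 2)) (g := fun t => t ^ 2) (g' := fun t => 2 * t) hx
    ((psi_ii 1 x).mul_continuousOn hc) ?_ ?_ (by fun_prop)
  · rw [← Ssum_eq_int hx] at h
    have e1 : ∫ t in (1:ℝ)..x, Chebyshev.psi t * (1 / t ^ 2) * t ^ 2 = ∫ t in (1:ℝ)..x, Chebyshev.psi t := by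
      apply intervalIntegral.integral_congr
      intro t ht
      rw [uIcc_of_le hx] at ht
      have : t ≠ 0 := by have := ht.1; positivity
      simp only
      field_simp
    have e2 : ∫ t in (1:ℝ)..x, (∫ u in (1:ℝ)..t, Chebyshev.psi u * (1 / u ^ 2)) * (2 * t) = ∫ t in (1:ℝ)..x, 2 * t * Ssum t := by
      apply intervalIntegral.integral_congr
      intro t ht
      rw [uIcc_of_le hx] at ht
      simp only
      rw [← Ssum_eq_int ht.1]; ring
    rw [e1, e2] at h
    rw [h]; ring
  · intro t ht
    have ht0 : (0:ℝ) < t := by linarith [ht.1]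
    refine (psi_rc ht0.le).mul (ContinuousAt.continuousWithinAt ?_)
    have : t ^ 2 ≠ 0 := by positivity
    fun_prop (disch := assumption)
  · intro t ht
    simpa using hasDerivAt_pow 2 t

theorem Ssum_cont {x : ℝ} : ContinuousOn Ssum (Icc 1 x) := by
  rcases lt_or_ge x 1 with h | hx
  · rw [Icc_eq_empty (by linarith)]; exact continuousOn_empty _
  have hc : ContinuousOn (fun t : ℝ => 1 / t ^ 2) (uIcc 1 x) := by
    rw [uIcc_of_le hx]
    intro t ht
    have : t ^ 2 ≠ 0 := by have := ht.1; positivity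
    exact ContinuousAt.continuousWithinAt (by fun_prop (disch := assumption))
  have := intervalIntegral.continuousOn_primitive_interval' ((psi_ii 1 x).mul_continuousOn hc) left_mem_uIcc
  rw [uIcc_of_le hx] at this
  exact this.congr fun t ht => Ssum_eq_int ht.1
end ibp
end RHPi

namespace RHPi
section bnd
open Set Topology

lemma log_ge_of (n m k : ℕ) (hn : 0 < n) (h : 2 ^ k ≤ n ^ m) : (k:ℝ) * Real.log 2 ≤ m * Real.log n := by
  rw [← Real.log_pow, ← Real.log_pow]
  apply Real.log_le_log (by positivity)
  exact_mod_cast h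

lemma log_le_of (n m k : ℕ) (hn : 0 < n) (h : n ^ m ≤ 2 ^ k) : (m:ℝ) * Real.log n ≤ k * Real.log 2 := by
  rw [← Real.log_pow, ← Real.log_pow]
  apply Real.log_le_log (by positivity)
  exact_mod_cast h

theorem eta_le : 4 * (logDeriv Xi 1).re ≤ 0.1111 := by
  rw [FX_one', Complex.ofReal_re]
  have h1 := (Real.eulerMascheroniConstant_lt_eulerMascheroniSeq' 64).le
  have h2 : Real.eulerMascheroniSeq' 64 ≤ 4.744 - 6 * Real.log 2 := by
    unfold Real.eulerMascheroniSeq'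
    have : Real.log ((64:ℕ):ℝ) = 6 * Real.log 2 := by
      rw [show ((64:ℕ):ℝ) = 2 ^ 6 by norm_num, Real.log_pow]; norm_num
    rw [if_neg (by norm_num), this]
    have h : harmonic 64 ≤ 4.744 := by
      norm_num [harmonic, Finset.sum_range_succ]
    have h' : ((harmonic 64 : ℚ) : ℝ) ≤ ((4.744 : ℚ) : ℝ) := by exact_mod_cast h
    push_cast at h'
    norm_num at h' ⊢
  have h3 : 33 * Real.log 2 ≤ 20 * Real.log Real.pi := by
    have e1 : 33 * Real.log 2 = Real.log (2 ^ 33) := by rw [Real.log_pow]; norm_num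
    have e2 : 20 * Real.log Real.pi = Real.log (Real.pi ^ 20) := by rw [Real.log_pow]; norm_num
    rw [e1, e2]
    apply Real.log_le_log (by positivity)
    calc (2:ℝ) ^ 33 ≤ 3.14 ^ 20 := by norm_num
      _ ≤ _ := by gcongr; exact Real.pi_gt_d2.le
  have h4 := Real.log_two_gt_d9
  have h5 := Real.log_two_lt_d9
  norm_num at *
  linarith

theorem intpsi_le (hZ : ∀ s : ℂ, 1 / 2 < s.re → riemannZeta₁ s ≠ 0) {x : ℝ} (hx : 1 ≤ x) :
    ∫ t in (1:ℝ)..x, Chebyshev.psi t ≤ x ^ 2 / 2 + 0.26 * (x * √x) - x + 1 := by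
  set η := 4 * (logDeriv Xi 1).re with hη
  set γ := Real.eulerMascheroniConstant with hγ
  have hγ2 : 1 / 2 < γ := Real.one_half_lt_eulerMascheroniConstant
  have hη1 : η ≤ 0.1111 := eta_le
  have hη0 : 0 ≤ η := by
    have := (S_bound hZ le_rfl).1
    simp [Ssum] at this
    linarith
  rw [intpsi_eq hx]
  have hx0 : 0 < x := by linarith
  have hs0 : 0 < √x := Real.sqrt_pos.mpr hx0
  have hss : √x * √x = x := Real.mul_self_sqrt hx0.le
  have up : x ^ 2 * Ssum x ≤ x ^ 2 * Real.log x - (1 + γ) * (x ^ 2 - x) + η * (x * √x) + x / 2 := by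
    have h := (S_bound hZ hx).2
    have h2 := mul_le_mul_of_nonneg_left h (show 0 ≤ x * √x by positivity)
    have e : x * √x * (√x * (Ssum x - Real.log x + (1 + γ) * (1 - 1 / x)))
      = x ^ 2 * Ssum x - x ^ 2 * Real.log x + (1 + γ) * (x ^ 2 - x) := by
      calc _ = x * (√x * √x) * (Ssum x - Real.log x + (1 + γ) * (1 - 1 / x)) := by ring
        _ = _ := by rw [hss]; field_simp
    have e2 : x * √x * (η + 1 / (2 * √x)) = η * (x * √x) + x / 2 := by field_simp
    rw [e, e2] at h2
    linarith
  have hF : ∀ t : ℝ, 1 ≤ t → HasDerivAt (fun t : ℝ => t ^ 2 * Real.log t - t ^ 2 / 2 - (1 + γ) * (t ^ 2 - 2 * t) - 4 / 3 * η * (t * √t))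
      (2 * t * (Real.log t - (1 + γ) * (1 - 1 / t)) - 2 * η * √t) t := by
    intro t ht
    have ht0 : 0 < t := by linarith
    have a1 := (hasDerivAt_pow 2 t).fun_mul (Real.hasDerivAt_log ht0.ne')
    have a2 := (hasDerivAt_pow 2 t).div_const 2
    have a3 := (((hasDerivAt_pow 2 t).fun_sub ((hasDerivAt_id t).const_mul 2)).const_mul (1 + γ))
    have a4 := (((hasDerivAt_id t).fun_mul (Real.hasDerivAt_sqrt ht0.ne'))).const_mul (4 / 3 * η)
    have := ((a1.fun_sub a2).fun_sub a3).fun_sub a4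
    refine this.congr_deriv ?_
    have hs0 : 0 < √t := Real.sqrt_pos.mpr ht0
    have hss : √t * √t = t := Real.mul_self_sqrt ht0.le
    simp only [id]
    have : t * (1 / (2 * √t)) = √t / 2 := by
      field_simp; nlinarith
    rw [this]
    have e : t ^ 2 * t⁻¹ = t := by field_simp
    rw [e]
    have e : t * (1 / t) = 1 := by field_simp
    push_cast
    simp only [Nat.add_one_sub_one, pow_one]
    linear_combination (-2 * (1 + γ)) * e
  have lo : (x ^ 2 * Real.log x - x ^ 2 / 2 - (1 + γ) * (x ^ 2 - 2 * x) - 4 / 3 * η * (x * √x)) - (-1 / 2 + (1 + γ) - 4 / 3 * η) ≤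
      ∫ t in (1:ℝ)..x, 2 * t * Ssum t := by
    have hc : ContinuousOn (fun t : ℝ => 2 * t * (Real.log t - (1 + γ) * (1 - 1 / t)) - 2 * η * √t) (uIcc 1 x) := by
      rw [uIcc_of_le hx]
      intro t ht
      have : t ≠ 0 := by have := ht.1; positivity
      exact ContinuousAt.continuousWithinAt (by fun_prop (disch := assumption))
    have h := intervalIntegral.integral_eq_sub_of_hasDerivAt (fun t ht => hF t (by rw [uIcc_of_le hx] at ht; exact ht.1)) hc.intervalIntegrable
    have e : (x ^ 2 * Real.log x - x ^ 2 / 2 - (1 + γ) * (x ^ 2 - 2 * x) - 4 / 3 * η * (x * √x)) - (-1 / 2 + (1 + γ) - 4 / 3 * η)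
      = ∫ t in (1:ℝ)..x, (2 * t * (Real.log t - (1 + γ) * (1 - 1 / t)) - 2 * η * √t) := by
      rw [h]; simp; ring
    rw [e]
    apply intervalIntegral.integral_mono_on hx hc.intervalIntegrable
    · apply ContinuousOn.intervalIntegrable
      rw [uIcc_of_le hx]
      exact ContinuousOn.mul (by fun_prop) Ssum_cont
    · intro t ht
      have ht0 : 0 < t := by linarith [ht.1]
      have hs0 : 0 < √t := Real.sqrt_pos.mpr ht0
      have hss : √t * √t = t := Real.mul_self_sqrt ht0.le
      have h := (S_bound hZ ht.1).1
      have h2 := mul_le_mul_of_nonneg_left h hs0.le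
      rw [← mul_assoc, hss] at h2
      linarith
  have : (γ - 1 / 2) * (x - 1) ≥ 0 := mul_nonneg (by linarith) (by linarith)
  have h3 : 7 / 3 * η * (x * √x) ≤ 0.26 * (x * √x) := by gcongr; linarith
  linarith
end bnd
end RHPi

namespace RHPi
section bnd
open Set Topology
local notation "ψ" => Chebyshev.psi
local notation "θ" => Chebyshev.theta

lemma int_ge {f : ℝ → ℝ} {a b c : ℝ} (hab : a ≤ b) (hf : IntervalIntegrable f volume a b) (h : ∀ t ∈ Icc a b, c ≤ f t) :
    c * (b - a) ≤ ∫ t in a..b, f t := by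
  have := intervalIntegral.integral_mono_on hab (intervalIntegrable_const (c := c)) hf h
  simpa [mul_comm] using this

lemma theta_nat_eq (n N : ℕ) (h : primorial n = N) : θ n = Real.log N := by
  rw [Chebyshev.theta_eq_log_primorial, Nat.floor_natCast, h]

lemma theta_mid {n : ℕ} {N : ℕ} (h : primorial n = N) {t : ℝ} (ht : t < n + 1) : θ t ≤ Real.log N := by
  rw [Chebyshev.theta_eq_theta_coe_floor, ← theta_nat_eq n N h]
  apply Chebyshev.theta_mono
  have : ⌊t⌋₊ < n + 1 := Nat.floor_lt' (by omega) |>.mpr (by exact_mod_cast ht)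
  exact_mod_cast Nat.lt_succ_iff.mp this

lemma theta_low {n : ℕ} {N : ℕ} (h : primorial n = N) {t : ℝ} (ht : n ≤ t) : Real.log N ≤ θ t := by
  rw [← theta_nat_eq n N h]
  exact Chebyshev.theta_mono ht

lemma theta_lt_self {t : ℝ} (h1 : 10 ≤ t) (h2 : t < 31) : θ t < t := by
  have l2 := Real.log_two_lt_d9
  rcases lt_or_ge t 13 with h | h3
  · have := theta_mid (n := 12) (N := 2310) (by norm_num [primorial, Finset.prod_filter, Finset.prod_range_succ]) (by norm_num; linarith : t < _)
    have := log_le_of 2310 1 12 (by norm_num) (by norm_num)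
    push_cast at *
    linarith
  rcases lt_or_ge t 17 with h | h4
  · have := theta_mid (n := 16) (N := 30030) (by norm_num [primorial, Finset.prod_filter, Finset.prod_range_succ]) (by norm_num; linarith : t < _)
    have := log_le_of 30030 1 15 (by norm_num) (by norm_num)
    push_cast at *
    linarith
  rcases lt_or_ge t 23 with h | h5
  · have := theta_mid (n := 22) (N := 9699690) (by norm_num [primorial, Finset.prod_filter, Finset.prod_range_succ]) (by norm_num; linarith : t < _)
    have := log_le_of 9699690 1 24 (by norm_num) (by norm_num)
    push_cast at *
    linarith
  · have := theta_mid (n := 30) (N := 6469693230) (by norm_num [primorial, Finset.prod_filter, Finset.prod_range_succ]) (by norm_num; linarith : t < _)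
    have := log_le_of 6469693230 1 33 (by norm_num) (by norm_num)
    push_cast at *
    linarith

lemma psi_ge_39 {y : ℝ} (hy : 3 ≤ y) : 0.39 * y ≤ ψ y := by
  have l2 := Real.log_two_gt_d9
  rcases lt_or_ge y 4 with h | h4
  · have := theta_low (n := 3) (N := 6) (by norm_num [primorial, Finset.prod_filter, Finset.prod_range_succ]) (by norm_num; linarith : _ ≤ y)
    have := log_ge_of 6 2 5 (by norm_num) (by norm_num)
    have := Chebyshev.theta_le_psi y
    push_cast at *
    linarith
  rcases lt_or_ge y 5 with h | h5
  · have h1 : ψ (4:ℕ) ≤ ψ y := Chebyshev.psi_mono (by exact_mod_cast h4)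
    rw [Chebyshev.psi_eq_log_lcmUpto, show Nat.lcmUpto 4 = 12 by decide +kernel] at h1
    have := log_ge_of 12 2 7 (by norm_num) (by norm_num)
    push_cast at *
    linarith
  rcases lt_or_ge y 7 with h | h6
  · have := theta_low (n := 5) (N := 30) (by norm_num [primorial, Finset.prod_filter, Finset.prod_range_succ]) (by norm_num; linarith : _ ≤ y)
    have := log_ge_of 30 2 9 (by norm_num) (by norm_num)
    have := Chebyshev.theta_le_psi y
    push_cast at *
    linarith
  rcases lt_or_ge y 11 with h | h7
  · have := theta_low (n := 7) (N := 210) (by norm_num [primorial, Finset.prod_filter, Finset.prod_range_succ]) (by norm_num; linarith : _ ≤ y)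
    have := log_ge_of 210 2 15 (by norm_num) (by norm_num)
    have := Chebyshev.theta_le_psi y
    push_cast at *
    linarith
  · have h1 := Chebyshev.psi_ge' (x := y) (by linarith)
    have h2 : Real.log (y + 2) ≤ Real.log 13 + (y - 11) / 13 := by
      have : Real.log ((y + 2) / 13) ≤ (y + 2) / 13 - 1 := Real.log_le_sub_one_of_pos (by linarith)
      rw [Real.log_div (by linarith) (by norm_num)] at this
      linarith
    have := log_le_of 13 4 15 (by norm_num) (by norm_num)
    have l3 := Real.log_two_lt_d9
    push_cast at *
    nlinarith

lemma int_theta_ge : 25.9 ≤ ∫ t in (1:ℝ)..10, θ t := by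
  have l2 := Real.log_two_gt_d9
  have e : ∫ t in (1:ℝ)..10, θ t = (∫ t in (1:ℝ)..2, θ t) + (∫ t in (2:ℝ)..3, θ t) + (∫ t in (3:ℝ)..5, θ t)
    + (∫ t in (5:ℝ)..7, θ t) + (∫ t in (7:ℝ)..10, θ t) := by
    rw [intervalIntegral.integral_add_adjacent_intervals, intervalIntegral.integral_add_adjacent_intervals,
      intervalIntegral.integral_add_adjacent_intervals, intervalIntegral.integral_add_adjacent_intervals] <;> exact theta_ii _ _
  have h0 := int_ge (f := θ) (a := 1) (b := 2) (c := 0) (by norm_num) (theta_ii _ _) (fun t _ => Chebyshev.theta_nonneg t)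
  have h1 := int_ge (f := θ) (a := 2) (b := 3) (by norm_num) (theta_ii _ _) (fun t ht => theta_low (n := 2) (N := 2) (by norm_num [primorial, Finset.prod_filter, Finset.prod_range_succ]) (by exact_mod_cast ht.1))
  have h2 := int_ge (f := θ) (a := 3) (b := 5) (by norm_num) (theta_ii _ _) (fun t ht => theta_low (n := 3) (N := 6) (by norm_num [primorial, Finset.prod_filter, Finset.prod_range_succ]) (by exact_mod_cast ht.1))
  have h3 := int_ge (f := θ) (a := 5) (b := 7) (by norm_num) (theta_ii _ _) (fun t ht => theta_low (n := 5) (N := 30) (by norm_num [primorial, Finset.prod_filter, Finset.prod_range_succ]) (by exact_mod_cast ht.1))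
  have h4 := int_ge (f := θ) (a := 7) (b := 10) (by norm_num) (theta_ii _ _) (fun t ht => theta_low (n := 7) (N := 210) (by norm_num [primorial, Finset.prod_filter, Finset.prod_range_succ]) (by exact_mod_cast ht.1))
  have := log_ge_of 6 2 5 (by norm_num) (by norm_num)
  have := log_ge_of 30 2 9 (by norm_num) (by norm_num)
  have := log_ge_of 210 2 15 (by norm_num) (by norm_num)
  push_cast at *
  linarith

lemma psi_sqrt_ii (a b : ℝ) : IntervalIntegrable (fun t => ψ √t) volume a b :=
  Monotone.intervalIntegrable fun _ _ h => Chebyshev.psi_mono (Real.sqrt_le_sqrt h)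

lemma int_psi_sqrt {x : ℝ} (hx : 9 ≤ x) : 0.26 * (x * √x) - 3.56 ≤ ∫ t in (1:ℝ)..x, ψ √t := by
  have l2 := Real.log_two_gt_d9
  have e : ∫ t in (1:ℝ)..x, ψ √t = (∫ t in (1:ℝ)..4, ψ √t) + (∫ t in (4:ℝ)..9, ψ √t) + (∫ t in (9:ℝ)..x, ψ √t) := by
    rw [intervalIntegral.integral_add_adjacent_intervals, intervalIntegral.integral_add_adjacent_intervals] <;> exact psi_sqrt_ii _ _
  have h0 := int_ge (a := 1) (b := 4) (c := 0) (by norm_num) (psi_sqrt_ii _ _) (fun t _ => Chebyshev.psi_nonneg _)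
  have h1 := int_ge (a := 4) (b := 9) (c := Real.log 2) (by norm_num) (psi_sqrt_ii _ _) (fun t ht => by
    have h2 : (2:ℕ) ≤ √t := Real.le_sqrt_of_sq_le (by norm_num; exact ht.1)
    have := theta_low (n := 2) (N := 2) (by norm_num [primorial, Finset.prod_filter, Finset.prod_range_succ]) h2
    exact_mod_cast this.trans (Chebyshev.theta_le_psi _))
  have h2 : 0.26 * (x * √x) - 7.02 ≤ ∫ t in (9:ℝ)..x, ψ √t := by
    have hd : ∀ t ∈ uIcc 9 x, HasDerivAt (fun t : ℝ => 0.26 * (t * √t)) (0.39 * √t) t := by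
      intro t ht
      rw [uIcc_of_le hx] at ht
      have ht0 : 0 < t := by linarith [ht.1]
      have := (((hasDerivAt_id t).fun_mul (Real.hasDerivAt_sqrt ht0.ne'))).const_mul (0.26 : ℝ)
      refine this.congr_deriv ?_
      have hs0 : 0 < √t := Real.sqrt_pos.mpr ht0
      have hss : √t * √t = t := Real.mul_self_sqrt ht0.le
      simp only [id]
      have : t * (1 / (2 * √t)) = √t / 2 := by
        field_simp; nlinarith
      rw [this]; norm_num; ring
    have hc : IntervalIntegrable (fun t : ℝ => 0.39 * √t) volume 9 x := Continuous.intervalIntegrable (by fun_prop) _ _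
    have h := intervalIntegral.integral_eq_sub_of_hasDerivAt hd hc
    have h9 : √(9:ℝ) = 3 := by rw [show (9:ℝ) = 3 ^ 2 by norm_num]; exact Real.sqrt_sq (by norm_num)
    rw [h9] at h
    have h3 := intervalIntegral.integral_mono_on hx hc (psi_sqrt_ii 9 x) (fun t ht => psi_ge_39 (Real.le_sqrt_of_sq_le (by norm_num; exact ht.1)))
    rw [h] at h3
    norm_num at h3 ⊢
    linarith
  linarith

theorem T_nonpos (hZ : ∀ s : ℂ, 1 / 2 < s.re → riemannZeta₁ s ≠ 0) {x : ℝ} (hx : 10 ≤ x) :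
    ∫ t in (10:ℝ)..x, (θ t - t) ≤ 0 := by
  rcases lt_or_ge x 31 with h | h
  · have := intervalIntegral.integral_nonneg (μ := volume) (f := fun t => -(θ t - t)) hx (fun t ht => by
      have := theta_lt_self ht.1 (ht.2.trans_lt h); linarith)
    rw [intervalIntegral.integral_neg] at this
    linarith
  · rw [intervalIntegral.integral_sub (theta_ii _ _) intervalIntegral.intervalIntegrable_id]
    have h1 := intpsi_le hZ (x := x) (by linarith)
    have h2 := int_psi_sqrt (x := x) (by linarith)
    have h3 := int_theta_ge
    have h4 := intervalIntegral.integral_add_adjacent_intervals (theta_ii 1 10) (theta_ii 10 x)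
    have h5 : (∫ t in (1:ℝ)..x, θ t) + ∫ t in (1:ℝ)..x, ψ √t ≤ ∫ t in (1:ℝ)..x, ψ t := by
      rw [← intervalIntegral.integral_add (theta_ii _ _) (psi_sqrt_ii _ _)]
      apply intervalIntegral.integral_mono_on (by linarith) ((theta_ii _ _).add (psi_sqrt_ii _ _)) (psi_ii _ _)
      intro t ht
      have := Chebyshev.psi_sub_theta_ge_psi_add_psi_add_psi (x := t) (by linarith [ht.1])
      have e : t ^ (2:ℝ)⁻¹ = √t := by rw [Real.sqrt_eq_rpow]; norm_num
      rw [e] at this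
      have := Chebyshev.psi_nonneg (t ^ (3:ℝ)⁻¹)
      have := Chebyshev.psi_nonneg (t ^ (7:ℝ)⁻¹)
      linarith
    rw [integral_id]
    linarith
end bnd
end RHPi

namespace RHPi
section lisec
open Set Topology

noncomputable def kk (v : ℝ) : ℝ := 1 / Real.log (1 + v) + 1 / Real.log (1 - v)
noncomputable def L0 : ℝ := ∫ v in (0:ℝ)..1, kk v

lemma nonneg_of_deriv {h h' : ℝ → ℝ} (hd : ∀ v ∈ Ico (0:ℝ) 1, HasDerivAt h (h' v) v) (h0 : h 0 = 0)
    (hp : ∀ v ∈ Ioo (0:ℝ) 1, 0 ≤ h' v) : ∀ v ∈ Ico (0:ℝ) 1, 0 ≤ h v := by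
  have hm : MonotoneOn h (Ico 0 1) := by
    apply monotoneOn_of_deriv_nonneg (convex_Ico 0 1)
    · exact fun v hv => (hd v hv).continuousAt.continuousWithinAt
    · rw [interior_Ico]; exact fun v hv => (hd v ⟨hv.1.le, hv.2⟩).differentiableAt.differentiableWithinAt
    · rw [interior_Ico]; intro v hv; rw [(hd v ⟨hv.1.le, hv.2⟩).deriv]; exact hp v hv
  intro v hv
  rw [← h0]
  exact hm ⟨le_rfl, by norm_num⟩ hv hv.1

lemma dlog1 {v : ℝ} (hv : v ∈ Ico (0:ℝ) 1) : HasDerivAt (fun v : ℝ => Real.log (1 + v)) (1 / (1 + v)) v := by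
  have := ((hasDerivAt_id v).const_add 1).log (by simp; linarith [hv.1])
  simpa using this
lemma dlog2 {v : ℝ} (hv : v ∈ Ico (0:ℝ) 1) : HasDerivAt (fun v : ℝ => Real.log (1 - v)) (-1 / (1 - v)) v := by
  have := ((hasDerivAt_id v).const_sub 1).log (by simp; linarith [hv.2])
  simpa using this

lemma kk_aux1 : ∀ v ∈ Ico (0:ℝ) 1, 0 ≤ 2 * v + (1 - v) * Real.log (1 - v) - (1 + v) * Real.log (1 + v) := by
  apply nonneg_of_deriv (h' := fun v => -Real.log (1 - v) - Real.log (1 + v))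
  · intro v hv
    have a1 := (hasDerivAt_id v).const_mul 2
    have a2 := ((hasDerivAt_id v).const_sub 1).fun_mul (dlog2 hv)
    have a3 := ((hasDerivAt_id v).const_add 1).fun_mul (dlog1 hv)
    refine ((a1.fun_add a2).fun_sub a3).congr_deriv ?_
    have : 1 - v ≠ 0 := by linarith [hv.2]
    have : 1 + v ≠ 0 := by linarith [hv.1]
    simp only [id]
    generalize Real.log (1 - v) = A
    generalize Real.log (1 + v) = B
    field_simp; ring
  · simp
  · intro v hv
    rw [← neg_add', ← Real.log_mul (by linarith [hv.2]) (by linarith [hv.1])]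
    have : Real.log ((1 - v) * (1 + v)) ≤ 0 := Real.log_nonpos (by nlinarith [hv.1, hv.2]) (by nlinarith [hv.1, hv.2])
    linarith

lemma kk_aux2 : ∀ v ∈ Ico (0:ℝ) 1, 0 ≤ -Real.log (1 - v) - Real.log (1 + v) + Real.log (1 + v) * Real.log (1 - v) := by
  apply nonneg_of_deriv (h' := fun v => (2 * v + (1 - v) * Real.log (1 - v) - (1 + v) * Real.log (1 + v)) / ((1 - v) * (1 + v)))
  · intro v hv
    refine (((dlog2 hv).fun_neg.fun_sub (dlog1 hv)).fun_add ((dlog1 hv).fun_mul (dlog2 hv))).congr_deriv ?_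
    have : 1 - v ≠ 0 := by linarith [hv.2]
    have : 1 + v ≠ 0 := by linarith [hv.1]
    generalize Real.log (1 - v) = A
    generalize Real.log (1 + v) = B
    field_simp; ring
  · simp
  · intro v hv
    exact div_nonneg (kk_aux1 v ⟨hv.1.le, hv.2⟩) (by nlinarith [hv.1, hv.2])

lemma kk_bd {v : ℝ} (hv : v ∈ Ioo (0:ℝ) 1) : 1 ≤ kk v ∧ kk v ≤ 2 := by
  obtain ⟨h0, h1⟩ := hv
  have hA : 0 < Real.log (1 + v) := Real.log_pos (by linarith)
  have hB : Real.log (1 - v) < 0 := Real.log_neg (by linarith) (by linarith)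
  have h := kk_aux2 v ⟨h0.le, h1⟩
  unfold kk
  constructor
  · rw [div_add_div _ _ hA.ne' hB.ne, le_div_iff_of_neg (mul_neg_of_pos_of_neg hA hB)]
    linarith
  · have b1 : v / (1 + v) ≤ Real.log (1 + v) := by
      have := Real.one_sub_inv_le_log_of_pos (show 0 < 1 + v by linarith)
      have e : v / (1 + v) = 1 - (1 + v)⁻¹ := by field_simp; ring
      rw [e]; exact this
    have b2 : -(v / (1 - v)) ≤ Real.log (1 - v) := by
      have := Real.one_sub_inv_le_log_of_pos (show 0 < 1 - v by linarith)
      have : 1 - v ≠ 0 := by linarith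
      have e : -(v / (1 - v)) = 1 - (1 - v)⁻¹ := by field_simp; ring
      rwa [e]
    have c1 : 1 / Real.log (1 + v) ≤ (1 + v) / v := by
      have := one_div_le_one_div_of_le (by positivity) b1
      rwa [one_div_div] at this
    have c2 : 1 / Real.log (1 - v) ≤ -((1 - v) / v) := by
      have hp : 0 < v / (1 - v) := div_pos h0 (by linarith)
      have := one_div_le_one_div_of_le (show 0 < -Real.log (1 - v) by linarith) (show -Real.log (1 - v) ≤ v / (1 - v) by linarith)
      rw [one_div_div, one_div_neg_eq_neg_one_div] at this
      linarith
    have : (1 + v) / v + -((1 - v) / v) = 2 := by field_simp; ring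
    linarith

lemma kk_ii : IntervalIntegrable kk volume 0 1 := by
  rw [intervalIntegrable_iff_integrableOn_Ioo_of_le zero_le_one]
  have hm : Measurable kk := by unfold kk; fun_prop
  apply Measure.integrableOn_of_bounded (M := 2) (by simp) hm.aestronglyMeasurable
  filter_upwards [ae_restrict_mem measurableSet_Ioo] with v hv
  have := kk_bd hv
  rw [Real.norm_eq_abs, abs_le]; constructor <;> linarith

lemma L0_ge : 1 ≤ L0 := by
  unfold L0
  rw [intervalIntegral.integral_of_le zero_le_one]
  have h := setIntegral_mono_on (μ := volume) (s := Ioo (0:ℝ) 1) (f := fun _ => (1:ℝ)) (g := kk) (by simp)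
    ((intervalIntegrable_iff_integrableOn_Ioo_of_le zero_le_one).mp kk_ii) measurableSet_Ioo (fun v hv => (kk_bd hv).1)
  rw [integral_Ioc_eq_integral_Ioo]
  simpa using h

lemma invlog_cont {a b : ℝ} (ha : 1 < a) : ContinuousOn (fun u : ℝ => 1 / Real.log u) (Icc a b) := by
  intro u hu
  have h1 : u ≠ 0 := by linarith [hu.1]
  have h2 : Real.log u ≠ 0 := (Real.log_pos (by linarith [hu.1])).ne'
  exact ContinuousAt.continuousWithinAt (by fun_prop (disch := assumption))

lemma invlog_ii {a b : ℝ} (ha : 1 < a) (hb : 1 < b) : IntervalIntegrable (fun u : ℝ => 1 / Real.log u) volume a b := by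
  apply ContinuousOn.intervalIntegrable
  exact invlog_cont (lt_min ha hb)

theorem li_eq {x : ℝ} (hx : 2 ≤ x) : li x = L0 + ∫ u in (2:ℝ)..x, 1 / Real.log u := by
  unfold li
  apply Tendsto.limUnder_eq
  have hev : ∀ᶠ ε : ℝ in 𝓝[>] 0, (∫ v in ε..1, kk v) + (∫ u in (2:ℝ)..x, 1 / Real.log u)
     = (∫ u in (0:ℝ)..(1 - ε), 1 / Real.log u) + ∫ u in (1 + ε)..x, 1 / Real.log u := by
    filter_upwards [Ioo_mem_nhdsGT (show (0:ℝ) < 1 by norm_num)] with ε hε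
    have e1 : ∫ v in ε..1, 1 / Real.log (1 - v) = ∫ u in (0:ℝ)..(1 - ε), 1 / Real.log u := by
      have := intervalIntegral.integral_comp_sub_left (a := ε) (b := 1) (fun u => 1 / Real.log u) 1
      simpa using this
    have e2 : ∫ v in ε..1, 1 / Real.log (1 + v) = ∫ u in (1 + ε)..2, 1 / Real.log u := by
      have := intervalIntegral.integral_comp_add_left (a := ε) (b := 1) (fun u => 1 / Real.log u) 1
      rw [this]; norm_num
    have i1 : IntervalIntegrable (fun v => 1 / Real.log (1 + v)) volume ε 1 := by
      apply ContinuousOn.intervalIntegrable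
      rw [uIcc_of_le hε.2.le]
      intro u hu
      have h1 : 1 + u ≠ 0 := by linarith [hu.1, hε.1]
      have h2 : Real.log (1 + u) ≠ 0 := (Real.log_pos (by linarith [hu.1, hε.1])).ne'
      exact ContinuousAt.continuousWithinAt (by fun_prop (disch := assumption))
    have ik : IntervalIntegrable kk volume ε 1 := kk_ii.mono_set (by
      rw [uIcc_of_le hε.2.le, uIcc_of_le zero_le_one]; exact Icc_subset_Icc_left hε.1.le)
    have i2 : IntervalIntegrable (fun v => 1 / Real.log (1 - v)) volume ε 1 := by
      have := ik.sub i1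
      refine this.congr ?_
      intro v _
      simp [kk]
    have e3 : ∫ v in ε..1, kk v = (∫ v in ε..1, 1 / Real.log (1 + v)) + ∫ v in ε..1, 1 / Real.log (1 - v) := by
      rw [← intervalIntegral.integral_add i1 i2]; rfl
    rw [e3, e1, e2, add_comm (∫ u in (1 + ε)..2, 1 / Real.log u), add_assoc,
      intervalIntegral.integral_add_adjacent_intervals (invlog_ii (by linarith [hε.1]) (by norm_num)) (invlog_ii (by norm_num) (by linarith))]
  refine Tendsto.congr' hev (Tendsto.add_const _ ?_)
  have hc := intervalIntegral.continuousOn_primitive_interval' kk_ii (a := 1) right_mem_uIcc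
  have h0 := (hc 0 left_mem_uIcc).neg
  rw [uIcc_of_le zero_le_one] at h0
  have : Tendsto (fun ε : ℝ => -∫ v in (1:ℝ)..ε, kk v) (𝓝[>] 0) (𝓝 (-∫ v in (1:ℝ)..0, kk v)) := by
    apply h0.tendsto.mono_left
    rw [nhdsWithin_le_iff]
    filter_upwards [Ioo_mem_nhdsGT (show (0:ℝ) < 1 by norm_num)] with ε hε using ⟨hε.1.le, hε.2.le⟩
  simpa only [L0, ← intervalIntegral.integral_symm] using this

lemma li_cont {x : ℝ} (hx : 2 ≤ x) : ContinuousOn li (Icc 2 x) := by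
  have h := intervalIntegral.continuousOn_primitive_interval' (invlog_ii (a := 2) (b := x) (by norm_num) (by linarith)) left_mem_uIcc
  rw [uIcc_of_le hx] at h
  exact (h.const_add L0).congr fun t ht => li_eq ht.1

lemma li_ii {a b : ℝ} (ha : 2 ≤ a) (hb : 2 ≤ b) : IntervalIntegrable li volume a b := by
  apply ContinuousOn.intervalIntegrable
  exact (li_cont (x := max a b) (ha.trans (le_max_left _ _))).mono (Icc_subset_Icc_left (le_min ha hb))

lemma pi_ii (a b : ℝ) : IntervalIntegrable primePi volume a b := by
  apply Monotone.intervalIntegrable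
  intro x y h
  unfold primePi
  exact_mod_cast Nat.monotone_primeCounting (Nat.floor_mono h)
end lisec
end RHPi

namespace RHPi
section fwd
open Set Topology
local notation "θ" => Chebyshev.theta

lemma seg {a b m : ℝ} (ha : 1 < a) (hab : a ≤ b) (hm : Real.log ((a + b) / 2) ≤ m) :
    (b - a) / m ≤ ∫ u in a..b, 1 / Real.log u := by
  set c := (a + b) / 2 with hc
  have hc1 : 1 < c := by rw [hc]; linarith
  have hl : 0 < Real.log c := Real.log_pos hc1
  have h1 : (b - a) / m ≤ (b - a) / Real.log c := by
    apply div_le_div_of_nonneg_left (by linarith) hl hm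
  refine h1.trans ?_
  set l := Real.log c
  have h2 : ∫ u in a..b, (1 / l - (u - c) * (1 / (c * l ^ 2))) = (b - a) / l := by
    rw [intervalIntegral.integral_sub (by simp) (Continuous.intervalIntegrable (by fun_prop) _ _), intervalIntegral.integral_mul_const,
      intervalIntegral.integral_sub (by simp) (by simp), integral_id]
    simp only [intervalIntegral.integral_const, smul_eq_mul]
    have : (b ^ 2 - a ^ 2) / 2 - (b - a) * c = 0 := by rw [hc]; ring
    rw [this]; ring
  rw [← h2]
  apply intervalIntegral.integral_mono_on hab (Continuous.intervalIntegrable (by fun_prop) _ _) (invlog_ii ha (by linarith))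
  intro u hu
  have hu1 : 1 < u := by linarith [hu.1]
  have hlu : 0 < Real.log u := Real.log_pos hu1
  have h3 : Real.log u ≤ l + (u - c) / c := by
    have := Real.log_le_sub_one_of_pos (show 0 < u / c by positivity)
    rw [Real.log_div (by linarith) (by linarith)] at this
    have e : (u - c) / c = u / c - 1 := by field_simp
    rw [e]; linarith
  set w := (u - c) / c
  have e : 1 / l - (u - c) * (1 / (c * l ^ 2)) = (l - w) / l ^ 2 := by
    simp only [w]; field_simp
  rw [e, div_le_div_iff₀ (by positivity) hlu]
  rcases le_or_gt (l - w) 0 with h | h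
  · nlinarith [mul_nonneg (sub_nonneg.mpr h) hlu.le]
  · nlinarith [mul_le_mul_of_nonneg_left h3 h.le, sq_nonneg w]

lemma li_add {a b : ℝ} (ha : 2 ≤ a) (hb : a ≤ b) : li b = li a + ∫ u in a..b, 1 / Real.log u := by
  rw [li_eq ha, li_eq (ha.trans hb), add_assoc,
    intervalIntegral.integral_add_adjacent_intervals (invlog_ii (by norm_num) (by linarith)) (invlog_ii (by linarith) (by linarith))]

lemma li_mono {a b : ℝ} (ha : 2 ≤ a) (hb : a ≤ b) : li a ≤ li b := by
  rw [li_add ha hb]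
  have := intervalIntegral.integral_nonneg (μ := volume) (f := fun u => 1 / Real.log u) hb (fun u hu => by
    have := Real.log_pos (show 1 < u by linarith [hu.1])
    positivity)
  linarith

lemma li_two : 1 ≤ li 2 := by
  rw [li_eq le_rfl]; simpa using L0_ge

lemma num_logs : Real.log ((2 + 3) / 2) ≤ 0.9168 ∧ Real.log ((3 + 4) / 2) ≤ 1.2564 ∧ Real.log ((4 + 6) / 2) ≤ 1.61 ∧
   Real.log ((6 + 8) / 2) ≤ 1.95 ∧ Real.log ((8 + 10) / 2) ≤ 2.2 := by
  have l1 := Real.log_two_lt_d9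
  have l2 := Real.log_two_gt_d9
  have h5 := log_le_of 5 31 72 (by norm_num) (by norm_num)
  have h7 := log_le_of 7 16 45 (by norm_num) (by norm_num)
  have h9 := log_le_of 9 29 92 (by norm_num) (by norm_num)
  have e1 : Real.log ((2 + 3) / 2) = Real.log 5 - Real.log 2 := by rw [← Real.log_div (by norm_num) (by norm_num)]; norm_num
  have e2 : Real.log ((3 + 4) / 2) = Real.log 7 - Real.log 2 := by rw [← Real.log_div (by norm_num) (by norm_num)]; norm_num
  have e3 : Real.log ((4 + 6) / 2) = Real.log 5 := by norm_num
  have e4 : Real.log ((6 + 8) / 2) = Real.log 7 := by norm_num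
  have e5 : Real.log ((8 + 10) / 2) = Real.log 9 := by norm_num
  rw [e1, e2, e3, e4, e5]
  push_cast at h5 h7 h9
  refine ⟨?_, ?_, ?_, ?_, ?_⟩ <;> linarith

lemma li_nums : 2.09 ≤ li 3 ∧ 3.4 ≤ li 5 ∧ 4.6 ≤ li 7 ∧ 6.06 ≤ li 10 := by
  obtain ⟨n1, n2, n3, n4, n5⟩ := num_logs
  have s1 := seg (a := 2) (b := 3) (by norm_num) (by norm_num) n1
  have s2 := seg (a := 3) (b := 4) (by norm_num) (by norm_num) n2
  have s3 := seg (a := 4) (b := 6) (by norm_num) (by norm_num) n3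
  have s4 := seg (a := 6) (b := 8) (by norm_num) (by norm_num) n4
  have s5 := seg (a := 8) (b := 10) (by norm_num) (by norm_num) n5
  have t3 := seg (a := 4) (b := 5) (m := 1.61) (by norm_num) (by norm_num) (le_trans (Real.log_le_log (by norm_num) (by norm_num)) n3)
  have t4 := seg (a := 6) (b := 7) (m := 1.95) (by norm_num) (by norm_num) (le_trans (Real.log_le_log (by norm_num) (by norm_num)) n4)
  have a0 := li_two
  have a1 := li_add (a := 2) (b := 3) (by norm_num) (by norm_num)
  have a2 := li_add (a := 3) (b := 4) (by norm_num) (by norm_num)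
  have a3 := li_add (a := 4) (b := 6) (by norm_num) (by norm_num)
  have a4 := li_add (a := 6) (b := 8) (by norm_num) (by norm_num)
  have a5 := li_add (a := 8) (b := 10) (by norm_num) (by norm_num)
  have b3 := li_add (a := 4) (b := 5) (by norm_num) (by norm_num)
  have b4 := li_add (a := 6) (b := 7) (by norm_num) (by norm_num)
  norm_num at s1 s2 s3 s4 s5 t3 t4 a1 a2 a3 a4 a5 b3 b4 ⊢
  refine ⟨?_, ?_, ?_, ?_⟩ <;> linarith

lemma pi_mid {n N : ℕ} (h : Nat.primeCounting n = N) {t : ℝ} (ht : t < n + 1) : primePi t ≤ N := by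
  unfold primePi
  rw [← h]
  have : ⌊t⌋₊ < n + 1 := Nat.floor_lt' (by omega) |>.mpr (by exact_mod_cast ht)
  exact_mod_cast Nat.monotone_primeCounting (Nat.lt_succ_iff.mp this)

lemma pi_lt_li {t : ℝ} (h2 : 2 < t) (h10 : t ≤ 10) : primePi t < li t := by
  obtain ⟨n1, n2, n3, n4⟩ := li_nums
  rcases lt_or_ge t 3 with h | h3
  · have := pi_mid (n := 2) (N := 1) (by norm_num [Nat.primeCounting, Nat.primeCounting', Nat.count_succ]) (by norm_num; linarith : t < _)
    have h1 := li_add le_rfl h2.le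
    have := intervalIntegral.intervalIntegral_pos_of_pos_on (f := fun u => 1 / Real.log u) (invlog_ii (a := 2) (b := t) (by norm_num) (by linarith))
      (fun u hu => by
        have := Real.log_pos (show 1 < u by linarith [hu.1])
        positivity) h2
    have := li_two
    push_cast at *
    linarith
  rcases lt_or_ge t 5 with h | h5
  · have := pi_mid (n := 4) (N := 2) (by norm_num [Nat.primeCounting, Nat.primeCounting', Nat.count_succ]) (by norm_num; linarith : t < _)
    have h1 := li_mono (by norm_num) h3
    push_cast at *
    linarith
  rcases lt_or_ge t 7 with h | h7
  · have := pi_mid (n := 6) (N := 3) (by norm_num [Nat.primeCounting, Nat.primeCounting', Nat.count_succ]) (by norm_num; linarith : t < _)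
    have h1 := li_mono (by norm_num) h5
    push_cast at *
    linarith
  · have := pi_mid (n := 10) (N := 4) (by norm_num [Nat.primeCounting, Nat.primeCounting', Nat.count_succ]) (by norm_num; linarith : t < _)
    have h1 := li_mono (by norm_num) h7
    push_cast at *
    linarith

lemma A_small {x : ℝ} (h2 : 2 < x) (h10 : x ≤ 10) : ∫ t in (2:ℝ)..x, (primePi t - li t) < 0 := by
  have := intervalIntegral.intervalIntegral_pos_of_pos_on (f := fun t => -(primePi t - li t)) (a := 2) (b := x)
    ((pi_ii _ _).sub (li_ii (by norm_num) h2.le)).neg (fun u hu => by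
      have := pi_lt_li hu.1 (hu.2.le.trans h10)
      linarith) h2
  rw [intervalIntegral.integral_neg] at this
  linarith

lemma W {x : ℝ} (hx : 10 ≤ x) (hT : ∀ t, 10 ≤ t → ∫ t in (10:ℝ)..t, (θ t - t) ≤ 0) {g g' : ℝ → ℝ}
    (hg : ∀ x, 10 ≤ x → HasDerivAt g (g' x) x) (hg' : ∀ x, 10 ≤ x → ContinuousAt g' x)
    (h0 : ∀ x, 10 ≤ x → 0 ≤ g x) (h0' : ∀ x, 10 ≤ x → g' x ≤ 0) :
    ∫ t in (10:ℝ)..x, (θ t - t) * g t ≤ 0 := by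
  rw [ibp hx ((theta_ii _ _).sub intervalIntegral.intervalIntegrable_id) ?_ (fun t ht => hg t ht.1) (fun t ht => (hg' t ht.1).continuousWithinAt)]
  · have h1 := mul_nonpos_of_nonpos_of_nonneg (hT x hx) (h0 x hx)
    have h2 := intervalIntegral.integral_nonneg (μ := volume) (f := fun t => (∫ u in (10:ℝ)..t, (θ u - u)) * g' t) hx
      (fun t ht => mul_nonneg_of_nonpos_of_nonpos (hT t ht.1) (h0' t ht.1))
    linarith
  · intro t ht
    exact (theta_rc (by linarith [ht.1])).sub continuousWithinAt_id

lemma d1 {t : ℝ} (ht : 10 ≤ t) : HasDerivAt (fun t => 1 / Real.log t) (-(1 / (t * Real.log t ^ 2))) t := by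
  have hl : 0 < Real.log t := Real.log_pos (by linarith)
  have := (Real.hasDerivAt_log (show t ≠ 0 by linarith)).inv hl.ne'
  simp only [one_div]
  refine this.congr_deriv ?_
  generalize Real.log t = l at *
  field_simp

lemma d2 {t : ℝ} (ht : 10 ≤ t) : HasDerivAt (fun t => 1 / (t * Real.log t ^ 2)) (-((Real.log t ^ 2 + 2 * Real.log t) / (t * Real.log t ^ 2) ^ 2)) t := by
  have hl : 0 < Real.log t := Real.log_pos (by linarith)
  have ht0 : t ≠ 0 := by linarith
  have h1 := (hasDerivAt_id t).fun_mul ((Real.hasDerivAt_log ht0).fun_pow 2)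
  have := h1.inv (by simp only [id]; positivity)
  simp only [one_div]
  refine this.congr_deriv ?_
  simp only [id]
  generalize Real.log t = l at *
  field_simp
  push_cast
  ring

lemma d3 {t : ℝ} (ht : 10 ≤ t) : HasDerivAt (fun t => t / Real.log t) (1 / Real.log t - 1 / Real.log t ^ 2) t := by
  have hl : 0 < Real.log t := Real.log_pos (by linarith)
  have ht0 : t ≠ 0 := by linarith
  have := (hasDerivAt_id t).div (Real.hasDerivAt_log ht0) hl.ne'
  refine this.congr_deriv ?_
  simp only [id]
  generalize Real.log t = l at *
  field_simp

lemma lg_ca {t : ℝ} (ht : 10 ≤ t) : ContinuousAt (fun t => 1 / (t * Real.log t ^ 2)) t := (d2 ht).continuousAt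

lemma lg_ii {t : ℝ} (ht : 10 ≤ t) : IntervalIntegrable (fun t => (θ t - t) * (1 / (t * Real.log t ^ 2))) volume 10 t := by
  apply IntervalIntegrable.mul_continuousOn ((theta_ii _ _).sub intervalIntegral.intervalIntegrable_id)
  rw [uIcc_of_le ht]
  exact fun u hu => (lg_ca hu.1).continuousWithinAt

lemma pili {t : ℝ} (ht : 10 ≤ t) : primePi t - li t = (4 - li 10 + (10 - Real.log 210) / Real.log 10) +
    (θ t - t) * (1 / Real.log t) + ∫ u in (10:ℝ)..t, (θ u - u) * (1 / (u * Real.log u ^ 2)) := by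
  have p1 := Chebyshev.primeCounting_eq_theta_div_log_add_integral (x := t) (by linarith)
  have p2 := Chebyshev.primeCounting_eq_theta_div_log_add_integral (x := 10) (by norm_num)
  have p3 : Nat.primeCounting ⌊(10:ℝ)⌋₊ = 4 := by
    rw [show (10:ℝ) = (10:ℕ) by norm_num, Nat.floor_natCast]; norm_num [Nat.primeCounting, Nat.primeCounting', Nat.count_succ]
  have p4 : θ 10 = Real.log 210 := by
    have := theta_nat_eq 10 210 (by norm_num [primorial, Finset.prod_filter, Finset.prod_range_succ])
    exact_mod_cast this
  have ct : ∀ {a b : ℝ}, 1 < a → 1 < b → IntervalIntegrable (fun u => θ u / (u * Real.log u ^ 2)) volume a b := by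
    intro a b ha hb
    simp only [div_eq_mul_inv]
    apply (theta_ii a b).mul_continuousOn
    intro u hu
    have : 1 < u := lt_of_lt_of_le (lt_min ha hb) hu.1
    have hl : 0 < Real.log u := Real.log_pos this
    have h0 : u ≠ 0 := by linarith
    have h1 : u * Real.log u ^ 2 ≠ 0 := by positivity
    exact ContinuousAt.continuousWithinAt (by fun_prop (disch := assumption))
  have p5 := intervalIntegral.integral_add_adjacent_intervals (ct (a := 2) (b := 10) (by norm_num) (by norm_num)) (ct (a := 10) (b := t) (by norm_num) (by linarith))
  have p6 := li_add (a := 10) (by norm_num) ht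
  have hc : ∀ u ∈ Icc 10 t, ContinuousAt (fun u => 1 / Real.log u ^ 2) u := by
    intro u hu
    have hl : 0 < Real.log u := Real.log_pos (by linarith [hu.1])
    have h0 : u ≠ 0 := by linarith [hu.1]
    have h1 : Real.log u ^ 2 ≠ 0 := by positivity
    fun_prop (disch := assumption)
  have i2 : IntervalIntegrable (fun u => 1 / Real.log u ^ 2) volume 10 t := by
    apply ContinuousOn.intervalIntegrable; rw [uIcc_of_le ht]; exact fun u hu => (hc u hu).continuousWithinAt
  have i1 := invlog_ii (a := 10) (b := t) (by norm_num) (by linarith)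
  have p7 := intervalIntegral.integral_eq_sub_of_hasDerivAt (a := 10) (b := t) (fun u hu => d3 (by rw [uIcc_of_le ht] at hu; exact hu.1))
    (i1.sub i2)
  rw [intervalIntegral.integral_sub i1 i2] at p7
  have p8 : ∫ u in (10:ℝ)..t, (θ u - u) * (1 / (u * Real.log u ^ 2)) =
     (∫ u in (10:ℝ)..t, θ u / (u * Real.log u ^ 2)) - ∫ u in (10:ℝ)..t, 1 / Real.log u ^ 2 := by
    rw [← intervalIntegral.integral_sub (ct (by norm_num) (by linarith)) i2]
    apply intervalIntegral.integral_congr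
    intro u hu
    rw [uIcc_of_le ht] at hu
    have h0 : u ≠ 0 := by linarith [hu.1]
    have hl : 0 < Real.log u := Real.log_pos (by linarith [hu.1])
    simp only
    generalize Real.log u = l at *
    field_simp
  rw [p3, p4] at p2
  rw [p8]
  unfold primePi
  push_cast at p2
  rw [p1]
  have e1 : (10 - Real.log 210) / Real.log 10 = 10 / Real.log 10 - Real.log 210 / Real.log 10 := sub_div _ _ _
  have e2 : (θ t - t) * (1 / Real.log t) = θ t / Real.log t - t / Real.log t := by ring
  rw [e1, e2]
  linarith

lemma Cneg : 4 - li 10 + (10 - Real.log 210) / Real.log 10 < 0 := by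
  have l2 := Real.log_two_gt_d9
  obtain ⟨_, _, _, n4⟩ := li_nums
  have h1 := log_ge_of 210 10 77 (by norm_num) (by norm_num)
  have h2 := log_ge_of 10 28 93 (by norm_num) (by norm_num)
  push_cast at h1 h2
  have h3 : (10 - Real.log 210) / Real.log 10 ≤ 2.05 := by
    rw [div_le_iff₀ (by linarith)]
    linarith
  linarith

theorem forward (hZ : ∀ s : ℂ, 1 / 2 < s.re → riemannZeta₁ s ≠ 0) {x : ℝ} (hx : 2 < x) :
    ∫ t in (2:ℝ)..x, (primePi t - li t) < 0 := by
  rcases le_or_gt x 10 with h | h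
  · exact A_small hx h
  have hT : ∀ t, 10 ≤ t → ∫ t in (10:ℝ)..t, (θ t - t) ≤ 0 := fun t ht => T_nonpos hZ ht
  have w1 := W h.le hT (g := fun t => 1 / Real.log t) (fun t ht => d1 ht) (fun t ht => (lg_ca ht).neg)
    (fun t ht => by have := Real.log_pos (show 1 < t by linarith); positivity)
    (fun t ht => by have := Real.log_pos (show 1 < t by linarith); simp only [Left.neg_nonpos_iff]; positivity)
  have w2 : ∀ t, 10 ≤ t → ∫ u in (10:ℝ)..t, (θ u - u) * (1 / (u * Real.log u ^ 2)) ≤ 0 := fun t ht =>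
    W ht hT (fun t ht => d2 ht) (fun t ht => by
      have hl : 0 < Real.log t := Real.log_pos (by linarith)
      have h0 : t ≠ 0 := by linarith
      have h1 : (t * Real.log t ^ 2) ^ 2 ≠ 0 := by positivity
      fun_prop (disch := assumption))
    (fun t ht => by have := Real.log_pos (show 1 < t by linarith); positivity)
    (fun t ht => by have := Real.log_pos (show 1 < t by linarith); simp only [Left.neg_nonpos_iff]; positivity)
  have i0 : ∀ {a b : ℝ}, 2 ≤ a → 2 ≤ b → IntervalIntegrable (fun t => primePi t - li t) volume a b :=
    fun ha hb => (pi_ii _ _).sub (li_ii ha hb)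
  rw [← intervalIntegral.integral_add_adjacent_intervals (i0 (a := 2) (b := 10) (by norm_num) (by norm_num)) (i0 (by norm_num) hx.le)]
  have a1 := A_small (x := 10) (by norm_num) le_rfl
  have i1 : IntervalIntegrable (fun t => (θ t - t) * (1 / Real.log t)) volume 10 x := by
    apply IntervalIntegrable.mul_continuousOn ((theta_ii _ _).sub intervalIntegral.intervalIntegrable_id)
    rw [uIcc_of_le h.le]
    exact fun u hu => (d1 hu.1).continuousAt.continuousWithinAt
  have a2 : ∫ t in (10:ℝ)..x, (primePi t - li t) ≤ ∫ t in (10:ℝ)..x, ((4 - li 10 + (10 - Real.log 210) / Real.log 10) + (θ t - t) * (1 / Real.log t)) := by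
    apply intervalIntegral.integral_mono_on h.le (i0 (by norm_num) hx.le) (intervalIntegrable_const.add i1)
    intro t ht
    rw [pili ht.1]
    linarith [w2 t ht.1]
  rw [intervalIntegral.integral_add intervalIntegrable_const i1, intervalIntegral.integral_const, smul_eq_mul] at a2
  have := mul_neg_of_pos_of_neg (sub_pos.mpr h) Cneg
  linarith
end fwd
end RHPi

namespace RHPi
section landau
open Set Topology ProbabilityTheory

theorem landau_step {Ω : Type} [MeasurableSpace Ω] {μ : Measure Ω} {X : Ω → ℝ} (hX : AEMeasurable X μ)
    (hX0 : ∀ᵐ ω ∂μ, 0 ≤ X ω) {c R : ℝ} (hR : 0 < R) (hS : Iio c ⊆ integrableExpSet X μ) {H : ℂ → ℂ}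
    (hH : DifferentiableOn ℂ H (Metric.ball (c:ℂ) R))
    (hM : ∀ z ∈ Metric.ball (c:ℂ) R, z.re < c → H z = complexMGF X μ z) :
    c + R / 4 ∈ integrableExpSet X μ := by
  set b : ℝ := c - R / 4 with hb
  have hbi : b ∈ interior (integrableExpSet X μ) :=
    mem_interior.mpr ⟨Iio c, hS, isOpen_Iio, by rw [hb, mem_Iio]; linarith⟩
  have hbc : (b:ℂ) ∈ Metric.ball (c:ℂ) R := by
    rw [Metric.mem_ball, Complex.dist_eq, ← Complex.ofReal_sub, Complex.norm_real, Real.norm_eq_abs, hb, abs_lt]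
    constructor <;> linarith
  have hHM : H =ᶠ[𝓝 (b:ℂ)] complexMGF X μ := by
    have h1 : Metric.ball (c:ℂ) R ∈ 𝓝 (b:ℂ) := Metric.isOpen_ball.mem_nhds hbc
    have h2 : {z : ℂ | z.re < c} ∈ 𝓝 (b:ℂ) :=
      (isOpen_lt Complex.continuous_re continuous_const).mem_nhds (by simp [hb]; linarith)
    filter_upwards [h1, h2] with z hz1 hz2 using hM z hz1 hz2
  have hsub : Metric.ball (b:ℂ) (3 * R / 4) ⊆ Metric.ball (c:ℂ) R := by
    apply Metric.ball_subset_ball'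
    rw [Complex.dist_eq, ← Complex.ofReal_sub, Complex.norm_real, Real.norm_eq_abs, hb,
      abs_of_nonpos (by linarith)]
    linarith
  have hz : (b:ℂ) + (R / 2 : ℝ) ∈ Metric.ball (b:ℂ) (3 * R / 4) := by
    rw [Metric.mem_ball, Complex.dist_eq, add_sub_cancel_left, Complex.norm_real, Real.norm_eq_abs, abs_of_pos (by linarith)]
    linarith
  have hT := (Complex.hasSum_taylorSeries_on_ball (hH.mono hsub) hz).summable
  set a : ℕ → Ω → ℝ := fun n ω => (R / 2 * X ω) ^ n / n.factorial * Real.exp (b * X ω) with ha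
  have hai : ∀ n, Integrable (a n) μ := fun n => by
    have := (integrable_pow_mul_exp_of_mem_interior_integrableExpSet hbi n).const_mul ((R / 2) ^ n / n.factorial)
    refine this.congr (ae_of_all _ fun ω => ?_)
    simp only [ha]; ring
  have hintg : ∀ n : ℕ, (n.factorial : ℂ)⁻¹ • ((b:ℂ) + (R / 2 : ℝ) - b) ^ n • iteratedDeriv n H b = ((∫ ω, a n ω ∂μ : ℝ) : ℂ) := by
    intro n
    rw [hHM.iteratedDeriv_eq, iteratedDeriv_complexMGF (by simpa using hbi), ← integral_complex_ofReal,
      add_sub_cancel_left, smul_eq_mul, smul_eq_mul, ← integral_const_mul, ← integral_const_mul]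
    congr 1
    ext ω
    simp only [ha]
    push_cast
    ring
  simp only [hintg] at hT
  have hsum : Summable fun n => ∫ ω, a n ω ∂μ := by exact_mod_cast hT
  have han : ∀ᵐ ω ∂μ, ∀ n, 0 ≤ a n ω := by
    filter_upwards [hX0] with ω hω n
    simp only [ha]; positivity
  have hlt : ∫⁻ ω, ∑' n, ENNReal.ofReal (a n ω) ∂μ < ⊤ := by
    rw [lintegral_tsum fun n => (hai n).aestronglyMeasurable.aemeasurable.ennreal_ofReal]
    have : ∀ n, ∫⁻ ω, ENNReal.ofReal (a n ω) ∂μ = ENNReal.ofReal (∫ ω, a n ω ∂μ) := fun n =>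
      (ofReal_integral_eq_lintegral_ofReal (hai n) (han.mono fun ω h => h n)).symm
    simp only [this]
    rw [← ENNReal.ofReal_tsum_of_nonneg (fun n => integral_nonneg_of_ae (han.mono fun ω h => h n)) hsum]
    exact ENNReal.ofReal_lt_top
  have heq : ∀ᵐ ω ∂μ, ENNReal.ofReal (Real.exp ((c + R / 4) * X ω)) = ∑' n, ENNReal.ofReal (a n ω) := by
    filter_upwards [han] with ω hω
    have h1 : HasSum (fun n => a n ω) (Real.exp (R / 2 * X ω) * Real.exp (b * X ω)) := by
      have := NormedSpace.expSeries_div_hasSum_exp (𝔸 := ℝ) (R / 2 * X ω)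
      rw [← Real.exp_eq_exp_ℝ] at this
      exact this.mul_right _
    rw [← ENNReal.ofReal_tsum_of_nonneg hω h1.summable, h1.tsum_eq, ← Real.exp_add]
    congr 2
    rw [hb]; ring
  rw [← lintegral_congr_ae heq] at hlt
  refine ⟨?_, ?_⟩
  · exact (Real.measurable_exp.comp_aemeasurable (hX.const_mul _)).aestronglyMeasurable
  · rw [hasFiniteIntegral_iff_ofReal (ae_of_all _ fun _ => (Real.exp_pos _).le)]
    exact hlt

theorem landau {Ω : Type} [MeasurableSpace Ω] {μ : Measure Ω} {X : Ω → ℝ} (hX : AEMeasurable X μ)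
    (hX0 : ∀ᵐ ω ∂μ, 0 ≤ X ω) {T0 T : ℝ} (hS0 : Iio T0 ⊆ integrableExpSet X μ)
    (hstep : ∀ c, T0 ≤ c → c < T → Iio c ⊆ integrableExpSet X μ → ∃ R > 0, ∃ H : ℂ → ℂ,
      DifferentiableOn ℂ H (Metric.ball (c:ℂ) R) ∧ ∀ z ∈ Metric.ball (c:ℂ) R, z.re < c → H z = complexMGF X μ z) :
    Iio T ⊆ integrableExpSet X μ := by
  have hdown : ∀ t ∈ integrableExpSet X μ, ∀ t' ≤ t, t' ∈ integrableExpSet X μ := by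
    intro t ht t' htt
    refine Integrable.mono ht (Real.measurable_exp.comp_aemeasurable (hX.const_mul _)).aestronglyMeasurable ?_
    filter_upwards [hX0] with ω hω
    rw [Real.norm_of_nonneg (Real.exp_pos _).le, Real.norm_of_nonneg (Real.exp_pos _).le]
    gcongr
  intro t1 ht1
  by_contra hn
  have hub : ∀ t ∈ integrableExpSet X μ, t ≤ t1 := by
    intro t ht
    by_contra h
    exact hn (hdown t ht t1 (not_le.mp h).le)
  have hne : (integrableExpSet X μ).Nonempty := ⟨T0 - 1, hS0 (by simp)⟩
  have hbd : BddAbove (integrableExpSet X μ) := ⟨t1, hub⟩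
  set c := sSup (integrableExpSet X μ)
  have hc1 : c ≤ t1 := csSup_le hne hub
  have hc0 : T0 ≤ c := by
    by_contra h
    push Not at h
    obtain ⟨y, hy1, hy2⟩ := exists_between h
    exact absurd (le_csSup hbd (hS0 hy2)) (not_le.mpr hy1)
  have hcS : Iio c ⊆ integrableExpSet X μ := by
    intro t ht
    obtain ⟨y, hy, hty⟩ := exists_lt_of_lt_csSup hne ht
    exact hdown y hy t hty.le
  obtain ⟨R, hR, H, h1, h2⟩ := hstep c hc0 (hc1.trans_lt ht1) hcS
  have := le_csSup hbd (landau_step hX hX0 hR hcS h1 h2)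
  linarith
end landau
end RHPi

namespace RHPi
section closing
open Set Topology ProbabilityTheory

lemma hp_open (σ : ℝ) : IsOpen {s : ℂ | σ < s.re} := isOpen_lt continuous_const Complex.continuous_re

lemma F_diff {Ω : Type} [MeasurableSpace Ω] {μ : Measure Ω} {X : Ω → ℝ} {σ : ℝ}
    (hS : Iio (-σ) ⊆ integrableExpSet X μ) {s : ℂ} (hs : σ < s.re) :
    DifferentiableAt ℂ (fun s => s * (s + 1) * complexMGF X μ (-s)) s := by
  have h1 : (-s).re ∈ interior (integrableExpSet X μ) :=
    mem_interior.mpr ⟨Iio (-σ), hS, isOpen_Iio, by simpa using hs⟩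
  have h2 : DifferentiableAt ℂ (fun s => complexMGF X μ (-s)) s :=
    DifferentiableAt.comp (g := complexMGF X μ) s (hasDerivAt_complexMGF h1).differentiableAt (by fun_prop)
  exact DifferentiableAt.mul (by fun_prop) h2

lemma ext_id {Ω : Type} [MeasurableSpace Ω] {μ : Measure Ω} {X : Ω → ℝ} {q : ℂ → ℂ}
    (hq : DifferentiableOn ℂ q {s : ℂ | 1 / 2 < s.re})
    (hK : ∀ s : ℂ, 1 < s.re → HasDerivAt (fun s => s * (s + 1) * complexMGF X μ (-s))
      (- logDeriv riemannZeta₁ s - q s) s) {σ : ℝ} (hσ : 1 / 2 ≤ σ)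
    (hS : Iio (-σ) ⊆ integrableExpSet X μ) {s : ℂ} (hs : σ < s.re) :
    deriv (fun s => s * (s + 1) * complexMGF X μ (-s)) s * riemannZeta₁ s
      = - deriv riemannZeta₁ s - q s * riemannZeta₁ s := by
  have hd : DifferentiableOn ℂ (fun s => s * (s + 1) * complexMGF X μ (-s)) {s : ℂ | σ < s.re} :=
    fun s hs => (F_diff hS hs).differentiableWithinAt
  have hZ := differentiable_riemannZeta₁
  have hq' : DifferentiableOn ℂ q {s : ℂ | σ < s.re} := hq.mono fun s (hs : σ < s.re) => by
    show 1 / 2 < s.re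
    linarith
  have hA : AnalyticOnNhd ℂ (fun s => deriv (fun s => s * (s + 1) * complexMGF X μ (-s)) s * riemannZeta₁ s) {s : ℂ | σ < s.re} :=
    DifferentiableOn.analyticOnNhd ((hd.deriv (hp_open σ)).mul hZ.differentiableOn) (hp_open σ)
  have hB : AnalyticOnNhd ℂ (fun s => - deriv riemannZeta₁ s - q s * riemannZeta₁ s) {s : ℂ | σ < s.re} :=
    DifferentiableOn.analyticOnNhd ((hZ.deriv.neg.differentiableOn).sub (hq'.mul hZ.differentiableOn)) (hp_open σ)
  have hpc : IsPreconnected {s : ℂ | σ < s.re} := (convex_halfSpace_re_gt σ).isPreconnected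
  have h0 : ((σ + 2 : ℝ) : ℂ) ∈ {s : ℂ | σ < s.re} := by
    show σ < ((σ + 2 : ℝ) : ℂ).re
    rw [Complex.ofReal_re]; linarith
  refine AnalyticOnNhd.eqOn_of_preconnected_of_eventuallyEq hA hB hpc h0 ?_ hs
  filter_upwards [(hp_open 1).mem_nhds (show ((σ + 2 : ℝ) : ℂ) ∈ {s : ℂ | 1 < s.re} by
    show 1 < ((σ + 2 : ℝ) : ℂ).re
    rw [Complex.ofReal_re]; linarith)] with w hw
  have hw' : 1 < w.re := hw
  have hne := zeta1_ne_zero_of_one_le (s := w) hw'.le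
  rw [(hK w hw').deriv, logDeriv_apply]
  field_simp

theorem closing {Ω : Type} [MeasurableSpace Ω] {μ : Measure Ω} {X : Ω → ℝ} {q : ℂ → ℂ}
    (hX : AEMeasurable X μ) (hX0 : ∀ᵐ ω ∂μ, 0 ≤ X ω)
    (hS0 : Iio (-1) ⊆ integrableExpSet X μ)
    (hq : DifferentiableOn ℂ q {s : ℂ | 1 / 2 < s.re})
    (hK : ∀ s : ℂ, 1 < s.re → HasDerivAt (fun s => s * (s + 1) * complexMGF X μ (-s))
      (- logDeriv riemannZeta₁ s - q s) s) :
    ∀ s : ℂ, 1 / 2 < s.re → riemannZeta₁ s ≠ 0 := by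
  have hZ := differentiable_riemannZeta₁
  have hS : Iio (-(1/2):ℝ) ⊆ integrableExpSet X μ := by
    refine landau hX hX0 hS0 ?_
    intro c hc1 hc2 hS
    obtain ⟨σ, rfl⟩ : ∃ σ, c = -σ := ⟨-c, by simp⟩
    have hσ : 1 / 2 < σ := by linarith
    have hopen : IsOpen ({s : ℂ | 1 / 2 < s.re} ∩ {s | riemannZeta₁ s ≠ 0}) :=
      (hp_open _).inter (isOpen_ne_fun hZ.continuous continuous_const)
    have hmem : (σ:ℂ) ∈ {s : ℂ | 1 / 2 < s.re} ∩ {s | riemannZeta₁ s ≠ 0} :=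
      ⟨by show 1 / 2 < (σ:ℂ).re
          rwa [Complex.ofReal_re], zeta1_real_ne_zero (by linarith)⟩
    obtain ⟨R, hR, hball⟩ := Metric.isOpen_iff.1 hopen _ hmem
    have hKd : DifferentiableOn ℂ (fun s => - logDeriv riemannZeta₁ s - q s) (Metric.ball (σ:ℂ) R) := by
      intro s hs
      have hs1 : 1 / 2 < s.re := (hball hs).1
      have hd1 : DifferentiableAt ℂ (logDeriv riemannZeta₁) s :=
        (hZ.deriv s).div (hZ s) (hball hs).2
      exact (hd1.neg.sub (hq.differentiableAt ((hp_open _).mem_nhds hs1))).differentiableWithinAt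
    obtain ⟨P, hP⟩ := hKd.isExactOn_ball
    set F : ℂ → ℂ := fun s => s * (s + 1) * complexMGF X μ (-s) with hF
    have hder : ∀ s ∈ Metric.ball (σ:ℂ) R ∩ {s : ℂ | σ < s.re}, HasDerivAt (fun s => F s - P s) 0 s := by
      rintro s ⟨hs1, hs2⟩
      have h1 := (F_diff hS hs2).hasDerivAt
      have h2 := ext_id hq hK hσ.le hS hs2
      refine (h1.fun_sub (hP s hs1)).congr_deriv ?_
      have hne : riemannZeta₁ s ≠ 0 := (hball hs1).2
      beta_reduce
      rw [logDeriv_apply]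
      apply mul_right_cancel₀ hne
      rw [sub_mul, h2]
      field_simp
      ring
    obtain ⟨k, hk⟩ := (Metric.isOpen_ball.inter (hp_open σ)).exists_is_const_of_deriv_eq_zero (𝕜 := ℂ)
      ((convex_ball (σ:ℂ) R).inter (convex_halfSpace_re_gt σ)).isPreconnected
      (fun s hs => (hder s hs).differentiableAt.differentiableWithinAt)
      (fun s hs => (hder s hs).deriv)
    have hneg : ∀ z ∈ Metric.ball (((-σ : ℝ)):ℂ) R, -z ∈ Metric.ball (σ:ℂ) R := by
      intro z hz
      rw [Metric.mem_ball, Complex.dist_eq] at hz ⊢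
      rw [← norm_neg]
      convert! hz using 2
      push_cast; ring
    have hnz : ∀ s : ℂ, 1 / 2 < s.re → s * (s + 1) ≠ 0 := by
      intro s hs h
      rcases mul_eq_zero.1 h with h | h
      · rw [h] at hs; norm_num at hs
      · have : s = -1 := by linear_combination h
        rw [this] at hs; norm_num at hs
    refine ⟨R, hR, fun z => (P (-z) + k) / (-z * (-z + 1)), ?_, ?_⟩
    · intro z hz
      have h1 : DifferentiableAt ℂ (fun z => P (-z)) z :=
        DifferentiableAt.comp z (hP _ (hneg z hz)).differentiableAt (by fun_prop)
      refine (DifferentiableAt.div (h1.add_const k) (by fun_prop) ?_).differentiableWithinAt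
      exact hnz _ (hball (hneg z hz)).1
    · intro z hz hzc
      have h1 := hk (-z) ⟨hneg z hz, by show σ < (-z).re; rw [Complex.neg_re]; linarith⟩
      have h2 := hnz (-z) (hball (hneg z hz)).1
      simp only [hF, neg_neg] at h1
      rw [div_eq_iff h2]
      linear_combination -h1
  intro s0 hs0 h0
  set F : ℂ → ℂ := fun s => s * (s + 1) * complexMGF X μ (-s) with hF
  have hd : DifferentiableOn ℂ F {s : ℂ | 1/2 < s.re} :=
    fun s hs => (F_diff hS hs).differentiableWithinAt
  -- choose the ball
  obtain ⟨r, hr, hsr⟩ : ∃ r : ℝ, 0 < r ∧ s0 ∈ Metric.ball (((1/2 + r : ℝ)):ℂ) r := by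
    set a := s0.re - 1/2
    have ha : 0 < a := by simp only [a]; linarith
    have hs0e : s0.re = 1/2 + a := by simp only [a]; ring
    refine ⟨(a^2 + s0.im^2) / a, by positivity, ?_⟩
    set r := (a^2 + s0.im^2) / a with hr
    have hr0 : 0 < r := by positivity
    have hra : r * a = a^2 + s0.im^2 := by rw [hr]; field_simp
    rw [Metric.mem_ball, Complex.dist_eq, ← sq_lt_sq₀ (norm_nonneg _) hr0.le, Complex.sq_norm, Complex.normSq_apply]
    simp only [Complex.sub_re, Complex.sub_im, Complex.ofReal_re, Complex.ofReal_im, hs0e]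
    nlinarith [sq_nonneg a, mul_pos hr0 ha]
  have hsub : Metric.ball (((1/2 + r : ℝ)):ℂ) r ⊆ {s : ℂ | 1/2 < s.re} := by
    intro s hs
    rw [Metric.mem_ball, Complex.dist_eq] at hs
    have := (abs_le.1 (Complex.abs_re_le_norm (s - ((1/2 + r : ℝ):ℂ)))).1
    rw [Complex.sub_re, Complex.ofReal_re] at this
    show 1/2 < s.re
    linarith
  obtain ⟨P, hP⟩ := (((hd.deriv (hp_open _)).add hq).mono hsub).isExactOn_ball
  have key : ∀ s ∈ Metric.ball (((1/2 + r : ℝ)):ℂ) r, HasDerivAt (fun s => riemannZeta₁ s * Complex.exp (P s)) 0 s := by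
    intro s hs
    refine ((hZ s).hasDerivAt.fun_mul (hP s hs).cexp).congr_deriv ?_
    have := ext_id hq hK le_rfl hS (hsub hs)
    simp only [Pi.add_apply]
    linear_combination Complex.exp (P s) * this
  obtain ⟨k, hk⟩ := (Metric.isOpen_ball).exists_is_const_of_deriv_eq_zero (𝕜 := ℂ)
      (convex_ball (((1/2 + r : ℝ)):ℂ) r).isPreconnected
      (fun s hs => (key s hs).differentiableAt.differentiableWithinAt)
      (fun s hs => (key s hs).deriv)
  have h1 := hk _ hsr
  have h2 := hk _ (Metric.mem_ball_self hr)
  rw [h0, zero_mul] at h1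
  rw [← h1] at h2
  rcases mul_eq_zero.1 h2 with h | h
  · exact zeta1_real_ne_zero (by positivity) h
  · exact Complex.exp_ne_zero _ h

lemma RH_of_nz (hZ : ∀ s : ℂ, 1 / 2 < s.re → riemannZeta₁ s ≠ 0) : RiemannHypothesis := by
  have hz : ∀ s : ℂ, 1 / 2 < s.re → s ≠ 1 → riemannZeta s ≠ 0 := by
    intro s hs h1 h
    apply hZ s hs
    rw [zeta1_eq_mul h1, h, mul_zero]
  intro s hs htriv h1
  by_contra hne
  rcases lt_or_gt_of_ne hne with h | h
  · have hw1 : (1:ℂ) - s ≠ 1 := by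
      intro h
      have : s = 0 := by linear_combination -h
      rw [this, riemannZeta_zero] at hs
      norm_num at hs
    have hwre : 1 / 2 < (1 - s).re := by
      rw [Complex.sub_re, Complex.one_re]; linarith
    have hwn : ∀ n : ℕ, 1 - s ≠ -(n:ℂ) := by
      intro n hn
      rw [hn, Complex.neg_re, Complex.natCast_re] at hwre
      have : (0:ℝ) ≤ n := n.cast_nonneg
      linarith
    have hfe := riemannZeta_one_sub hwn hw1
    rw [sub_sub_cancel, hs] at hfe
    have hG := Complex.Gamma_ne_zero hwn
    have hzw := hz _ hwre hw1
    have hpi : (2 * (Real.pi:ℂ)) ^ (-(1 - s)) ≠ 0 := by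
      rw [Ne, Complex.cpow_eq_zero_iff]
      rintro ⟨h, -⟩
      simp at h
    have hcos : Complex.cos (Real.pi * (1 - s) / 2) = 0 := by
      by_contra hc
      exact (mul_ne_zero (mul_ne_zero (mul_ne_zero (mul_ne_zero two_ne_zero hpi) hG) hc) hzw) hfe.symm
    rw [Complex.cos_eq_zero_iff] at hcos
    obtain ⟨k, hk⟩ := hcos
    have hpi0 : (Real.pi:ℂ) ≠ 0 := by exact_mod_cast Real.pi_ne_zero
    have hsk : s = -2 * (k:ℂ) := by
      field_simp at hk
      linear_combination -hk
    have hkre : s.re = -2 * (k:ℝ) := by rw [hsk]; simp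
    have hk0 : 0 ≤ k := by
      by_contra hk0
      have h1 : k ≤ -1 := by omega
      have : (k:ℝ) ≤ -1 := by exact_mod_cast h1
      linarith
    lift k to ℕ using hk0
    rcases k with _ | n
    · exact hw1 (by rw [hsk]; simp)
    · exact htriv ⟨n, by rw [hsk]; push_cast; ring⟩
  · exact hz s h h1 hs
end closing
end RHPi

namespace RHPi
section transf
open Set Topology

lemma int_pw {v : ℝ → ℝ} (hm : AEStronglyMeasurable v (volume.restrict (Ioi 2))) {C k : ℝ}
    (hv : ∀ x, 2 ≤ x → |v x| ≤ C * x ^ k) {w : ℂ} (hw : k + w.re < -1) :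
    IntegrableOn (fun x : ℝ => (v x : ℂ) * (x:ℂ) ^ w) (Ioi 2) := by
  have h1 : IntegrableOn (fun x : ℝ => C * x ^ (k + w.re)) (Ioi 2) :=
    (integrableOn_Ioi_rpow_of_lt hw (by norm_num)).const_mul C
  refine Integrable.mono' h1 ?_ ?_
  · refine AEStronglyMeasurable.mul (Complex.continuous_ofReal.comp_aestronglyMeasurable hm) ?_
    refine ContinuousOn.aestronglyMeasurable ?_ measurableSet_Ioi
    intro x hx
    have hx : 2 < x := hx
    apply ContinuousAt.continuousWithinAt
    exact (Complex.continuousAt_ofReal_cpow_const _ _ (Or.inr (by linarith)))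
  · filter_upwards [ae_restrict_mem measurableSet_Ioi] with x hx
    have hx : 2 < x := hx
    have hx0 : 0 < x := by linarith
    rw [norm_mul, Complex.norm_real, Complex.norm_cpow_eq_rpow_re_of_pos hx0, Real.rpow_add hx0, ← mul_assoc]
    exact mul_le_mul_of_nonneg_right (hv x hx.le) (by positivity)

lemma ibp_inf {u u' : ℝ → ℝ} {C C' k : ℝ} {s : ℂ} (hs : k < s.re)
    (hc : ContinuousOn u (Ici 2)) (hd : ∀ x, 2 < x → HasDerivWithinAt u (u' x) (Ioi x) x)
    (hm : AEStronglyMeasurable u' (volume.restrict (Ioi 2)))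
    (hu : ∀ x, 2 ≤ x → |u x| ≤ C * x ^ k) (hu' : ∀ x, 2 ≤ x → |u' x| ≤ C' * x ^ (k - 1)) :
    s * ∫ x in Ioi (2:ℝ), (u x : ℂ) * (x:ℂ) ^ (-s - 1)
      = u 2 * (2:ℂ) ^ (-s) + ∫ x in Ioi (2:ℝ), (u' x : ℂ) * (x:ℂ) ^ (-s) := by
  have hi1 : IntegrableOn (fun x : ℝ => (u x : ℂ) * (x:ℂ) ^ (-s - 1)) (Ioi 2) :=
    int_pw ((hc.mono Ioi_subset_Ici_self).aestronglyMeasurable measurableSet_Ioi) hu (by simp; linarith)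
  have hi2 : IntegrableOn (fun x : ℝ => (u' x : ℂ) * (x:ℂ) ^ (-s)) (Ioi 2) :=
    int_pw hm hu' (by simp; linarith)
  have hi : IntegrableOn (fun x : ℝ => (u' x : ℂ) * (x:ℂ) ^ (-s) - s * ((u x : ℂ) * (x:ℂ) ^ (-s - 1))) (Ioi 2) :=
    hi2.sub (hi1.const_mul s)
  have hintg : ∫ x in Ioi (2:ℝ), ((u' x : ℂ) * (x:ℂ) ^ (-s) - s * ((u x : ℂ) * (x:ℂ) ^ (-s - 1)))
      = 0 - u 2 * (2:ℂ) ^ (-s) := by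
    refine tendsto_nhds_unique (MeasureTheory.intervalIntegral_tendsto_integral_Ioi 2 hi tendsto_id) ?_
    have hfin : ∀ b : ℝ, 2 ≤ b → ∫ x in (2:ℝ)..b, ((u' x : ℂ) * (x:ℂ) ^ (-s) - s * ((u x : ℂ) * (x:ℂ) ^ (-s - 1)))
        = u b * (b:ℂ) ^ (-s) - u 2 * (2:ℂ) ^ (-s) := by
      intro b hb
      have := intervalIntegral.integral_eq_sub_of_hasDeriv_right (a := 2) (b := b)
        (f := fun x : ℝ => (u x : ℂ) * (x:ℂ) ^ (-s))
        (f' := fun x : ℝ => (u' x : ℂ) * (x:ℂ) ^ (-s) - s * ((u x : ℂ) * (x:ℂ) ^ (-s - 1))) ?_ ?_ ?_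
      · simpa using this
      · rw [uIcc_of_le hb]
        refine ContinuousOn.mul (Complex.continuous_ofReal.comp_continuousOn (hc.mono Icc_subset_Ici_self)) ?_
        intro x hx
        exact (Complex.continuousAt_ofReal_cpow_const _ _ (Or.inr (by linarith [hx.1]))).continuousWithinAt
      · intro x hx
        rw [min_eq_left hb, max_eq_right hb] at hx
        have h1 := (hd x hx.1).ofReal_comp
        have hx0 : x ≠ 0 := by linarith [hx.1]
        have h2 : HasDerivAt (fun x : ℝ => (x:ℂ) ^ (-s)) (-s * (x:ℂ) ^ (-s - 1)) x := by
          rcases eq_or_ne s 0 with h | h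
          · subst h
            simpa using hasDerivAt_const x (1:ℂ)
          · exact hasDerivAt_ofReal_cpow_const hx0 (neg_ne_zero.2 h)
        refine (h1.mul h2.hasDerivWithinAt).congr_deriv ?_
        ring
      · rw [intervalIntegrable_iff_integrableOn_Ioc_of_le hb]
        exact hi.mono_set Ioc_subset_Ioi_self
    have hlim : Tendsto (fun b : ℝ => (u b:ℂ) * (b:ℂ) ^ (-s)) atTop (𝓝 0) := by
      rw [tendsto_zero_iff_norm_tendsto_zero]
      have h0 : Tendsto (fun b : ℝ => C * b ^ (-(s.re - k))) atTop (𝓝 (C * 0)) :=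
        (tendsto_rpow_neg_atTop (by linarith)).const_mul C
      rw [mul_zero] at h0
      refine squeeze_zero' (Eventually.of_forall fun _ => norm_nonneg _) ?_ h0
      filter_upwards [eventually_ge_atTop (2:ℝ)] with b hb
      have hb0 : 0 < b := by linarith
      rw [norm_mul, Complex.norm_real, Complex.norm_cpow_eq_rpow_re_of_pos hb0,
        show -(s.re - k) = k + (-s).re by simp; ring, Real.rpow_add hb0, ← mul_assoc]
      exact mul_le_mul_of_nonneg_right (hu b hb) (by positivity)
    refine (hlim.sub_const _).congr' ?_
    filter_upwards [eventually_ge_atTop (2:ℝ)] with b hb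
    exact (hfin b hb).symm
  rw [integral_sub hi2 (hi1.const_mul s), integral_const_mul] at hintg
  linear_combination -hintg

lemma two_le_log2 : 0 < Real.log 2 := Real.log_pos (by norm_num)

lemma invlog_bd {u : ℝ} (hu : 2 ≤ u) : |1 / Real.log u| ≤ 1 / Real.log 2 := by
  have h1 := Real.log_le_log (by norm_num) hu
  have := two_le_log2
  rw [abs_of_nonneg (one_div_nonneg.2 (by linarith))]
  exact one_div_le_one_div_of_le this h1

lemma li_hd {x : ℝ} (hx : 2 < x) : HasDerivAt li (1 / Real.log x) x := by
  have h1 : HasDerivAt (fun x => L0 + ∫ u in (2:ℝ)..x, 1 / Real.log u) (1 / Real.log x) x := by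
    apply HasDerivAt.const_add
    have hcont : ContinuousAt (fun u => 1 / Real.log u) x := by
      have h := (Real.log_pos (by linarith : 1 < x)).ne'
      exact ContinuousAt.div continuousAt_const (Real.continuousAt_log (by linarith)) h
    refine intervalIntegral.integral_hasDerivAt_right (invlog_ii (by norm_num) (by linarith)) ?_ hcont
    refine StronglyMeasurable.stronglyMeasurableAtFilter ?_
    exact (measurable_const.div Real.measurable_log).stronglyMeasurable
  refine h1.congr_of_eventuallyEq ?_
  filter_upwards [Ioi_mem_nhds hx] with y hy
  exact li_eq (le_of_lt hy)

lemma li_contIci : ContinuousOn li (Ici 2) := by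
  intro x hx
  have hx : 2 ≤ x := hx
  have h := li_cont (x := x + 1) (by linarith) x ⟨hx, by linarith⟩
  refine h.mono_of_mem_nhdsWithin ?_
  filter_upwards [self_mem_nhdsWithin, mem_nhdsWithin_of_mem_nhds (Iio_mem_nhds (by linarith : x < x + 1))] with y h1 h2
  exact ⟨h1, le_of_lt h2⟩

lemma li_bd : ∃ C : ℝ, 0 ≤ C ∧ ∀ x, 2 ≤ x → |li x| ≤ C * x := by
  have h2 := two_le_log2
  refine ⟨|L0| + 1 / Real.log 2, by positivity, fun x hx => ?_⟩
  rw [li_eq hx]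
  have h3 : ‖∫ u in (2:ℝ)..x, 1 / Real.log u‖ ≤ 1 / Real.log 2 * |x - 2| := by
    apply intervalIntegral.norm_integral_le_of_norm_le_const
    intro u hu
    rw [uIoc_of_le hx] at hu
    exact invlog_bd hu.1.le
  rw [abs_of_nonneg (by linarith), Real.norm_eq_abs] at h3
  refine (abs_add_le _ _).trans ?_
  have h4 : 0 ≤ 1 / Real.log 2 := by positivity
  nlinarith [abs_nonneg L0]

/-- indicator of primes -/
noncomputable def pInd (n : ℕ) : ℝ := if n.Prime then 1 else 0

lemma sum_pInd (n : ℕ) : ∑ k ∈ Finset.Icc 1 n, pInd k = (Nat.primeCounting n : ℝ) := by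
  unfold pInd Nat.primeCounting Nat.primeCounting'
  rw [Nat.count_eq_card_filter_range, Finset.sum_boole]
  congr 2
  ext k
  simp only [Finset.mem_filter, Finset.mem_Icc, Finset.mem_range]
  constructor
  · rintro ⟨⟨h1, h2⟩, h3⟩; exact ⟨by omega, h3⟩
  · rintro ⟨h1, h3⟩; exact ⟨⟨h3.one_lt.le, by omega⟩, h3⟩

lemma pc_le (n : ℕ) : (Nat.primeCounting n : ℝ) ≤ n := by
  rw [← sum_pInd]
  calc ∑ k ∈ Finset.Icc 1 n, pInd k ≤ ∑ k ∈ Finset.Icc 1 n, (1:ℝ) := by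
        apply Finset.sum_le_sum; intro k _; unfold pInd; split_ifs <;> norm_num
    _ = n := by simp

lemma pi_bd {x : ℝ} (hx : 0 ≤ x) : |primePi x| ≤ x := by
  unfold primePi
  rw [abs_of_nonneg (Nat.cast_nonneg _)]
  exact (pc_le _).trans (Nat.floor_le hx)

lemma pi_rc {x : ℝ} (hx : 0 ≤ x) : ContinuousWithinAt primePi (Ici x) x :=
  floor_rc (fun n => (Nat.primeCounting n : ℝ)) (fun _ => rfl) hx

/-- minus the integral of `π - li`. -/
noncomputable def fA (x : ℝ) : ℝ := - ∫ t in (2:ℝ)..x, (primePi t - li t)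

lemma pl_ii {x : ℝ} (hx : 2 ≤ x) : IntervalIntegrable (fun t => primePi t - li t) volume 2 x :=
  (pi_ii 2 x).sub (li_ii le_rfl hx)

lemma pi_meas : Measurable primePi := by
  apply Monotone.measurable
  intro x y h
  unfold primePi
  exact_mod_cast Nat.monotone_primeCounting (Nat.floor_mono h)

lemma pl_meas : AEStronglyMeasurable (fun t => li t - primePi t) (volume.restrict (Ioi 2)) :=
  ((li_contIci.mono Ioi_subset_Ici_self).aestronglyMeasurable measurableSet_Ioi).sub
    pi_meas.aestronglyMeasurable

lemma fA_hd {x : ℝ} (hx : 2 < x) : HasDerivWithinAt fA (li x - primePi x) (Ioi x) x := by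
  have h1 : HasDerivWithinAt (fun u => ∫ t in (2:ℝ)..u, (primePi t - li t)) (primePi x - li x) (Ici x) x := by
    refine intervalIntegral.integral_hasDerivWithinAt_right (pl_ii hx.le) (s := Ici x) (t := Ioi x) ?_ ?_
    · refine ⟨Ioi x, self_mem_nhdsWithin, ?_⟩
      have := (pl_meas.mono_set (Ioi_subset_Ioi hx.le)).neg
      refine this.congr (Eventually.of_forall fun y => ?_)
      simp
    · exact ((pi_rc (by linarith)).mono Ioi_subset_Ici_self).sub (li_hd hx).continuousAt.continuousWithinAt
  have h2 := (h1.mono Ioi_subset_Ici_self).neg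
  refine h2.congr_deriv (by ring)

lemma fA_cont : ContinuousOn fA (Ici 2) := by
  intro x hx
  have hx : 2 ≤ x := hx
  have h := (intervalIntegral.continuousOn_primitive_interval' (pl_ii (x := x + 1) (by linarith)) left_mem_uIcc).neg
  rw [uIcc_of_le (by linarith)] at h
  refine (h x ⟨hx, by linarith⟩).mono_of_mem_nhdsWithin ?_
  filter_upwards [self_mem_nhdsWithin, mem_nhdsWithin_of_mem_nhds (Iio_mem_nhds (by linarith : x < x + 1))] with y h1 h2
  exact ⟨h1, le_of_lt h2⟩

lemma pl_bd : ∃ C : ℝ, 0 ≤ C ∧ ∀ x, 2 ≤ x → |li x - primePi x| ≤ C * x := by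
  obtain ⟨C, hC, h⟩ := li_bd
  refine ⟨C + 1, by linarith, fun x hx => ?_⟩
  have h1 := h x hx
  have h2 := pi_bd (x := x) (by linarith)
  rw [abs_le] at h1 h2 ⊢
  constructor <;> nlinarith

lemma fA_bd : ∃ C : ℝ, 0 ≤ C ∧ ∀ x, 2 ≤ x → |fA x| ≤ C * x ^ (2:ℝ) := by
  obtain ⟨C, hC, h⟩ := pl_bd
  refine ⟨C, hC, fun x hx => ?_⟩
  unfold fA
  rw [abs_neg]
  have h3 : ‖∫ t in (2:ℝ)..x, (primePi t - li t)‖ ≤ (C * x) * |x - 2| := by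
    apply intervalIntegral.norm_integral_le_of_norm_le_const
    intro u hu
    rw [uIoc_of_le hx] at hu
    rw [Real.norm_eq_abs, abs_sub_comm]
    exact (h u hu.1.le).trans (mul_le_mul_of_nonneg_left hu.2 hC)
  rw [abs_of_nonneg (by linarith), Real.norm_eq_abs] at h3
  rw [Real.rpow_two]
  nlinarith [mul_nonneg hC (by linarith : 0 ≤ x)]

lemma two_steps {s : ℂ} (hs : 1 < s.re) :
    s * (s + 1) * ∫ x in Ioi (2:ℝ), (fA x : ℂ) * (x:ℂ) ^ (-s - 2)
      = li 2 * (2:ℂ) ^ (-s) + (∫ x in Ioi (2:ℝ), ((1 / Real.log x : ℝ) : ℂ) * (x:ℂ) ^ (-s))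
        - s * ∫ x in Ioi (2:ℝ), (primePi x : ℂ) * (x:ℂ) ^ (-s - 1) := by
  obtain ⟨C1, hC1, h1⟩ := fA_bd
  obtain ⟨C2, hC2, h2⟩ := pl_bd
  obtain ⟨C3, hC3, h3⟩ := li_bd
  have e1 := ibp_inf (s := s + 1) (k := 2) (by simp; linarith) fA_cont (fun x hx => fA_hd hx) pl_meas h1
    (C' := C2) (fun x hx => by norm_num; exact h2 x hx)
  have e2 := ibp_inf (s := s) (k := 1) hs li_contIci (fun x hx => (li_hd hx).hasDerivWithinAt)
    (measurable_const.div Real.measurable_log).aestronglyMeasurable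
    (fun x hx => by rw [Real.rpow_one]; exact h3 x hx) (C' := 1 / Real.log 2)
    (fun x hx => by norm_num; simpa using invlog_bd hx)
  have hf2 : fA 2 = 0 := by simp [fA]
  rw [hf2] at e1
  simp only [show -(s+1) = -s - 1 by ring, show -s - 1 - 1 = -s - 2 by ring] at e1
  have i1 : IntegrableOn (fun x : ℝ => (li x : ℂ) * (x:ℂ) ^ (-s - 1)) (Ioi 2) :=
    int_pw ((li_contIci.mono Ioi_subset_Ici_self).aestronglyMeasurable measurableSet_Ioi) (k := 1) (C := C3)
      (fun x hx => by rw [Real.rpow_one]; exact h3 x hx) (by simp; linarith)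
  have i2 : IntegrableOn (fun x : ℝ => (primePi x : ℂ) * (x:ℂ) ^ (-s - 1)) (Ioi 2) :=
    int_pw pi_meas.aestronglyMeasurable (k := 1) (C := 1)
      (fun x hx => by rw [Real.rpow_one, one_mul]; exact pi_bd (by linarith)) (by simp; linarith)
  have e3 : ∫ x in Ioi (2:ℝ), ((li x - primePi x : ℝ) : ℂ) * (x:ℂ) ^ (-s - 1)
      = (∫ x in Ioi (2:ℝ), (li x : ℂ) * (x:ℂ) ^ (-s - 1)) - ∫ x in Ioi (2:ℝ), (primePi x : ℂ) * (x:ℂ) ^ (-s - 1) := by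
    rw [← integral_sub i1 i2]
    congr 1; ext x; push_cast; ring
  rw [e3] at e1
  rw [mul_assoc, e1, ← e2]
  push_cast; ring
end transf
end RHPi

namespace RHPi
section transf2
open Set Topology

lemma pInd_nonneg (n : ℕ) : 0 ≤ pInd n := by unfold pInd; split_ifs <;> norm_num

lemma D_eq {s : ℂ} (hs : 1 < s.re) :
    s * ∫ x in Ioi (2:ℝ), (primePi x : ℂ) * (x:ℂ) ^ (-s - 1) = LSeries (fun n => (pInd n : ℂ)) s := by
  rw [LSeries_eq_mul_integral_of_nonneg pInd (r := 1) zero_le_one hs ?_ pInd_nonneg]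
  · congr 1
    rw [← integral_Ici_eq_integral_Ioi]
    have h1 : ∀ t : ℝ, (∑ k ∈ Finset.Icc 1 ⌊t⌋₊, (pInd k : ℂ)) = (primePi t : ℂ) := by
      intro t
      rw [← Complex.ofReal_sum, sum_pInd]; rfl
    simp only [h1, show -(s + 1) = -s - 1 by ring]
    refine (setIntegral_eq_of_subset_of_forall_sdiff_eq_zero measurableSet_Ioi ?_ ?_).symm
    · intro x hx
      have hx : 2 ≤ x := hx
      show 1 < x
      linarith
    · rintro x ⟨h1, h2⟩
      have h1 : 1 < x := h1
      have h2 : x < 2 := not_le.1 h2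
      have hf : ⌊x⌋₊ = 1 := by
        rw [Nat.floor_eq_iff (by linarith)]
        constructor <;> norm_num <;> linarith
      have : primePi x = 0 := by
        unfold primePi
        rw [hf]; simp [Nat.primeCounting, Nat.primeCounting']; decide
      rw [this]; simp
  · refine Asymptotics.IsBigO.of_bound 1 (Eventually.of_forall fun n => ?_)
    simp only [sum_pInd, Real.rpow_one, one_mul, Real.norm_natCast]
    exact pc_le n

/-- the `1/log` transform -/
noncomputable def Qf (s : ℂ) : ℂ := ∫ x in Ioi (2:ℝ), ((1 / Real.log x : ℝ) : ℂ) * (x:ℂ) ^ (-s)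

noncomputable def hI : ℝ → ℂ := indicator (Ioi 2) (fun x => ((1 / Real.log x : ℝ) : ℂ))

lemma Qf_eq (s : ℂ) : Qf s = mellin hI (1 - s) := by
  unfold Qf mellin hI
  have h : ∀ t : ℝ, ((t:ℂ) ^ (1 - s - 1)) • (indicator (Ioi 2) (fun x : ℝ => ((1 / Real.log x : ℝ) : ℂ)) t)
      = indicator (Ioi 2) (fun x : ℝ => ((1 / Real.log x : ℝ) : ℂ) * (x:ℂ) ^ (-s)) t := by
    intro t
    by_cases ht : t ∈ Ioi (2:ℝ)
    · rw [indicator_of_mem ht, indicator_of_mem ht, smul_eq_mul, mul_comm, show 1 - s - 1 = -s by ring]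
    · rw [indicator_of_notMem ht, indicator_of_notMem ht, smul_zero]
  simp only [h]
  rw [setIntegral_indicator measurableSet_Ioi, Ioi_inter_Ioi]
  norm_num

lemma hI_bd (x : ℝ) : ‖hI x‖ ≤ 1 / Real.log 2 := by
  have := two_le_log2
  unfold hI
  by_cases hx : x ∈ Ioi (2:ℝ)
  · rw [indicator_of_mem hx, Complex.norm_real]
    exact invlog_bd (le_of_lt hx)
  · rw [indicator_of_notMem hx, norm_zero]; positivity

lemma Qf_hd {s : ℂ} (hs : 1 < s.re) : HasDerivAt Qf (-((2:ℂ) ^ (1 - s) / (s - 1))) s := by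
  have hmeas : Measurable hI :=
    (Complex.measurable_ofReal.comp (measurable_const.div Real.measurable_log)).indicator measurableSet_Ioi
  have hloc : LocallyIntegrableOn hI (Ioi 0) volume := by
    refine LocallyIntegrable.locallyIntegrableOn ?_ _
    refine (locallyIntegrable_const (1 / Real.log 2)).mono hmeas.aestronglyMeasurable
      (Eventually.of_forall fun x => ?_)
    exact (hI_bd x).trans (le_abs_self _)
  have hm := (mellin_hasDerivAt_of_isBigO_rpow (a := 0) (b := -s.re) (s := 1 - s) hloc ?_ ?_ ?_ ?_).2
  · have h2 : mellin (fun t => Real.log t • hI t) (1 - s) = (2:ℂ) ^ (1 - s) / (s - 1) := by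
      unfold mellin hI
      have h : ∀ t : ℝ, ((t:ℂ) ^ (1 - s - 1)) • (Real.log t • indicator (Ioi 2) (fun x : ℝ => ((1 / Real.log x : ℝ) : ℂ)) t)
          = indicator (Ioi 2) (fun x : ℝ => (x:ℂ) ^ (-s)) t := by
        intro t
        by_cases ht : t ∈ Ioi (2:ℝ)
        · have ht' : 2 < t := ht
          have hl : Real.log t ≠ 0 := (Real.log_pos (by linarith)).ne'
          rw [indicator_of_mem ht, indicator_of_mem ht, smul_eq_mul, show 1 - s - 1 = -s by ring,
            Complex.real_smul, ← Complex.ofReal_mul, mul_one_div_cancel hl]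
          simp
        · rw [indicator_of_notMem ht, indicator_of_notMem ht, smul_zero, smul_zero]
      simp only [h]
      rw [setIntegral_indicator measurableSet_Ioi, Ioi_inter_Ioi, max_eq_right (by norm_num),
        integral_Ioi_cpow_of_lt (by simp; linarith) (by norm_num)]
      have : s - 1 ≠ 0 := by
        intro h
        have : s = 1 := by linear_combination h
        rw [this] at hs; simp at hs
      rw [show -s + 1 = 1 - s by ring, show 1 - s = -(s - 1) by ring]
      push_cast
      rw [neg_div_neg_eq]
    rw [h2] at hm
    have h3 : HasDerivAt (fun s : ℂ => 1 - s) (-1) s := by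
      simpa using (hasDerivAt_id s).const_sub 1
    have h4 := HasDerivAt.comp s hm h3
    refine (h4.congr_deriv (by ring)).congr_of_eventuallyEq (Eventually.of_forall fun z => Qf_eq z)
  · refine Asymptotics.IsBigO.of_bound (1 / Real.log 2) (Eventually.of_forall fun x => ?_)
    simpa using hI_bd x
  · simp; linarith
  · refine Asymptotics.IsBigO.of_bound 1 ?_
    filter_upwards [mem_nhdsWithin_of_mem_nhds (Iio_mem_nhds (by norm_num : (0:ℝ) < 2))] with x hx
    have : x ∉ Ioi (2:ℝ) := by
      have hx : x < 2 := hx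
      simp only [mem_Ioi, not_lt]; exact hx.le
    unfold hI
    rw [indicator_of_notMem this, norm_zero]; positivity
  · simp

/-- von Mangoldt on non-primes -/
noncomputable def gI (n : ℕ) : ℝ := if n.Prime then 0 else ArithmeticFunction.vonMangoldt n

lemma gI_nonneg (n : ℕ) : 0 ≤ gI n := by
  unfold gI; split_ifs
  · exact le_rfl
  · exact ArithmeticFunction.vonMangoldt_nonneg

lemma gI_sum {s : ℂ} (hs : 1 / 2 < s.re) : LSeriesSummable (fun n => (gI n : ℂ)) s := by
  refine LSeriesSummable_of_sum_norm_bigO_and_nonneg (r := 1 / 2) ?_ gI_nonneg (by norm_num) hs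
  have h := Chebyshev.isBigO_psi_sub_theta_sqrt.comp_tendsto (tendsto_natCast_atTop_atTop (R := ℝ))
  refine (h.congr ?_ ?_)
  · intro n
    simp only [Function.comp, Pi.sub_apply]
    rw [Chebyshev.psi_sub_theta_eq_sum_not_prime, Nat.floor_natCast, Finset.sum_filter]
    refine Finset.sum_congr rfl fun k _ => ?_
    unfold gI
    by_cases hk : k.Prime <;> simp [hk]
  · intro n
    simp [Real.sqrt_eq_rpow]

lemma gI_absc : LSeries.abscissaOfAbsConv (fun n => (gI n : ℂ)) ≤ ((1/2 : ℝ) : EReal) := by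
  apply LSeries.abscissaOfAbsConv_le_of_forall_lt_LSeriesSummable
  intro y hy
  exact gI_sum (by simpa using hy)

lemma gI_diff : DifferentiableOn ℂ (LSeries (fun n => (gI n : ℂ))) {s : ℂ | 1 / 2 < s.re} := by
  refine (LSeries_analyticOnNhd _).differentiableOn.mono ?_
  intro s hs
  have hs : 1 / 2 < s.re := hs
  exact lt_of_le_of_lt gI_absc (by exact_mod_cast hs)

lemma D_hd {s : ℂ} (hs : 1 < s.re) : HasDerivAt (LSeries (fun n => (pInd n : ℂ)))
    (-(LSeries (fun n => (ArithmeticFunction.vonMangoldt n : ℂ)) s - LSeries (fun n => (gI n : ℂ)) s)) s := by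
  have ha : LSeries.abscissaOfAbsConv (fun n => (pInd n : ℂ)) ≤ 1 := by
    apply LSeries.abscissaOfAbsConv_le_of_le_const
    refine ⟨1, fun n _ => ?_⟩
    rw [Complex.norm_real]
    unfold pInd; split_ifs <;> norm_num
  have h := LSeries_hasDerivAt (lt_of_le_of_lt ha (by exact_mod_cast hs) : _ < ((s.re : ℝ) : EReal))
  refine h.congr_deriv ?_
  rw [← LSeries_sub (ArithmeticFunction.LSeriesSummable_vonMangoldt hs) (gI_sum (by linarith))]
  congr 2
  ext n
  simp only [LSeries.logMul, Pi.sub_apply, pInd, gI]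
  split_ifs with hp
  · rw [ArithmeticFunction.vonMangoldt_apply_prime hp]; simp
  · simp

/-- the correction term -/
noncomputable def qF (s : ℂ) : ℂ := LSeries (fun n => (gI n : ℂ)) s +
  (li 2 * (Real.log 2 : ℂ) * (2:ℂ) ^ (-s) + dslope (fun s : ℂ => (2:ℂ) ^ (1 - s)) 1 s)

lemma qF_diff : DifferentiableOn ℂ qF {s : ℂ | 1 / 2 < s.re} := by
  refine gI_diff.add (DifferentiableOn.add ?_ ?_)
  · intro s _
    refine DifferentiableAt.differentiableWithinAt ?_
    refine DifferentiableAt.const_mul ?_ _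
    exact DifferentiableAt.const_cpow (by fun_prop) (Or.inl two_ne_zero)
  · refine DifferentiableOn.mono ?_ (subset_univ _)
    rw [Complex.differentiableOn_dslope univ_mem]
    intro s _
    exact (DifferentiableAt.const_cpow (by fun_prop) (Or.inl two_ne_zero)).differentiableWithinAt

lemma F_hd {s : ℂ} (hs : 1 < s.re) :
    HasDerivAt (fun s => s * (s + 1) * ∫ x in Ioi (2:ℝ), (fA x : ℂ) * (x:ℂ) ^ (-s - 2))
      (- logDeriv riemannZeta₁ s - qF s) s := by
  have hs1 : s ≠ 1 := by rintro rfl; simp at hs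
  have h1 : HasDerivAt (fun s : ℂ => (2:ℂ) ^ (-s)) ((2:ℂ) ^ (-s) * Complex.log 2 * (-1)) s :=
    HasDerivAt.const_cpow (hasDerivAt_neg s) (Or.inl two_ne_zero)
  have h2 := ((h1.const_mul (li 2 : ℂ)).fun_add (Qf_hd hs)).fun_sub (D_hd hs)
  refine (h2.congr_deriv ?_).congr_of_eventuallyEq ?_
  · unfold qF
    rw [dslope_of_ne _ hs1, slope_def_field, logDeriv_zeta1 hs, Complex.ofReal_log (by norm_num)]
    have : s - 1 ≠ 0 := sub_ne_zero.2 hs1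
    simp only [sub_self, Complex.cpow_zero, Complex.ofReal_ofNat]
    field_simp
    ring
  · filter_upwards [(hp_open 1).mem_nhds hs] with z hz
    have hz : 1 < z.re := hz
    rw [two_steps hz, D_eq hz]
    rfl
end transf2

section final
open Set Topology ProbabilityTheory

noncomputable def dens (x : ℝ) : ℝ := fA x * x ^ (-2:ℝ)
noncomputable def mu : Measure ℝ := (volume.restrict (Ioi 2)).withDensity (fun x => ENNReal.ofReal (dens x))

lemma dens_meas : AEMeasurable (fun x => ENNReal.ofReal (dens x)) (volume.restrict (Ioi 2)) := by
  refine ENNReal.measurable_ofReal.comp_aemeasurable ?_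
  refine AEMeasurable.mul ?_ (by fun_prop)
  exact ((fA_cont.mono Ioi_subset_Ici_self).aestronglyMeasurable measurableSet_Ioi).aemeasurable

lemma mgf_eq (hf : ∀ x, 2 < x → 0 ≤ fA x) (s : ℂ) :
    complexMGF Real.log mu (-s) = ∫ x in Ioi (2:ℝ), (fA x : ℂ) * (x:ℂ) ^ (-s - 2) := by
  unfold complexMGF mu
  rw [integral_withDensity_eq_integral_toReal_smul₀ dens_meas (Eventually.of_forall fun x => ENNReal.ofReal_lt_top)]
  refine setIntegral_congr_fun measurableSet_Ioi fun x hx => ?_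
  have hx : 2 < x := hx
  have hx0 : 0 < x := by linarith
  have hxc : (x:ℂ) ≠ 0 := by exact_mod_cast hx0.ne'
  have hd : 0 ≤ dens x := mul_nonneg (hf x hx) (by positivity)
  rw [ENNReal.toReal_ofReal hd, Complex.real_smul, dens, Complex.ofReal_mul, Complex.ofReal_cpow hx0.le,
    mul_assoc, sub_eq_add_neg, Complex.cpow_add _ _ hxc, Complex.cpow_def_of_ne_zero hxc (-s), Complex.ofReal_log hx0.le]
  push_cast
  ring_nf

lemma mgf_int (hf : ∀ x, 2 < x → 0 ≤ fA x) : Iio (-1) ⊆ integrableExpSet Real.log mu := by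
  intro t ht
  have ht : t < -1 := ht
  show Integrable (fun x => Real.exp (t * Real.log x)) mu
  unfold mu
  obtain ⟨C, hC, hb⟩ := fA_bd
  rw [integrable_withDensity_iff_integrable_smul₀' dens_meas (Eventually.of_forall fun x => ENNReal.ofReal_lt_top)]
  have h1 : IntegrableOn (fun x : ℝ => C * x ^ t) (Ioi 2) :=
    (integrableOn_Ioi_rpow_of_lt ht (by norm_num)).const_mul C
  refine Integrable.mono' h1 ?_ ?_
  · refine AEMeasurable.aestronglyMeasurable ?_
    exact dens_meas.ennreal_toReal.smul (by fun_prop)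
  · filter_upwards [ae_restrict_mem measurableSet_Ioi] with x hx
    have hx : 2 < x := hx
    have hx0 : 0 < x := by linarith
    have hd : 0 ≤ dens x := mul_nonneg (hf x hx) (by positivity)
    have hdC : dens x ≤ C := by
      have h2 := (le_abs_self _).trans (hb x hx.le)
      calc dens x ≤ C * x ^ (2:ℝ) * x ^ (-2:ℝ) := mul_le_mul_of_nonneg_right h2 (by positivity)
        _ = C := by rw [mul_assoc, ← Real.rpow_add hx0]; simp
    rw [ENNReal.toReal_ofReal hd, smul_eq_mul, norm_mul, Real.norm_of_nonneg hd,
      Real.norm_of_nonneg (Real.exp_pos _).le, mul_comm t, ← Real.rpow_def_of_pos hx0]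
    exact mul_le_mul_of_nonneg_right hdC (by positivity)

theorem backward (h : ∀ x : ℝ, x > 2 → (∫ t in (2:ℝ)..x, (primePi t - li t)) < 0) : RiemannHypothesis := by
  have hf : ∀ x, 2 < x → 0 ≤ fA x := fun x hx => by
    have := h x hx
    unfold fA; linarith
  apply RH_of_nz
  refine closing (μ := mu) (X := Real.log) (q := qF) Real.measurable_log.aemeasurable ?_ (mgf_int hf) qF_diff ?_
  · refine (withDensity_absolutelyContinuous _ _).ae_le ?_
    filter_upwards [ae_restrict_mem measurableSet_Ioi] with x hx
    have hx : 2 < x := hx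
    exact Real.log_nonneg (by linarith)
  · intro s hs
    simp only [mgf_eq hf]
    exact F_hd hs
end final
end RHPi

theorem riemannHypothesis_iff_integral_pi_sub_li_neg :
    RiemannHypothesis ↔
      ∀ x : ℝ, x > 2 → (∫ t in (2:ℝ)..x, (primePi t - li t)) < 0 :=
  ⟨fun h x hx => RHPi.forward (fun s hs => RHPi.nz_of_RH h hs) hx, fun h => RHPi.backward h⟩
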